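/- arXiv:math/0303228 — 6 statements merged into one kernel-verified Lean document; each statement's English description precedes it below -/
import Mathlib

section
/- Assume the φ_i lie in ℤ^r, they span ℤ^r over ℤ, every basic subset σ satisfies |det(φ_i : i ∈ σ)| = 1 (the system is unimodular), and the only x ∈ ℝ^N with x ≥ 0 and Σ_i x_i φ_i = 0 is x = 0. Then for every combinatorial chamber I there exists a polynomial P in r variables with rational coefficients such that for every a ∈ F(I) ∩ ℤ^r, the number of N-tuples (x_1,…,x_N) of nonnegative integers with Σ_i x_i φ_i = a equals P(a). -/
noncomputable section

/-- The closed convex cone of nonnegative linear combinations of `{φ i : i ∈ σ}`. -/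
def coneOf {N r : ℕ} (φ : Fin N → (Fin r → ℝ)) (σ : Finset (Fin N)) : Set (Fin r → ℝ) :=
  {y | ∃ c : Fin N → ℝ, (∀ i, 0 ≤ c i) ∧ (∀ i, i ∉ σ → c i = 0) ∧ y = ∑ i, c i • φ i}

/-- `σ` is a basic subset: `r` indices whose vectors are linearly independent. -/
def IsBasic {N r : ℕ} (φ : Fin N → (Fin r → ℝ)) (σ : Finset (Fin N)) : Prop :=
  σ.card = r ∧ LinearIndependent ℝ (fun i : {i // i ∈ σ} => φ i)

/-- `F(I) = ⋂_{σ ∈ I} C(σ)`. -/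
def Fcone {N r : ℕ} (φ : Fin N → (Fin r → ℝ)) (I : Set (Finset (Fin N))) :
    Set (Fin r → ℝ) :=
  ⋂ σ ∈ I, coneOf φ σ

/-- `I` is feasible when `F(I)` has nonempty interior. -/
def IsFeasible {N r : ℕ} (φ : Fin N → (Fin r → ℝ)) (I : Set (Finset (Fin N))) : Prop :=
  (interior (Fcone φ I)).Nonempty

/-- A combinatorial chamber: a maximal feasible set of basic subsets. -/
def IsChamber {N r : ℕ} (φ : Fin N → (Fin r → ℝ)) (I : Set (Finset (Fin N))) : Prop :=
  (∀ σ ∈ I, IsBasic φ σ) ∧ IsFeasible φ I ∧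
  ∀ J : Set (Finset (Fin N)), I ⊆ J → (∀ σ ∈ J, IsBasic φ σ) → IsFeasible φ J → J = I

/-- A wall: an `(r-1)`-dimensional subspace spanned by `r - 1` linearly independent
vectors from `Δ⁺`. -/
def IsWall {N r : ℕ} (φ : Fin N → (Fin r → ℝ)) (W : Submodule ℝ (Fin r → ℝ)) : Prop :=
  ∃ s : Finset (Fin N), s.card = r - 1 ∧
    LinearIndependent ℝ (fun i : {i // i ∈ s} => φ i) ∧
    W = Submodule.span ℝ (φ '' (s : Set (Fin N)))

/-- The combinatorial data of a unimodular vector configuration `φ` in an abelian group: a family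
`ℬ` of bases, together with the integral coordinate functions `y σ i` of each `σ ∈ ℬ`. -/
structure UnimodularBases {ι M : Type*} [DecidableEq ι] [AddCommGroup M]
    (φ : ι → M) (ℬ : Finset (Finset ι)) (y : Finset ι → ι → M →+ ℤ) : Prop where
  coord_apply : ∀ σ ∈ ℬ, ∀ i ∈ σ, ∀ j ∈ σ, y σ i (φ j) = if i = j then 1 else 0
  expand : ∀ σ ∈ ℬ, ∀ a, ∑ i ∈ σ, y σ i a • φ i = a
  exchange : ∀ σ ∈ ℬ, ∀ i ∈ σ, ∀ j, y σ i (φ j) ≠ 0 → insert j (σ.erase i) ∈ ℬ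

namespace UnimodularBases

variable {ι M : Type*} [DecidableEq ι] [AddCommGroup M]
  {φ : ι → M} {ℬ : Finset (Finset ι)} {y : Finset ι → ι → M →+ ℤ}

theorem coord_self (S : UnimodularBases φ ℬ y) {σ : Finset ι} (hσ : σ ∈ ℬ) {i : ι} (hi : i ∈ σ) :
    y σ i (φ i) = 1 := by
  simp [S.coord_apply σ hσ i hi i hi]

theorem coord_ne (S : UnimodularBases φ ℬ y) {σ : Finset ι} (hσ : σ ∈ ℬ) {i j : ι} (hi : i ∈ σ)
    (hj : j ∈ σ) (hij : i ≠ j) : y σ i (φ j) = 0 := by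
  simp [S.coord_apply σ hσ i hi j hj, hij]

theorem apply_eq_sum (S : UnimodularBases φ ℬ y) {σ : Finset ι} (hσ : σ ∈ ℬ) (f : M →+ ℤ) (a : M) :
    f a = ∑ i ∈ σ, y σ i a * f (φ i) := by
  conv_lhs => rw [← S.expand σ hσ a]
  simp [map_sum]

theorem eq_of_subset (S : UnimodularBases φ ℬ y) {σ τ : Finset ι} (hσ : σ ∈ ℬ) (hτ : τ ∈ ℬ)
    (h : σ ⊆ τ) : σ = τ := by
  refine h.antisymm fun j hj => ?_
  by_contra hjσ
  have h1 := S.apply_eq_sum hσ (y τ j) (φ j)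
  rw [S.coord_self hτ hj, Finset.sum_eq_zero] at h1
  · exact one_ne_zero h1
  · intro i hi
    rw [S.coord_ne hτ hj (h hi) (fun e => hjσ (e ▸ hi)), mul_zero]

section Exchange

variable (S : UnimodularBases φ ℬ y) {σ : Finset ι} (hσ : σ ∈ ℬ) {i : ι} (hi : i ∈ σ) {j : ι}
  (hj : y σ i (φ j) ≠ 0)

include S hσ hi hj

theorem notMem_erase : j ∉ σ.erase i := by
  intro h
  rw [Finset.mem_erase] at h
  exact hj (S.coord_ne hσ hi h.2 h.1.symm)

theorem coord_exchange_mul (a : M) :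
    y σ i a = y σ i (φ j) * y (insert j (σ.erase i)) j a := by
  have hn := S.notMem_erase hσ hi hj
  rw [S.apply_eq_sum (S.exchange σ hσ i hi j hj) (y σ i) a, Finset.sum_insert hn,
    Finset.sum_eq_zero, add_zero, mul_comm]
  intro l hl
  rw [Finset.mem_erase] at hl
  rw [S.coord_ne hσ hi hl.2 hl.1.symm, mul_zero]

theorem coord_eq_one_or : y σ i (φ j) = 1 ∨ y σ i (φ j) = -1 := by
  have h := S.coord_exchange_mul hσ hi hj (φ i)
  rw [S.coord_self hσ hi] at h
  exact Int.isUnit_iff.1 (IsUnit.of_mul_eq_one _ h.symm)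

theorem coord_mul_self : y σ i (φ j) * y σ i (φ j) = 1 := by
  rcases S.coord_eq_one_or hσ hi hj with h | h <;> simp [h]

theorem coord_exchange_new (a : M) :
    y (insert j (σ.erase i)) j a = y σ i (φ j) * y σ i a := by
  rw [S.coord_exchange_mul hσ hi hj a, ← mul_assoc, S.coord_mul_self hσ hi hj, one_mul]

theorem coord_exchange_old {l : ι} (hl : l ∈ σ.erase i) (a : M) :
    y σ l a = y (insert j (σ.erase i)) l a
      + y σ l (φ j) * y (insert j (σ.erase i)) j a := by
  have hn := S.notMem_erase hσ hi hj
  have hl' := Finset.mem_erase.1 hl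
  rw [S.apply_eq_sum (S.exchange σ hσ i hi j hj) (y σ l) a, Finset.sum_insert hn,
    Finset.sum_eq_single_of_mem l hl, S.coord_self hσ hl'.2]
  · ring
  · intro m hm hml
    rw [S.coord_ne hσ hl'.2 (Finset.mem_erase.1 hm).2 hml.symm, mul_zero]

end Exchange

end UnimodularBases

/-- The multiplicative character taking the value `Q i` on the `i`-th vector of the basis `σ`. -/
def basisChar {ι M K : Type*} [AddCommGroup M] [Field K] (y : Finset ι → ι → M →+ ℤ) (Q : ι → K)
    (σ : Finset ι) (a : M) : K :=
  ∏ i ∈ σ, Q i ^ y σ i a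

section Char

variable {ι M K : Type*} [AddCommGroup M] [Field K]
  {y : Finset ι → ι → M →+ ℤ} {Q : ι → K}

theorem basisChar_ne_zero (hQ : ∀ i, Q i ≠ 0) (σ : Finset ι) (a : M) : basisChar y Q σ a ≠ 0 :=
  Finset.prod_ne_zero_iff.2 fun i _ => zpow_ne_zero _ (hQ i)

theorem basisChar_sub (hQ : ∀ i, Q i ≠ 0) (σ : Finset ι) (a b : M) :
    basisChar y Q σ (a - b) = basisChar y Q σ a / basisChar y Q σ b := by
  simp only [basisChar, ← Finset.prod_div_distrib, map_sub, zpow_sub₀ (hQ _)]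

variable [DecidableEq ι] {φ : ι → M} {ℬ : Finset (Finset ι)}

theorem UnimodularBases.basisChar_mem (S : UnimodularBases φ ℬ y) {σ : Finset ι} (hσ : σ ∈ ℬ)
    {i : ι} (hi : i ∈ σ) : basisChar y Q σ (φ i) = Q i := by
  rw [basisChar, Finset.prod_eq_single_of_mem i hi, S.coord_self hσ hi, zpow_one]
  intro j hj hji
  rw [S.coord_ne hσ hj hi hji, zpow_zero]

theorem UnimodularBases.basisChar_exchange (S : UnimodularBases φ ℬ y) (hQ : ∀ i, Q i ≠ 0)
    {σ : Finset ι} (hσ : σ ∈ ℬ) {i : ι} (hi : i ∈ σ) {j : ι} (hj : y σ i (φ j) ≠ 0) (a : M) :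
    basisChar y Q (insert j (σ.erase i)) a =
      basisChar y Q σ a * ((Q j / basisChar y Q σ (φ j)) ^ y σ i (φ j)) ^ y σ i a := by
  have hn := S.notMem_erase hσ hi hj
  have hE := basisChar_ne_zero (y := y) hQ σ (φ j)
  have key : basisChar y Q σ a = (∏ l ∈ σ.erase i, Q l ^ y (insert j (σ.erase i)) l a) *
      basisChar y Q σ (φ j) ^ y (insert j (σ.erase i)) j a := by
    rw [basisChar, basisChar, ← Finset.mul_prod_erase σ _ hi, ← Finset.mul_prod_erase σ _ hi,
      S.coord_exchange_mul hσ hi hj a, mul_zpow, zpow_mul, ← Finset.prod_zpow, mul_left_comm,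
      ← Finset.prod_mul_distrib]
    congr 1
    refine Finset.prod_congr rfl fun l hl => ?_
    rw [S.coord_exchange_old hσ hi hj hl a, zpow_add₀ (hQ l), zpow_mul]
  rw [key, basisChar, Finset.prod_insert hn, ← zpow_mul, ← S.coord_exchange_new hσ hi hj,
    div_zpow]
  field_simp

end Char

section Counting

variable {ι M K : Type*} [DecidableEq ι] [AddCommGroup M] [Field K]

/-- The tuples of natural numbers supported on `X` which express `a` through the vectors `φ i`. -/
def solutionSet (φ : ι → M) (X : Finset ι) (a : M) : Set (ι → ℕ) :=
  {x | (∀ i, i ∉ X → x i = 0) ∧ ∑ i ∈ X, x i • φ i = a}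

/-- The weighted number of expressions of `a` through the vectors `φ i`, `i ∈ X`. -/
noncomputable def weightedCount (φ : ι → M) (Q : ι → K) (X : Finset ι) (a : M) : K :=
  ∑ᶠ x ∈ solutionSet φ X a, ∏ i ∈ X, Q i ^ x i

variable {φ : ι → M} {Q : ι → K}

omit [DecidableEq ι] in
theorem solutionSet_finite [Fintype ι] (hpt : ∀ x : ι → ℕ, ∑ i, x i • φ i = 0 → x = 0)
    (X : Finset ι) (a : M) : (solutionSet φ X a).Finite := by
  refine WellQuasiOrderedLE.finite_of_isAntichain ?_
  intro x hx z hz hne hle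
  apply hne
  have hle' : ∀ i, x i ≤ z i := hle
  have h0 : (fun i => z i - x i) = 0 := by
    apply hpt
    have hX : ∀ w ∈ solutionSet φ X a, ∑ i, w i • φ i = a := by
      rintro w ⟨hw, hw'⟩
      rw [← hw', eq_comm]
      refine Finset.sum_subset (Finset.subset_univ X) fun i _ hi => ?_
      rw [hw i hi, zero_smul]
    have : ∑ i, (z i - x i) • φ i + ∑ i, x i • φ i = ∑ i, z i • φ i := by
      rw [← Finset.sum_add_distrib]
      refine Finset.sum_congr rfl fun i _ => ?_
      rw [← add_smul, Nat.sub_add_cancel (hle' i)]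
    rw [hX x hx, hX z hz] at this
    simpa using this
  funext i
  have := congrFun h0 i
  simp only [Pi.zero_apply] at this
  have := hle' i
  omega

theorem weightedCount_insert [Fintype ι] (hpt : ∀ x : ι → ℕ, ∑ i, x i • φ i = 0 → x = 0)
    {X : Finset ι} {k : ι} (hk : k ∉ X) (a : M) :
    weightedCount φ Q (insert k X) a =
      weightedCount φ Q X a + Q k * weightedCount φ Q (insert k X) (a - φ k) := by
  have hunion : solutionSet φ (insert k X) a = solutionSet φ X a ∪
      (fun x : ι → ℕ => x + Pi.single k 1) '' solutionSet φ (insert k X) (a - φ k) := by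
    ext x
    constructor
    · rintro ⟨hx, hx'⟩
      rw [Finset.sum_insert hk] at hx'
      by_cases h0 : x k = 0
      · left
        refine ⟨fun i hi => ?_, ?_⟩
        · by_cases hik : i = k
          · rw [hik, h0]
          · exact hx i (by simp [hik, hi])
        · rwa [h0, zero_smul, zero_add] at hx'
      · right
        have hdec : x - Pi.single k 1 + Pi.single k 1 = x := by
          funext i
          by_cases hik : i = k
          · subst hik; simp; omega
          · simp [hik]
        refine ⟨x - Pi.single k 1, ⟨fun i hi => ?_, ?_⟩, hdec⟩
        · simp [hx i hi]
        · rw [Finset.sum_insert hk, ← hx']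
          have h1 : ∑ i ∈ X, (x - Pi.single k 1 : ι → ℕ) i • φ i = ∑ i ∈ X, x i • φ i := by
            refine Finset.sum_congr rfl fun i hi => ?_
            have : i ≠ k := fun e => hk (e ▸ hi)
            simp [this]
          have h2 : (x - Pi.single k 1 : ι → ℕ) k • φ k + φ k = x k • φ k := by
            rw [← succ_nsmul]
            congr 1
            simp; omega
          rw [h1, ← h2]
          abel
    · rintro (⟨hx, hx'⟩ | ⟨z, ⟨hz, hz'⟩, rfl⟩)
      · refine ⟨fun i hi => hx i fun h => hi (Finset.mem_insert_of_mem h), ?_⟩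
        rw [Finset.sum_insert hk, hx k hk, zero_smul, zero_add, hx']
      · refine ⟨fun i hi => ?_, ?_⟩
        · have : i ≠ k := fun e => hi (e ▸ Finset.mem_insert_self _ _)
          simp [hz i hi, this]
        · simp only [Pi.add_apply, add_smul, Finset.sum_add_distrib, hz']
          rw [Finset.sum_eq_single_of_mem k (Finset.mem_insert_self _ _)]
          · simp
          · intro j _ hj
            simp [hj]
  have hdisj : Disjoint (solutionSet φ X a)
      ((fun x : ι → ℕ => x + Pi.single k 1) '' solutionSet φ (insert k X) (a - φ k)) := by
    rw [Set.disjoint_left]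
    rintro x ⟨hx, -⟩ ⟨z, -, rfl⟩
    simpa using hx k hk
  rw [weightedCount, hunion, finsum_mem_union hdisj (solutionSet_finite hpt X a)
    ((solutionSet_finite hpt _ _).image _), finsum_mem_image (add_left_injective _).injOn]
  congr 1
  · refine finsum_mem_congr rfl fun x hx => ?_
    rw [Finset.prod_insert hk, hx.1 k hk, pow_zero, one_mul]
  · rw [weightedCount, mul_finsum_mem]
    refine finsum_mem_congr rfl fun x _ => ?_
    rw [Finset.prod_insert hk, Finset.prod_insert hk]
    have : ∏ i ∈ X, Q i ^ (x + Pi.single k 1 : ι → ℕ) i = ∏ i ∈ X, Q i ^ x i := by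
      refine Finset.prod_congr rfl fun i hi => ?_
      have : i ≠ k := fun e => hk (e ▸ hi)
      simp [this]
    rw [this]
    simp [pow_succ]
    ring

theorem exists_weightedCount_eq_zero [Fintype ι]
    (hpt : ∀ x : ι → ℕ, ∑ i, x i • φ i = 0 → x = 0) {X : Finset ι} {k : ι} (hk : k ∈ X) (a : M) :
    ∃ n₀ : ℕ, ∀ n ≥ n₀, weightedCount φ Q X (a - n • φ k) = 0 := by
  obtain ⟨b, hb⟩ := ((solutionSet_finite hpt X a).image fun x => x k).bddAbove
  refine ⟨b + 1, fun n hn => ?_⟩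
  rw [weightedCount, finsum_mem_eq_zero_of_forall_eq_zero]
  rintro x ⟨hx, hx'⟩
  exfalso
  have hmem : x + Pi.single k n ∈ solutionSet φ X a := by
    refine ⟨fun i hi => ?_, ?_⟩
    · have : i ≠ k := fun e => hi (e ▸ hk)
      simp [hx i hi, this]
    · simp only [Pi.add_apply, add_smul, Finset.sum_add_distrib, hx']
      rw [Finset.sum_eq_single_of_mem k hk]
      · simp
      · intro j _ hj
        simp [hj]
  have := hb ⟨_, hmem, rfl⟩
  simp at this
  omega

theorem UnimodularBases.weightedCount_basis {ℬ : Finset (Finset ι)} {y : Finset ι → ι → M →+ ℤ}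
    (S : UnimodularBases φ ℬ y) {σ : Finset ι} (hσ : σ ∈ ℬ) (a : M) [Decidable (∀ i ∈ σ, 0 ≤ y σ i a)] :
    weightedCount φ Q σ a = if ∀ i ∈ σ, 0 ≤ y σ i a then basisChar y Q σ a else 0 := by
  have hcoord : ∀ x ∈ solutionSet φ σ a, ∀ i ∈ σ, (x i : ℤ) = y σ i a := by
    rintro x ⟨-, hx⟩ i hi
    rw [← hx, map_sum, Finset.sum_eq_single_of_mem i hi]
    · simp [S.coord_self hσ hi]
    · intro j hj hji
      simp [S.coord_ne hσ hi hj hji.symm]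
  split_ifs with h
  · have : solutionSet φ σ a = {fun i => if i ∈ σ then (y σ i a).toNat else 0} := by
      ext x
      rw [Set.mem_singleton_iff]
      constructor
      · intro hx
        funext i
        split_ifs with hi
        · rw [← hcoord x hx i hi, Int.toNat_natCast]
        · exact hx.1 i hi
      · rintro rfl
        refine ⟨fun i hi => by simp [hi], ?_⟩
        conv_rhs => rw [← S.expand σ hσ a]
        refine Finset.sum_congr rfl fun i hi => ?_
        beta_reduce
        rw [if_pos hi, ← natCast_zsmul, Int.toNat_of_nonneg (h i hi)]
    rw [weightedCount, this, finsum_mem_singleton, basisChar]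
    refine Finset.prod_congr rfl fun i hi => ?_
    beta_reduce
    rw [if_pos hi, ← zpow_natCast, Int.toNat_of_nonneg (h i hi)]
  · rw [weightedCount, finsum_mem_eq_zero_of_forall_eq_zero]
    intro x hx
    exact absurd (fun i hi => by rw [← hcoord x hx i hi]; positivity) h

end Counting

section VertexSum

variable {ι M K : Type*} [DecidableEq ι] [AddCommGroup M] [Field K]

/-- The contribution of the basis `σ` to Brion's formula for the subsystem `X`. -/
def vertexTerm (φ : ι → M) (y : Finset ι → ι → M →+ ℤ) (Q : ι → K) (X σ : Finset ι) (a : M) : K :=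
  basisChar y Q σ a / ∏ j ∈ X \ σ, (1 - Q j / basisChar y Q σ (φ j))

/-- The sum of the contributions of the bases contained in `X`, with weights `w`. -/
def vertexSum (φ : ι → M) (ℬ : Finset (Finset ι)) (y : Finset ι → ι → M →+ ℤ) (Q : ι → K)
    (X : Finset ι) (w : Finset ι → K) (a : M) : K :=
  ∑ σ ∈ ℬ with σ ⊆ X, w σ * vertexTerm φ y Q X σ a

variable {φ : ι → M} {ℬ : Finset (Finset ι)} {y : Finset ι → ι → M →+ ℤ} {Q : ι → K}

theorem UnimodularBases.vertexSum_insert (S : UnimodularBases φ ℬ y) (hQ : ∀ i, Q i ≠ 0)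
    (hgen : ∀ σ ∈ ℬ, ∀ j, j ∉ σ → Q j ≠ basisChar y Q σ (φ j))
    {X : Finset ι} {k : ι} (hk : k ∉ X) (w : Finset ι → K) (a : M) :
    vertexSum φ ℬ y Q (insert k X) w a =
      vertexSum φ ℬ y Q X w a + Q k * vertexSum φ ℬ y Q (insert k X) w (a - φ k) := by
  have hX : vertexSum φ ℬ y Q X w a =
      ∑ σ ∈ ℬ with σ ⊆ insert k X, if σ ⊆ X then w σ * vertexTerm φ y Q X σ a else 0 := by
    rw [← Finset.sum_filter, Finset.filter_filter, vertexSum]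
    refine Finset.sum_congr (Finset.filter_congr fun σ _ => ?_) fun _ _ => rfl
    exact ⟨fun h => ⟨h.trans (Finset.subset_insert _ _), h⟩, fun h => h.2⟩
  rw [hX, vertexSum, vertexSum, Finset.mul_sum, ← Finset.sum_add_distrib]
  refine Finset.sum_congr rfl fun σ hσ => ?_
  obtain ⟨hσ, hσX⟩ := Finset.mem_filter.1 hσ
  simp only [vertexTerm, basisChar_sub hQ]
  split_ifs with h
  · have hkσ : k ∉ σ := fun e => hk (h e)
    have hE := basisChar_ne_zero (y := y) hQ σ (φ k)
    rw [Finset.insert_sdiff_of_notMem _ hkσ, Finset.prod_insert (by simp [hk])]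
    have h1 : 1 - Q k / basisChar y Q σ (φ k) ≠ 0 := by
      rw [sub_ne_zero]
      intro e
      apply hgen σ hσ k hkσ
      field_simp at e
      exact e.symm
    have h2 : ∏ j ∈ X \ σ, (1 - Q j / basisChar y Q σ (φ j)) ≠ 0 := by
      refine Finset.prod_ne_zero_iff.2 fun j hj => ?_
      rw [sub_ne_zero]
      intro e
      apply hgen σ hσ j (Finset.mem_sdiff.1 hj).2
      have hE := basisChar_ne_zero (y := y) hQ σ (φ j)
      field_simp at e
      exact e.symm
    generalize ∏ j ∈ X \ σ, (1 - Q j / basisChar y Q σ (φ j)) = D at h2 ⊢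
    have h1' : basisChar y Q σ (φ k) - Q k ≠ 0 := by
      rw [sub_ne_zero]
      exact (hgen σ hσ k hkσ).symm
    field_simp
    ring
  · have hkσ : k ∈ σ := by
      by_contra hkσ
      exact h fun i hi => (Finset.mem_insert.1 (hσX hi)).resolve_left fun e => hkσ (e ▸ hi)
    rw [S.basisChar_mem hσ hkσ]
    have := hQ k
    field_simp
    ring

end VertexSum

theorem sum_pow_div_prod_sub_eq_zero {ι K : Type*} [DecidableEq ι] [Field K] {s : Finset ι}
    {z : ι → K} (hz : Set.InjOn z s) {m : ℕ} (hm : m + 1 < s.card) :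
    ∑ i ∈ s, z i ^ m / ∏ j ∈ s.erase i, (z i - z j) = 0 := by
  have hdeg : (Polynomial.X ^ m : Polynomial K).degree < s.card := by
    rw [Polynomial.degree_X_pow]
    exact_mod_cast (by omega : m < s.card)
  have := Lagrange.coeff_eq_sum hz hdeg
  simp only [Polynomial.eval_pow, Polynomial.eval_X] at this
  rw [← this, Polynomial.coeff_X_pow, if_neg (by omega)]

section WallCrossing

variable {ι M K : Type*} [DecidableEq ι] [AddCommGroup M] [Field K]
  {φ : ι → M} {ℬ : Finset (Finset ι)} {y : Finset ι → ι → M →+ ℤ} {Q : ι → K}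

/-- The residue theorem for the bases containing a given basis of a wall. -/
theorem UnimodularBases.sum_vertexTerm_eq_zero (S : UnimodularBases φ ℬ y) (hQ : ∀ i, Q i ≠ 0)
    (hgen : ∀ σ ∈ ℬ, ∀ j, j ∉ σ → Q j ≠ basisChar y Q σ (φ j))
    {X σ : Finset ι} (hσ : σ ∈ ℬ) {i₀ : ι} (hi₀ : i₀ ∈ σ) {a : M}
    (hpos : -((X.filter fun j => y σ i₀ (φ j) = 1).card : ℤ) < y σ i₀ a)
    (hneg : y σ i₀ a < ((X.filter fun j => y σ i₀ (φ j) = -1).card : ℤ)) :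
    ∑ i ∈ X with y σ i₀ (φ i) ≠ 0,
      (y σ i₀ (φ i) : K) * vertexTerm φ y Q X (insert i (σ.erase i₀)) a = 0 := by
  set h := y σ i₀ with hh
  set E := basisChar y Q σ with hE
  have hE0 : ∀ b, E b ≠ 0 := basisChar_ne_zero hQ σ
  set X₁ := X.filter fun j => h (φ j) ≠ 0 with hX₁
  set p := (X.filter fun j => h (φ j) = 1).card with hp
  set z : ι → K := fun i => (Q i / E (φ i)) ^ h (φ i) with hzdef
  have hz0 : ∀ i, z i ≠ 0 := fun i => zpow_ne_zero _ (div_ne_zero (hQ i) (hE0 _))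
  have hsq : ∀ j, h (φ j) ≠ 0 → h (φ j) * h (φ j) = 1 := fun j hj => S.coord_mul_self hσ hi₀ hj
  have hor : ∀ j, h (φ j) ≠ 0 → h (φ j) = 1 ∨ h (φ j) = -1 :=
    fun j hj => S.coord_eq_one_or hσ hi₀ hj
  have hzpow : ∀ j, h (φ j) ≠ 0 → z j ^ h (φ j) = Q j / E (φ j) := fun j hj => by
    rw [hzdef]
    simp only
    rw [← zpow_mul, hsq j hj, zpow_one]
  have hchar : ∀ i, h (φ i) ≠ 0 → ∀ b,
      basisChar y Q (insert i (σ.erase i₀)) b = E b * z i ^ h b :=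
    fun i hi b => S.basisChar_exchange hQ hσ hi₀ hi b
  have hzero : ∀ j ∈ σ.erase i₀, h (φ j) = 0 := fun j hj =>
    S.coord_ne hσ hi₀ (Finset.mem_erase.1 hj).2 (Finset.mem_erase.1 hj).1.symm
  have hinj : Set.InjOn z X₁ := by
    intro i hi j hj hij
    by_contra hne
    have hi' : h (φ i) ≠ 0 := (Finset.mem_filter.1 hi).2
    have hj' : h (φ j) ≠ 0 := (Finset.mem_filter.1 hj).2
    refine hgen _ (S.exchange σ hσ i₀ hi₀ i hi') j ?_ ?_
    · rw [Finset.mem_insert, not_or]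
      exact ⟨fun e => hne e.symm, fun e => hj' (hzero j e)⟩
    · rw [hchar i hi', hij, hzpow j hj']
      have := hE0 (φ j)
      field_simp
  set κ : ι → K := fun j => if h (φ j) = 1 then 1 else -(z j)⁻¹ with hκ
  set D₀ := ∏ j ∈ (X.filter fun j => h (φ j) = 0) \ σ.erase i₀, (1 - Q j / E (φ j)) with hD₀
  have hcard : p + (X.filter fun j => h (φ j) = -1).card = X₁.card := by
    rw [hp, ← Finset.card_union_of_disjoint]
    · congr 1
      ext j
      simp only [hX₁, Finset.mem_union, Finset.mem_filter]
      constructor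
      · rintro (⟨hj, e⟩ | ⟨hj, e⟩) <;> exact ⟨hj, by rw [e]; decide⟩
      · rintro ⟨hj, e⟩
        exact (hor j e).imp (fun e => ⟨hj, e⟩) fun e => ⟨hj, e⟩
    · rw [Finset.disjoint_filter]
      intro j _ e1 e2
      rw [e1] at e2
      exact absurd e2 (by decide)
  obtain ⟨m, hm⟩ : ∃ m : ℕ, h a + p - 1 = m := Int.eq_ofNat_of_zero_le (by omega)
  have hterm : ∀ i ∈ X₁, (h (φ i) : K) * vertexTerm φ y Q X (insert i (σ.erase i₀)) a =
      E a / (D₀ * ∏ j ∈ X₁, κ j) * (z i ^ m / ∏ j ∈ X₁.erase i, (z i - z j)) := by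
    intro i hi
    have hi' : h (φ i) ≠ 0 := (Finset.mem_filter.1 hi).2
    have hsplit : X \ insert i (σ.erase i₀) =
        ((X.filter fun j => h (φ j) = 0) \ σ.erase i₀) ∪ X₁.erase i := by
      ext j
      simp only [Finset.mem_sdiff, Finset.mem_insert, not_or, Finset.mem_union, Finset.mem_filter,
        Finset.mem_erase (a := j) (b := i), hX₁]
      have h1 := hzero j
      have h2 : j = i → h (φ j) ≠ 0 := fun e => e ▸ hi'
      tauto
    have hdisj : Disjoint ((X.filter fun j => h (φ j) = 0) \ σ.erase i₀) (X₁.erase i) := by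
      rw [Finset.disjoint_left]
      intro j hj hj'
      exact (Finset.mem_filter.1 (Finset.mem_of_mem_erase hj')).2
        (Finset.mem_filter.1 (Finset.mem_sdiff.1 hj).1).2
    have hD1 : ∏ j ∈ (X.filter fun j => h (φ j) = 0) \ σ.erase i₀,
        (1 - Q j / basisChar y Q (insert i (σ.erase i₀)) (φ j)) = D₀ := by
      refine Finset.prod_congr rfl fun j hj => ?_
      rw [hchar i hi', (Finset.mem_filter.1 (Finset.mem_sdiff.1 hj).1).2, zpow_zero, mul_one]
    have hfac : ∀ j ∈ X₁, 1 - Q j / basisChar y Q (insert i (σ.erase i₀)) (φ j) =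
        (z i - z j) * (κ j * if h (φ j) = 1 then (z i)⁻¹ else 1) := by
      intro j hj
      have hj' : h (φ j) ≠ 0 := (Finset.mem_filter.1 hj).2
      rw [hchar i hi', ← div_div, ← hzpow j hj', hκ]
      have h1 := hz0 i
      have h2 := hz0 j
      rcases hor j hj' with e | e
      · simp only [e, zpow_one, if_true]
        field_simp
      · simp only [e, zpow_neg, zpow_one, if_neg (show ¬ ((-1 : ℤ) = 1) by decide)]
        field_simp
        ring
    have hκ0 : ∀ j, κ j ≠ 0 := fun j => by
      rw [hκ]
      simp only
      split_ifs
      · exact one_ne_zero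
      · exact neg_ne_zero.2 (inv_ne_zero (hz0 j))
    have hD2 : ∏ j ∈ X₁.erase i, (1 - Q j / basisChar y Q (insert i (σ.erase i₀)) (φ j)) =
        (∏ j ∈ X₁.erase i, (z i - z j)) * ((∏ j ∈ X₁, κ j) / κ i *
          ((z i)⁻¹ ^ p / if h (φ i) = 1 then (z i)⁻¹ else 1)) := by
      rw [Finset.prod_congr rfl fun j hj => hfac j (Finset.mem_of_mem_erase hj),
        Finset.prod_mul_distrib, Finset.prod_mul_distrib]
      congr 2
      · rw [eq_div_iff (hκ0 i), Finset.prod_erase_mul _ _ hi]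
      · rw [eq_div_iff, Finset.prod_erase_mul _ (fun j => if h (φ j) = 1 then (z i)⁻¹ else 1) hi,
          Finset.prod_ite, Finset.prod_const_one, mul_one, Finset.prod_const, hp]
        · congr 2
          ext j
          simp only [hX₁, Finset.mem_filter]
          constructor
          · rintro ⟨⟨hj, -⟩, e⟩
            exact ⟨hj, e⟩
          · rintro ⟨hj, e⟩
            exact ⟨⟨hj, by rw [e]; decide⟩, e⟩
        · split_ifs
          · exact inv_ne_zero (hz0 i)
          · exact one_ne_zero
    have hsign : (h (φ i) : K) * (κ i * if h (φ i) = 1 then (z i)⁻¹ else 1) = (z i)⁻¹ := by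
      rw [hκ]
      rcases hor i hi' with e | e
      · simp [e]
      · simp [e, show ¬ ((-1 : ℤ) = 1) by decide]
    have hzm : z i ^ m = z i ^ h a * z i ^ p * (z i)⁻¹ := by
      rw [← zpow_natCast, ← hm, zpow_sub₀ (hz0 i), zpow_add₀ (hz0 i), zpow_one, zpow_natCast,
        div_eq_mul_inv]
    generalize (if h (φ i) = 1 then (z i)⁻¹ else 1) = ρ at hD2 hsign
    rw [vertexTerm, hsplit, Finset.prod_union hdisj, hD1, hD2, hchar i hi', hzm, inv_pow, ← hsign]
    simp only [div_eq_mul_inv, mul_inv, inv_inv]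
    ring
  rw [Finset.sum_congr rfl hterm, ← Finset.mul_sum,
    sum_pow_div_prod_sub_eq_zero hinj (by omega), mul_zero]

end WallCrossing

section Crossing

variable {ι M K : Type*} [DecidableEq ι] [AddCommGroup M] [Field K]
  {φ : ι → M} {ℬ : Finset (Finset ι)} {y : Finset ι → ι → M →+ ℤ} {Q : ι → K}

open Classical in
/-- The indicator of the bases `σ` whose cone contains the point `P + ε d` for small `ε > 0`,
where a point is described by the values it gives to integral linear functionals. -/
noncomputable def sideWeight (K : Type*) [Field K] (y : Finset ι → ι → M →+ ℤ)
    (P : (M →+ ℤ) →+ ℝ) (d : M) (σ : Finset ι) : K :=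
  if ∀ i ∈ σ, 0 < P (y σ i) ∨ (P (y σ i) = 0 ∧ 0 < y σ i d) then 1 else 0

theorem UnimodularBases.apply_exchange_new (S : UnimodularBases φ ℬ y) {σ : Finset ι} (hσ : σ ∈ ℬ)
    {i j : ι} (hi : i ∈ σ) (hj : y σ i (φ j) ≠ 0) :
    y (insert j (σ.erase i)) j = y σ i (φ j) • y σ i := by
  ext a
  simpa using S.coord_exchange_new hσ hi hj a

theorem UnimodularBases.apply_exchange_old (S : UnimodularBases φ ℬ y) {σ : Finset ι} (hσ : σ ∈ ℬ)
    {i j l : ι} (hi : i ∈ σ) (hj : y σ i (φ j) ≠ 0) (hl : l ∈ σ.erase i)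
    {P : (M →+ ℤ) →+ ℝ} (hP : P (y σ i) = 0) :
    P (y (insert j (σ.erase i)) l) = P (y σ l) := by
  have h : y σ l = y (insert j (σ.erase i)) l
      + y σ l (φ j) • y (insert j (σ.erase i)) j := by
    ext a
    simpa using S.coord_exchange_old hσ hi hj hl a
  rw [h, map_add, map_zsmul, S.apply_exchange_new hσ hi hj, map_zsmul, hP, smul_zero, smul_zero,
    add_zero]

theorem UnimodularBases.sideWeight_exchange_sub (S : UnimodularBases φ ℬ y) {σ : Finset ι}
    (hσ : σ ∈ ℬ) {i₀ : ι} (hi₀ : i₀ ∈ σ) {P : (M →+ ℤ) →+ ℝ} (hP : P (y σ i₀) = 0)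
    (hne : ∀ l ∈ σ.erase i₀, P (y σ l) ≠ 0) {d : M} (hd : y σ i₀ d ≠ 0) :
    ∃ c : K, ∀ i, y σ i₀ (φ i) ≠ 0 →
      sideWeight K y P d (insert i (σ.erase i₀)) - sideWeight K y P (-d) (insert i (σ.erase i₀)) =
        c * y σ i₀ (φ i) := by
  classical
  have key : ∀ i, y σ i₀ (φ i) ≠ 0 → ∀ e : M,
      sideWeight K y P e (insert i (σ.erase i₀)) =
        if (∀ l ∈ σ.erase i₀, 0 < P (y σ l)) ∧ 0 < y σ i₀ (φ i) * y σ i₀ e then 1 else 0 := by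
    intro i hi e
    rw [sideWeight]
    refine if_congr ?_ rfl rfl
    rw [Finset.forall_mem_insert, S.apply_exchange_new hσ hi₀ hi, map_zsmul, hP, smul_zero, and_comm]
    refine and_congr (forall₂_congr fun l hl => ?_) (by simp)
    rw [S.apply_exchange_old hσ hi₀ hi hl hP]
    simp [hne l hl]
  by_cases hτ : ∀ l ∈ σ.erase i₀, 0 < P (y σ l)
  · refine ⟨if 0 < y σ i₀ d then 1 else -1, fun i hi => ?_⟩
    rw [key i hi, key i hi]
    simp only [eq_true hτ, true_and]
    rcases S.coord_eq_one_or hσ hi₀ hi with h | h <;>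
      rcases lt_or_gt_of_ne hd with h' | h' <;> simp [h, h', h'.not_gt]
  · exact ⟨0, fun i hi => by rw [key i hi, key i hi, if_neg fun h => hτ h.1,
      if_neg fun h => hτ h.1]; simp⟩

theorem UnimodularBases.coord_window (S : UnimodularBases φ ℬ y) {X : Finset ι} {a : M}
    {P : (M →+ ℤ) →+ ℝ} {s : ι → ℝ} (hP : ∀ l, P l = l a + ∑ i ∈ X, s i * l (φ i))
    (hs : ∀ i ∈ X, 0 ≤ s i ∧ s i ≤ 1) {B : Finset ι} (hB : B ∈ ℬ) (hBX : B ⊆ X)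
    (hBs : ∀ i ∈ B, 0 < s i ∧ s i < 1) {σ : Finset ι} (hσ : σ ∈ ℬ) {i₀ : ι} (hi₀ : i₀ ∈ σ)
    (h0 : P (y σ i₀) = 0) :
    -((X.filter fun j => y σ i₀ (φ j) = 1).card : ℤ) < y σ i₀ a ∧
      y σ i₀ a < ((X.filter fun j => y σ i₀ (φ j) = -1).card : ℤ) := by
  obtain ⟨b, hb, hb0⟩ : ∃ b ∈ B, y σ i₀ (φ b) ≠ 0 := by
    by_contra! h
    have := S.apply_eq_sum hB (y σ i₀) (φ i₀)
    rw [S.coord_self hσ hi₀, Finset.sum_eq_zero fun i hi => by rw [h i hi, mul_zero]] at this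
    exact one_ne_zero this
  have hor : ∀ j, y σ i₀ (φ j) = 0 ∨ y σ i₀ (φ j) = 1 ∨ y σ i₀ (φ j) = -1 := fun j => by
    by_cases hj : y σ i₀ (φ j) = 0
    · exact Or.inl hj
    · exact Or.inr (S.coord_eq_one_or hσ hi₀ hj)
  rw [hP] at h0
  have hlt : ∑ i ∈ X, s i * (y σ i₀ (φ i) : ℝ) <
      ∑ i ∈ X, if y σ i₀ (φ i) = 1 then (1 : ℝ) else 0 := by
    refine Finset.sum_lt_sum (fun i hi => ?_) ⟨b, hBX hb, ?_⟩
    · obtain ⟨h1, h2⟩ := hs i hi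
      rcases hor i with h | h | h <;> simp [h, h1, h2]
    · obtain ⟨h1, h2⟩ := hBs b hb
      rcases (hor b).resolve_left hb0 with h | h <;> simp [h, h1, h2]
  have hgt : ∑ i ∈ X, -(if y σ i₀ (φ i) = -1 then (1 : ℝ) else 0) <
      ∑ i ∈ X, s i * (y σ i₀ (φ i) : ℝ) := by
    refine Finset.sum_lt_sum (fun i hi => ?_) ⟨b, hBX hb, ?_⟩
    · obtain ⟨h1, h2⟩ := hs i hi
      rcases hor i with h | h | h <;> simp [h, h1, h2]
    · obtain ⟨h1, h2⟩ := hBs b hb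
      rcases (hor b).resolve_left hb0 with h | h <;> simp [h, h1, h2]
  rw [Finset.sum_neg_distrib, Finset.sum_boole] at hgt
  rw [Finset.sum_boole] at hlt
  constructor
  · have : -((X.filter fun j => y σ i₀ (φ j) = 1).card : ℝ) < y σ i₀ a := by linarith
    exact_mod_cast this
  · have : (y σ i₀ a : ℝ) < ((X.filter fun j => y σ i₀ (φ j) = -1).card : ℝ) := by linarith
    exact_mod_cast this

/-- Brion's vertex sum does not change when the point crosses a single wall. -/
theorem UnimodularBases.vertexSum_sideWeight (S : UnimodularBases φ ℬ y) (hQ : ∀ i, Q i ≠ 0)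
    (hgen : ∀ σ ∈ ℬ, ∀ j, j ∉ σ → Q j ≠ basisChar y Q σ (φ j)) {X : Finset ι} {a d : M}
    {P : (M →+ ℤ) →+ ℝ} {s : ι → ℝ} (hP : ∀ l, P l = l a + ∑ i ∈ X, s i * l (φ i))
    (hs : ∀ i ∈ X, 0 ≤ s i ∧ s i ≤ 1) {B : Finset ι} (hB : B ∈ ℬ) (hBX : B ⊆ X)
    (hBs : ∀ i ∈ B, 0 < s i ∧ s i < 1)
    (hsimple : ∀ σ ∈ ℬ, ∀ i ∈ σ, ∀ j ∈ σ, P (y σ i) = 0 → P (y σ j) = 0 → i = j)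
    (hdir : ∀ σ ∈ ℬ, ∀ i ∈ σ, P (y σ i) = 0 → y σ i d ≠ 0) :
    vertexSum φ ℬ y Q X (sideWeight K y P d) a =
      vertexSum φ ℬ y Q X (sideWeight K y P (-d)) a := by
  classical
  rw [← sub_eq_zero, vertexSum, vertexSum, ← Finset.sum_sub_distrib]
  simp only [← sub_mul]
  set T : Finset ι → Finset ι := fun σ => σ.filter fun i => P (y σ i) ≠ 0 with hT
  rw [← Finset.sum_fiberwise_of_maps_to (g := T) fun σ hσ => Finset.mem_image_of_mem T hσ]
  refine Finset.sum_eq_zero fun τ hτ => ?_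
  obtain ⟨σ, hσ, rfl⟩ := Finset.mem_image.1 hτ
  obtain ⟨hσ, hσX⟩ := Finset.mem_filter.1 hσ
  by_cases hall : ∀ i ∈ σ, P (y σ i) ≠ 0
  · refine Finset.sum_eq_zero fun ρ hρ => ?_
    obtain ⟨hρ, hρσ⟩ := Finset.mem_filter.1 hρ
    have e : σ = ρ := by
      refine S.eq_of_subset hσ (Finset.mem_filter.1 hρ).1 ?_
      rw [← Finset.filter_true_of_mem hall]
      change T σ ⊆ ρ
      rw [← hρσ]
      exact Finset.filter_subset _ _
    rw [← e]
    have : sideWeight K y P d σ = sideWeight K y P (-d) σ := by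
      rw [sideWeight, sideWeight]
      refine if_congr (forall₂_congr fun i hi => ?_) rfl rfl
      simp [hall i hi]
    rw [this, sub_self, zero_mul]
  · push Not at hall
    obtain ⟨i₀, hi₀, h0⟩ := hall
    have hTσ : ∀ ρ ∈ ℬ, ∀ i ∈ ρ, P (y ρ i) = 0 → T ρ = ρ.erase i := by
      intro ρ hρ i hi hi0
      ext l
      rw [hT, Finset.mem_filter, Finset.mem_erase, and_comm]
      refine and_congr_left fun hl => ⟨fun h e => h (e ▸ hi0), fun h e => h ?_⟩
      exact hsimple ρ hρ l hl i hi e hi0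
    have hne : ∀ l ∈ σ.erase i₀, P (y σ l) ≠ 0 := by
      intro l hl
      rw [← hTσ σ hσ i₀ hi₀ h0] at hl
      exact (Finset.mem_filter.1 hl).2
    have hfib : (ℬ.filter fun ρ => ρ ⊆ X).filter (fun ρ => T ρ = T σ) =
        (X.filter fun i => y σ i₀ (φ i) ≠ 0).image fun i => insert i (σ.erase i₀) := by
      ext ρ
      rw [Finset.mem_filter, Finset.mem_filter, Finset.mem_image, hTσ σ hσ i₀ hi₀ h0]
      constructor
      · rintro ⟨⟨hρ, hρX⟩, hρσ⟩
        obtain ⟨i, hi, hi0⟩ : ∃ i ∈ ρ, P (y ρ i) = 0 := by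
          by_contra! h
          rw [hT] at hρσ
          beta_reduce at hρσ
          rw [Finset.filter_true_of_mem h] at hρσ
          have hmem : i₀ ∈ ρ := S.eq_of_subset hρ hσ (hρσ ▸ Finset.erase_subset _ _) ▸ hi₀
          rw [hρσ] at hmem
          exact Finset.notMem_erase i₀ σ hmem
        rw [hTσ ρ hρ i hi hi0] at hρσ
        refine ⟨i, Finset.mem_filter.2 ⟨hρX hi, fun h => ?_⟩, by
          rw [← hρσ, Finset.insert_erase hi]⟩
        have := S.apply_eq_sum hρ (y σ i₀) (φ i₀)
        rw [S.coord_self hσ hi₀, Finset.sum_eq_zero] at this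
        · exact one_ne_zero this
        · intro l hl
          by_cases hli : l = i
          · rw [hli, h, mul_zero]
          · have hl' : l ∈ σ.erase i₀ := hρσ ▸ Finset.mem_erase.2 ⟨hli, hl⟩
            rw [S.coord_ne hσ hi₀ (Finset.mem_erase.1 hl').2 (Finset.mem_erase.1 hl').1.symm,
              mul_zero]
      · rintro ⟨i, hi, rfl⟩
        obtain ⟨hiX, hi⟩ := Finset.mem_filter.1 hi
        have hmem := S.exchange σ hσ i₀ hi₀ i hi
        refine ⟨⟨hmem, Finset.insert_subset hiX ((Finset.erase_subset _ _).trans hσX)⟩, ?_⟩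
        rw [hTσ _ hmem i (Finset.mem_insert_self _ _), Finset.erase_insert
          (S.notMem_erase hσ hi₀ hi)]
        rw [S.apply_exchange_new hσ hi₀ hi, map_zsmul, h0, smul_zero]
    obtain ⟨c, hc⟩ := S.sideWeight_exchange_sub (K := K) hσ hi₀ h0 hne (hdir σ hσ i₀ hi₀ h0)
    obtain ⟨hpos, hneg⟩ := S.coord_window hP hs hB hBX hBs hσ hi₀ h0
    rw [hfib, Finset.sum_image]
    · rw [Finset.sum_congr rfl fun i hi => by
        rw [hc i (Finset.mem_filter.1 hi).2, mul_assoc], ← Finset.mul_sum,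
        S.sum_vertexTerm_eq_zero hQ hgen hσ hi₀ hpos hneg, mul_zero]
    · intro i hi j hj hij
      beta_reduce at hij
      have := S.notMem_erase hσ hi₀ (Finset.mem_filter.1 hi).2
      have hmem : i ∈ insert j (σ.erase i₀) := hij ▸ Finset.mem_insert_self _ _
      exact (Finset.mem_insert.1 hmem).resolve_right this

end Crossing

section Line

variable {ι M K : Type*} [DecidableEq ι] [AddCommGroup M] [Field K]
  {φ : ι → M} {ℬ : Finset (Finset ι)} {y : Finset ι → ι → M →+ ℤ} {Q : ι → K}

/-- The point at parameter `u` on the line through `P` with direction `d`, as a functional on the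
integral dual. -/
noncomputable def linePoint (P : (M →+ ℤ) →+ ℝ) (d : M) (u : ℝ) : (M →+ ℤ) →+ ℝ :=
  P + (AddMonoidHom.mulLeft u).comp ((Int.castAddHom ℝ).comp (AddMonoidHom.eval d))

theorem linePoint_apply (P : (M →+ ℤ) →+ ℝ) (d : M) (u : ℝ) (l : M →+ ℤ) :
    linePoint P d u l = P l + u * l d := rfl

theorem vertexSum_congr {X : Finset ι} {w w' : Finset ι → K} (h : ∀ σ ∈ ℬ, w σ = w' σ) (a : M) :
    vertexSum φ ℬ y Q X w a = vertexSum φ ℬ y Q X w' a :=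
  Finset.sum_congr rfl fun σ hσ => by rw [h σ (Finset.mem_filter.1 hσ).1]

theorem eventually_pos_linePoint_iff {P : (M →+ ℤ) →+ ℝ} {d : M} {u : ℝ} {l : M →+ ℤ}
    (hl : linePoint P d u l = 0 → l d ≠ 0) :
    ∀ᶠ v in nhds u,
      (u < v → ((0 < linePoint P d v l ∨ (linePoint P d v l = 0 ∧ 0 < l d)) ↔
        (0 < linePoint P d u l ∨ (linePoint P d u l = 0 ∧ 0 < l d)))) ∧
      (v < u → ((0 < linePoint P d v l ∨ (linePoint P d v l = 0 ∧ 0 < l d)) ↔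
        (0 < linePoint P d u l ∨ (linePoint P d u l = 0 ∧ 0 < l (-d))))) := by
  have hcont : Continuous fun v => linePoint P d v l := by
    simp only [linePoint_apply]
    fun_prop
  rcases lt_trichotomy (linePoint P d u l) 0 with h | h | h
  · filter_upwards [hcont.continuousAt.eventually_lt_const h] with v hv
    simp [h.not_gt, h.ne, hv.not_gt, hv.ne]
  · refine Filter.Eventually.of_forall fun v => ?_
    have hv : linePoint P d v l = (v - u) * l d := by
      rw [linePoint_apply] at h ⊢
      linarith
    have h0 := hl h
    rw [h, hv]
    rcases lt_or_gt_of_ne h0 with h' | h'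
    · have h'' : (l d : ℝ) < 0 := by exact_mod_cast h'
      constructor <;> intro huv
      · have : (v - u) * l d < 0 := mul_neg_of_pos_of_neg (by linarith) h''
        simp [this.not_gt, this.ne, h'.not_gt]
      · have : 0 < (v - u) * l d := mul_pos_of_neg_of_neg (by linarith) h''
        simp [this, h']
    · have h'' : 0 < (l d : ℝ) := by exact_mod_cast h'
      constructor <;> intro huv
      · have : 0 < (v - u) * l d := mul_pos (by linarith) h''
        simp [this, h']
      · have : (v - u) * l d < 0 := mul_neg_of_neg_of_pos (by linarith) h''
        simp [this.not_gt, this.ne, h'.not_gt]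
  · filter_upwards [hcont.continuousAt.eventually_const_lt h] with v hv
    simp [h, hv]

/-- Brion's vertex sum is constant along a line segment that crosses the walls one at a time. -/
theorem UnimodularBases.vertexSum_linePoint (S : UnimodularBases φ ℬ y) (hQ : ∀ i, Q i ≠ 0)
    (hgen : ∀ σ ∈ ℬ, ∀ j, j ∉ σ → Q j ≠ basisChar y Q σ (φ j)) {X : Finset ι} {a d : M}
    {P : (M →+ ℤ) →+ ℝ} {s : ℝ → ι → ℝ} {u₀ u₁ : ℝ} (hu : u₀ ≤ u₁)
    (hP : ∀ u l, linePoint P d u l = l a + ∑ i ∈ X, s u i * l (φ i))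
    (hs : ∀ u ∈ Set.Icc u₀ u₁, ∀ i ∈ X, 0 ≤ s u i ∧ s u i ≤ 1)
    {B : Finset ι} (hB : B ∈ ℬ) (hBX : B ⊆ X)
    (hBs : ∀ u ∈ Set.Icc u₀ u₁, ∀ i ∈ B, 0 < s u i ∧ s u i < 1)
    (hsimple : ∀ u, ∀ σ ∈ ℬ, ∀ i ∈ σ, ∀ j ∈ σ,
      linePoint P d u (y σ i) = 0 → linePoint P d u (y σ j) = 0 → i = j)
    (hdir : ∀ u, ∀ σ ∈ ℬ, ∀ i ∈ σ, linePoint P d u (y σ i) = 0 → y σ i d ≠ 0) :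
    vertexSum φ ℬ y Q X (sideWeight K y (linePoint P d u₀) d) a =
      vertexSum φ ℬ y Q X (sideWeight K y (linePoint P d u₁) d) a := by
  refine isPreconnected_Icc.induction₂ (fun u v =>
    vertexSum φ ℬ y Q X (sideWeight K y (linePoint P d u) d) a =
      vertexSum φ ℬ y Q X (sideWeight K y (linePoint P d v) d) a) ?_
    (fun u v w _ _ _ h h' => h.trans h') (fun u v _ _ h => h.symm)
    (Set.left_mem_Icc.2 hu) (Set.right_mem_Icc.2 hu)
  intro u hu
  have hev : ∀ᶠ v in nhdsWithin u (Set.Icc u₀ u₁), ∀ σ ∈ ℬ, ∀ i ∈ σ, _ :=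
    nhdsWithin_le_nhds <| (Filter.eventually_all_finset ℬ).2 fun σ hσ =>
      (Filter.eventually_all_finset σ).2 fun i hi => eventually_pos_linePoint_iff (hdir u σ hσ i hi)
  filter_upwards [hev] with v hv
  rcases lt_trichotomy u v with huv | rfl | huv
  · refine vertexSum_congr (fun σ hσ => ?_) a
    rw [sideWeight, sideWeight]
    exact if_congr (forall₂_congr fun i hi => ((hv σ hσ i hi).1 huv).symm) rfl rfl
  · rfl
  · rw [S.vertexSum_sideWeight hQ hgen (hP u) (hs u hu) hB hBX (hBs u hu) (hsimple u) (hdir u)]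
    refine vertexSum_congr (fun σ hσ => ?_) a
    rw [sideWeight, sideWeight]
    exact if_congr (forall₂_congr fun i hi => ((hv σ hσ i hi).2 huv).symm) rfl rfl

end Line

section Brion

variable {ι M K : Type*} [DecidableEq ι] [AddCommGroup M] [Field K]
  {φ : ι → M} {ℬ : Finset (Finset ι)} {y : Finset ι → ι → M →+ ℤ} {Q : ι → K}

/-- The point `a + ∑ i ∈ X, t i • φ i`, as a functional on the integral dual. -/
noncomputable def shiftPoint (φ : ι → M) (t : ι → ℝ) (X : Finset ι) (a : M) : (M →+ ℤ) →+ ℝ :=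
  (Int.castAddHom ℝ).comp (AddMonoidHom.eval a) + ∑ i ∈ X,
    (AddMonoidHom.mulLeft (t i)).comp ((Int.castAddHom ℝ).comp (AddMonoidHom.eval (φ i)))

omit [DecidableEq ι] in
theorem shiftPoint_apply (t : ι → ℝ) (X : Finset ι) (a : M) (l : M →+ ℤ) :
    shiftPoint φ t X a l = l a + ∑ i ∈ X, t i * l (φ i) := by
  simp [shiftPoint, AddMonoidHom.finsetSum_apply]

/-- The integral functionals that a shift has to avoid in order to be generic: those vanishing on
a wall, and those vanishing on the span of an intersection of two walls and a vector `φ k`. -/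
def wallFunctionals (φ : ι → M) (ℬ : Finset (Finset ι)) (y : Finset ι → ι → M →+ ℤ) :
    Set (M →+ ℤ) :=
  {l | (∃ σ ∈ ℬ, ∃ i ∈ σ, l = y σ i) ∨ ∃ σ ∈ ℬ, ∃ i ∈ σ, ∃ j ∈ σ, ∃ k, i ≠ j ∧
    y σ i (φ k) ≠ 0 ∧ l = y σ i (φ k) • y σ j - y σ j (φ k) • y σ i}

/-- A shift `t` is generic if all translates of the lattice by partial sums
`∑ i ∈ X, t i • φ i` with `B ⊆ X` avoid the zeros of the wall functionals. -/
structure IsGenericShift (φ : ι → M) (ℬ : Finset (Finset ι)) (y : Finset ι → ι → M →+ ℤ)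
    (B : Finset ι) (t : ι → ℝ) : Prop where
  pos : ∀ i, 0 < t i
  lt_one : ∀ i, t i < 1
  avoid : ∀ l ∈ wallFunctionals φ ℬ y, ∀ X, B ⊆ X → ∀ n : ℤ, ∑ i ∈ X, t i * l (φ i) ≠ n

omit [DecidableEq ι] in
theorem sideWeight_of_ne_zero {P : (M →+ ℤ) →+ ℝ} {σ : Finset ι} (h : ∀ i ∈ σ, P (y σ i) ≠ 0)
    (d d' : M) : sideWeight K y P d σ = sideWeight K y P d' σ := by
  rw [sideWeight, sideWeight]
  refine if_congr (forall₂_congr fun i hi => ?_) rfl rfl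
  simp [h i hi]

namespace IsGenericShift

variable {B : Finset ι} {t : ι → ℝ}

omit [DecidableEq ι] in
theorem shiftPoint_ne_zero (ht : IsGenericShift φ ℬ y B t) {l : M →+ ℤ}
    (hl : l ∈ wallFunctionals φ ℬ y) {X : Finset ι} (hX : B ⊆ X) (a : M) :
    shiftPoint φ t X a l ≠ 0 := by
  rw [shiftPoint_apply]
  intro h
  refine ht.avoid l hl X hX (-l a) ?_
  push_cast
  linarith

omit [DecidableEq ι] in
theorem coord_ne_zero (ht : IsGenericShift φ ℬ y B t) {σ : Finset ι} (hσ : σ ∈ ℬ) {i : ι}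
    (hi : i ∈ σ) {X : Finset ι} (hX : B ⊆ X) (a : M) : shiftPoint φ t X a (y σ i) ≠ 0 :=
  ht.shiftPoint_ne_zero (Or.inl ⟨σ, hσ, i, hi, rfl⟩) hX a

omit [DecidableEq ι] in
theorem apply_ne_zero_of_linePoint (ht : IsGenericShift φ ℬ y B t) {X : Finset ι} (hX : B ⊆ X)
    (a : M) (k : ι) (u : ℝ) {σ : Finset ι} (hσ : σ ∈ ℬ) {i : ι} (hi : i ∈ σ)
    (h : linePoint (shiftPoint φ t X a) (φ k) u (y σ i) = 0) : y σ i (φ k) ≠ 0 := by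
  intro h0
  rw [linePoint_apply, h0, Int.cast_zero, mul_zero, add_zero] at h
  exact ht.coord_ne_zero hσ hi hX a h

omit [DecidableEq ι] in
theorem eq_of_linePoint (ht : IsGenericShift φ ℬ y B t) {X : Finset ι} (hX : B ⊆ X)
    (a : M) (k : ι) (u : ℝ) {σ : Finset ι} (hσ : σ ∈ ℬ) {i j : ι} (hi : i ∈ σ) (hj : j ∈ σ)
    (h : linePoint (shiftPoint φ t X a) (φ k) u (y σ i) = 0)
    (h' : linePoint (shiftPoint φ t X a) (φ k) u (y σ j) = 0) : i = j := by
  by_contra hij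
  refine ht.shiftPoint_ne_zero (l := y σ i (φ k) • y σ j - y σ j (φ k) • y σ i)
    (Or.inr ⟨σ, hσ, i, hi, j, hj, k, hij,
      ht.apply_ne_zero_of_linePoint hX a k u hσ hi h, rfl⟩) hX a ?_
  rw [linePoint_apply] at h h'
  rw [map_sub, map_zsmul, map_zsmul, zsmul_eq_mul, zsmul_eq_mul]
  linear_combination (y σ i (φ k) : ℝ) * h' - (y σ j (φ k) : ℝ) * h

end IsGenericShift

theorem shiftPoint_insert (t : ι → ℝ) {X : Finset ι} {k : ι} (hk : k ∉ X) (a : M) :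
    shiftPoint φ t (insert k X) a = linePoint (shiftPoint φ t X a) (φ k) (t k) := by
  ext l
  rw [linePoint_apply, shiftPoint_apply, shiftPoint_apply, Finset.sum_insert hk]
  ring

theorem shiftPoint_insert_sub (t : ι → ℝ) {X : Finset ι} {k : ι} (hk : k ∉ X) (a : M) :
    shiftPoint φ t (insert k X) (a - φ k) = linePoint (shiftPoint φ t X a) (φ k) (t k - 1) := by
  ext l
  rw [linePoint_apply, shiftPoint_apply, shiftPoint_apply, Finset.sum_insert hk, map_sub,
    Int.cast_sub]
  ring

theorem UnimodularBases.exists_coord_pos (S : UnimodularBases φ ℬ y) [Fintype ι]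
    (hpt : ∀ x : ι → ℕ, ∑ i, x i • φ i = 0 → x = 0) {σ : Finset ι} (hσ : σ ∈ ℬ) (k : ι) :
    ∃ i ∈ σ, 0 < y σ i (φ k) := by
  by_contra! h
  have h0 := hpt (fun j => (if j = k then 1 else 0) + if j ∈ σ then (-y σ j (φ k)).toNat else 0) ?_
  · have := congrFun h0 k
    simp at this
  · simp only [add_smul, Finset.sum_add_distrib, ite_smul, zero_smul, one_smul,
      Finset.sum_ite_eq', Finset.mem_univ, if_true]
    rw [Finset.sum_ite_mem, Finset.univ_inter]
    have : ∑ i ∈ σ, (-y σ i (φ k)).toNat • φ i = -φ k := by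
      conv_rhs => rw [← S.expand σ hσ (φ k), ← Finset.sum_neg_distrib]
      refine Finset.sum_congr rfl fun i hi => ?_
      rw [← natCast_zsmul, Int.toNat_of_nonneg (by linarith [h i hi]), neg_smul]
    rw [this, add_neg_cancel]

theorem UnimodularBases.eventually_vertexSum_eq_zero (S : UnimodularBases φ ℬ y) [Fintype ι]
    (hpt : ∀ x : ι → ℕ, ∑ i, x i • φ i = 0 → x = 0) (t : ι → ℝ) (X : Finset ι) (k : ι) (a : M) :
    ∀ᶠ n : ℕ in Filter.atTop, vertexSum φ ℬ y Q X
      (sideWeight K y (shiftPoint φ t X (a - n • φ k)) 0) (a - n • φ k) = 0 := by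
  have : ∀ᶠ n : ℕ in Filter.atTop, ∀ σ ∈ ℬ,
      sideWeight K y (shiftPoint φ t X (a - n • φ k)) 0 σ = 0 := by
    rw [Filter.eventually_all_finset]
    intro σ hσ
    obtain ⟨i, hi, hpos⟩ := S.exists_coord_pos hpt hσ k
    filter_upwards [Filter.eventually_ge_atTop ⌈shiftPoint φ t X a (y σ i)⌉₊] with n hn
    rw [sideWeight, if_neg]
    intro h
    have h' := h i hi
    simp only [map_zero, lt_self_iff_false, and_false, or_false, shiftPoint_apply, map_sub,
      map_nsmul] at h'
    have h1 := (Nat.le_ceil _).trans (Nat.cast_le (α := ℝ).2 hn)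
    rw [shiftPoint_apply] at h1
    have h2 : (1 : ℝ) ≤ y σ i (φ k) := by exact_mod_cast hpos
    have h3 : (n : ℝ) ≤ n * y σ i (φ k) := le_mul_of_one_le_right n.cast_nonneg h2
    push_cast [nsmul_eq_mul] at h'
    linarith
  filter_upwards [this] with n hn
  rw [vertexSum]
  refine Finset.sum_eq_zero fun σ hσ => ?_
  rw [hn σ (Finset.mem_filter.1 hσ).1, zero_mul]

theorem UnimodularBases.weightedCount_eq_vertexSum_basis (S : UnimodularBases φ ℬ y)
    {B : Finset ι} (hB : B ∈ ℬ) {t : ι → ℝ} (ht0 : ∀ i, 0 < t i) (ht1 : ∀ i, t i < 1) (a : M) :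
    weightedCount φ Q B a =
      vertexSum φ ℬ y Q B (sideWeight K y (shiftPoint φ t B a) 0) a := by
  classical
  have hfil : (ℬ.filter fun σ => σ ⊆ B) = {B} := by
    ext σ
    rw [Finset.mem_filter, Finset.mem_singleton]
    exact ⟨fun h => S.eq_of_subset h.1 hB h.2, fun h => by rw [h]; exact ⟨hB, subset_rfl⟩⟩
  rw [vertexSum, hfil, Finset.sum_singleton, S.weightedCount_basis hB, vertexTerm,
    Finset.sdiff_self, Finset.prod_empty, div_one, sideWeight, ite_mul, one_mul, zero_mul]
  refine if_congr (forall₂_congr fun i hi => ?_) rfl rfl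
  have : shiftPoint φ t B a (y B i) = y B i a + t i := by
    rw [shiftPoint_apply, Finset.sum_eq_single_of_mem i hi, S.coord_self hB hi, Int.cast_one,
      mul_one]
    intro j hj hji
    rw [S.coord_ne hB hi hj hji.symm, Int.cast_zero, mul_zero]
  simp only [map_zero, lt_self_iff_false, and_false, or_false, this]
  constructor
  · intro h
    have : (0 : ℝ) ≤ y B i a := by exact_mod_cast h
    linarith [ht0 i]
  · intro h
    have : (-1 : ℝ) < y B i a := by linarith [ht1 i]
    have : -1 < y B i a := by exact_mod_cast this
    omega

theorem UnimodularBases.vertexSum_sideWeight_insert (S : UnimodularBases φ ℬ y)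
    (hQ : ∀ i, Q i ≠ 0) (hgen : ∀ σ ∈ ℬ, ∀ j, j ∉ σ → Q j ≠ basisChar y Q σ (φ j))
    {B : Finset ι} (hB : B ∈ ℬ) {t : ι → ℝ} (ht : IsGenericShift φ ℬ y B t)
    {X : Finset ι} (hX : B ⊆ X) {k : ι} (hk : k ∉ X) (a : M) :
    vertexSum φ ℬ y Q (insert k X) (sideWeight K y (shiftPoint φ t (insert k X) a) 0) a =
      vertexSum φ ℬ y Q X (sideWeight K y (shiftPoint φ t X a) 0) a +
        Q k * vertexSum φ ℬ y Q (insert k X)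
          (sideWeight K y (shiftPoint φ t (insert k X) (a - φ k)) 0) (a - φ k) := by
  have hY : B ⊆ insert k X := hX.trans (Finset.subset_insert _ _)
  have hside : ∀ Z, B ⊆ Z → ∀ b d, ∀ σ ∈ ℬ,
      sideWeight K y (shiftPoint φ t Z b) 0 σ = sideWeight K y (shiftPoint φ t Z b) d σ :=
    fun Z hZ b d σ hσ => sideWeight_of_ne_zero (fun i hi => ht.coord_ne_zero hσ hi hZ b) 0 d
  have hsum : ∀ (v : ℝ) (l : M →+ ℤ), ∑ i ∈ insert k X, Function.update t k v i * (l (φ i) : ℝ) =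
      v * l (φ k) + ∑ i ∈ X, t i * l (φ i) := by
    intro v l
    rw [Finset.sum_insert hk, Function.update_self]
    congr 1
    refine Finset.sum_congr rfl fun i hi => ?_
    rw [Function.update_of_ne (a := i) (a' := k) fun e => hk (e ▸ hi)]
  have hbound : ∀ v, 0 ≤ v ∧ v ≤ 1 → ∀ i,
      0 ≤ Function.update t k v i ∧ Function.update t k v i ≤ 1 := by
    intro v hv i
    rcases eq_or_ne i k with rfl | hik
    · rwa [Function.update_self]
    · rw [Function.update_of_ne hik]
      exact ⟨(ht.pos i).le, (ht.lt_one i).le⟩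
  have hboundB : ∀ v, ∀ i ∈ B, 0 < Function.update t k v i ∧ Function.update t k v i < 1 := by
    intro v i hi
    rw [Function.update_of_ne (a := i) (a' := k) fun e => hk (e ▸ hX hi)]
    exact ⟨ht.pos i, ht.lt_one i⟩
  have hk0 := ht.pos k
  have hk1 := ht.lt_one k
  have h0 : linePoint (shiftPoint φ t X a) (φ k) 0 = shiftPoint φ t X a := by
    ext l
    rw [linePoint_apply, zero_mul, add_zero]
  have cross : vertexSum φ ℬ y Q (insert k X) (sideWeight K y (shiftPoint φ t X a) (φ k)) a =
      vertexSum φ ℬ y Q (insert k X)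
        (sideWeight K y (shiftPoint φ t (insert k X) a) (φ k)) a := by
    rw [shiftPoint_insert t hk]
    nth_rw 1 [← h0]
    refine S.vertexSum_linePoint hQ hgen hk0.le (s := fun u => Function.update t k u)
      (fun u l => ?_) (fun u hu i _ => hbound u ⟨hu.1, hu.2.trans hk1.le⟩ i) hB hY
      (fun u _ i hi => hboundB u i hi)
      (fun u σ hσ i hi j hj h h' => ht.eq_of_linePoint hX a k u hσ hi hj h h')
      (fun u σ hσ i hi h => ht.apply_ne_zero_of_linePoint hX a k u hσ hi h)
    rw [hsum, linePoint_apply, shiftPoint_apply]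
    ring
  have cross' : vertexSum φ ℬ y Q (insert k X)
        (sideWeight K y (shiftPoint φ t (insert k X) (a - φ k)) (φ k)) (a - φ k) =
      vertexSum φ ℬ y Q (insert k X) (sideWeight K y (shiftPoint φ t X a) (φ k)) (a - φ k) := by
    rw [shiftPoint_insert_sub t hk]
    nth_rw 2 [← h0]
    refine S.vertexSum_linePoint hQ hgen (by linarith)
      (s := fun u => Function.update t k (u + 1))
      (fun u l => ?_) (fun u hu i _ => hbound _ ⟨by linarith [hu.1], by linarith [hu.2]⟩ i) hB hY
      (fun u _ i hi => hboundB _ i hi)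
      (fun u σ hσ i hi j hj h h' => ht.eq_of_linePoint hX a k u hσ hi hj h h')
      (fun u σ hσ i hi h => ht.apply_ne_zero_of_linePoint hX a k u hσ hi h)
    rw [hsum, linePoint_apply, shiftPoint_apply, map_sub, Int.cast_sub]
    ring
  rw [vertexSum_congr (hside _ hY a (φ k)), ← cross, S.vertexSum_insert hQ hgen hk,
    vertexSum_congr (hside _ hX a (φ k)), vertexSum_congr (hside _ hY (a - φ k) (φ k)), cross']

/-- Brion's formula for a unimodular configuration of vectors, perturbed by a generic shift. -/
theorem UnimodularBases.weightedCount_eq_vertexSum (S : UnimodularBases φ ℬ y) [Fintype ι]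
    (hpt : ∀ x : ι → ℕ, ∑ i, x i • φ i = 0 → x = 0) (hQ : ∀ i, Q i ≠ 0)
    (hgen : ∀ σ ∈ ℬ, ∀ j, j ∉ σ → Q j ≠ basisChar y Q σ (φ j))
    {B : Finset ι} (hB : B ∈ ℬ) {t : ι → ℝ} (ht : IsGenericShift φ ℬ y B t)
    {X : Finset ι} (hX : B ⊆ X) (a : M) :
    weightedCount φ Q X a =
      vertexSum φ ℬ y Q X (sideWeight K y (shiftPoint φ t X a) 0) a := by
  rw [← Finset.union_sdiff_of_subset hX]
  generalize X \ B = Z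
  induction Z using Finset.induction_on generalizing a with
  | empty =>
    rw [Finset.union_empty]
    exact S.weightedCount_eq_vertexSum_basis hB ht.pos ht.lt_one a
  | insert k Z _ ih =>
    rw [Finset.union_insert]
    by_cases hk : k ∈ B ∪ Z
    · rw [Finset.insert_eq_of_mem hk]
      exact ih a
    · have hstep : ∀ (n : ℕ) b, weightedCount φ Q (insert k (B ∪ Z)) b -
          vertexSum φ ℬ y Q (insert k (B ∪ Z))
            (sideWeight K y (shiftPoint φ t (insert k (B ∪ Z)) b) 0) b =
          Q k ^ n * (weightedCount φ Q (insert k (B ∪ Z)) (b - n • φ k) -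
            vertexSum φ ℬ y Q (insert k (B ∪ Z))
              (sideWeight K y (shiftPoint φ t (insert k (B ∪ Z)) (b - n • φ k)) 0)
                (b - n • φ k)) := by
        intro n
        induction n with
        | zero => simp
        | succ n ihn =>
          intro b
          rw [weightedCount_insert hpt hk,
            S.vertexSum_sideWeight_insert hQ hgen hB ht Finset.subset_union_left hk, ← ih b,
            add_sub_add_left_eq_sub, ← mul_sub, ihn (b - φ k), ← mul_assoc, ← pow_succ',
            sub_sub, ← succ_nsmul']
      obtain ⟨n₀, hn₀⟩ := exists_weightedCount_eq_zero (Q := Q) hpt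
        (Finset.mem_insert_self k (B ∪ Z)) a
      obtain ⟨n, hn, hn'⟩ := ((Filter.eventually_ge_atTop n₀).and
        (S.eventually_vertexSum_eq_zero (K := K) (Q := Q) hpt t (insert k (B ∪ Z)) k a)).exists
      rw [← sub_eq_zero, hstep n a, hn₀ n hn, hn', sub_zero, mul_zero]

end Brion

section Exponential

open PowerSeries in
/-- The power series `exp (q X)`, as a character of the additive group of `q`. -/
noncomputable def expCharacter : Multiplicative ℚ →* PowerSeries ℚ where
  toFun q := rescale q.toAdd (exp ℚ)
  map_one' := by simp
  map_mul' p q := by rw [exp_mul_exp_eq_exp_add, toAdd_mul]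

theorem coeff_expCharacter (n : ℕ) (q : ℚ) :
    PowerSeries.coeff n (expCharacter (.ofAdd q)) = q ^ n * (1 / n.factorial) := by
  simp [expCharacter, PowerSeries.coeff_rescale, PowerSeries.coeff_exp]

theorem constantCoeff_expCharacter (q : Multiplicative ℚ) :
    PowerSeries.constantCoeff (expCharacter q) = 1 := by
  simpa using coeff_expCharacter 0 q.toAdd

theorem expCharacter_injective : Function.Injective expCharacter := by
  intro p q h
  have := congrArg (PowerSeries.coeff 1) h
  have hp := coeff_expCharacter 1 p.toAdd
  have hq := coeff_expCharacter 1 q.toAdd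
  simp only [ofAdd_toAdd] at hp hq
  rw [hp, hq] at this
  simpa using this

theorem exists_mul_one_sub_expCharacter {q : ℚ} (hq : q ≠ 0) :
    ∃ u : PowerSeries ℚ, u * (1 - expCharacter (.ofAdd q)) = PowerSeries.X := by
  obtain ⟨v, hv⟩ : PowerSeries.X ∣ 1 - expCharacter (.ofAdd q) := by
    rw [PowerSeries.X_dvd_iff, map_sub, constantCoeff_expCharacter, map_one, sub_self]
  have hunit : IsUnit v := by
    rw [PowerSeries.isUnit_iff_constantCoeff, isUnit_iff_ne_zero]
    have h1 := congrArg (PowerSeries.coeff 1) hv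
    rw [map_sub, coeff_expCharacter, PowerSeries.coeff_one, show (1 : ℕ) = 0 + 1 from rfl,
      PowerSeries.coeff_succ_X_mul] at h1
    rw [← PowerSeries.coeff_zero_eq_constantCoeff_apply, ← h1]
    simpa using hq
  obtain ⟨u, hu⟩ := hunit.exists_left_inv
  exact ⟨u, by rw [hv, mul_left_comm, hu, mul_one]⟩

end Exponential

section Polynomiality

variable {ι : Type*} [DecidableEq ι] {r : ℕ}
  {φ : ι → Fin r → ℤ} {ℬ : Finset (Finset ι)} {y : Finset ι → ι → (Fin r → ℤ) →+ ℤ}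

omit [DecidableEq ι] in
theorem exists_generic_weights [Finite ι] (φ : ι → Fin r → ℤ) (ℬ : Finset (Finset ι))
    (y : Finset ι → ι → (Fin r → ℤ) →+ ℤ) :
    ∃ c : ι → ℚ, ∀ σ ∈ ℬ, ∀ j, j ∉ σ → c j - ∑ i ∈ σ, c i * y σ i (φ j) ≠ 0 := by
  classical
  obtain ⟨c, hc⟩ := Module.Dual.exists_forall_ne_zero_of_forall_exists (K := ℚ)
    (fun p : {p : Finset ι × ι // p.2 ∉ p.1} =>
      (LinearMap.proj p.1.2 - ∑ i ∈ p.1.1, (y p.1.1 i (φ p.1.2) : ℚ) • LinearMap.proj i :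
        Module.Dual ℚ (ι → ℚ))) (by
      rintro ⟨⟨σ, j⟩, hj⟩
      refine ⟨Pi.single j 1, ?_⟩
      have : ∑ i ∈ σ, (y σ i (φ j) : ℚ) * (Pi.single j 1 : ι → ℚ) i = 0 := by
        refine Finset.sum_eq_zero fun i hi => ?_
        have : i ≠ j := fun e => hj (e ▸ hi)
        rw [Pi.single_eq_of_ne this, mul_zero]
      simp [LinearMap.sub_apply, LinearMap.sum_apply, this])
  refine ⟨c, fun σ _ j hj => ?_⟩
  simpa [LinearMap.sub_apply, LinearMap.sum_apply, mul_comm] using hc ⟨⟨σ, j⟩, hj⟩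

/-- The number of solutions is given by one polynomial for all right hand sides that lie, after a
generic shift, in the interiors of the cones of the same bases. -/
theorem UnimodularBases.exists_polynomial (S : UnimodularBases φ ℬ y) [Fintype ι]
    (hpt : ∀ x : ι → ℕ, ∑ i, x i • φ i = 0 → x = 0) (hcard : ∀ σ ∈ ℬ, σ.card = r)
    {J : Finset (Finset ι)} (hJ : J ⊆ ℬ) :
    ∃ P : MvPolynomial (Fin r) ℚ, ∀ (a : Fin r → ℤ) (B : Finset ι) (t : ι → ℝ), B ∈ ℬ →
      IsGenericShift φ ℬ y B t →
      (∀ σ ∈ ℬ, σ ∈ J ↔ ∀ i ∈ σ, 0 < shiftPoint φ t Finset.univ a (y σ i)) →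
      ((solutionSet φ Finset.univ a).ncard : ℚ) = MvPolynomial.eval (fun j => (a j : ℚ)) P := by
  classical
  obtain ⟨c, hc⟩ := exists_generic_weights φ ℬ y
  choose! u hu using fun q (hq : q ≠ 0) => exists_mul_one_sub_expCharacter (q := q) hq
  set K := FractionRing (PowerSeries ℚ)
  set em : PowerSeries ℚ →+* K := algebraMap _ _ with hem
  have hemi : Function.Injective em := IsFractionRing.injective (PowerSeries ℚ) K
  set E : Multiplicative ℚ →* K := (em : PowerSeries ℚ →* K).comp expCharacter with hE
  have hEi : Function.Injective E := hemi.comp expCharacter_injective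
  set Q : ι → K := fun i => E (.ofAdd (c i)) with hQ
  have hE0 : ∀ q, E q ≠ 0 := fun q h => by
    have := map_mul E q q⁻¹
    rw [h, zero_mul, mul_inv_cancel, map_one] at this
    exact one_ne_zero this
  set L : Finset ι → (Fin r → ℤ) → ℚ := fun σ a => ∑ i ∈ σ, c i * y σ i a with hL
  have hchar : ∀ σ a, basisChar y Q σ a = E (.ofAdd (L σ a)) := by
    intro σ a
    rw [basisChar, hL, ofAdd_sum, map_prod]
    refine Finset.prod_congr rfl fun i _ => ?_
    rw [hQ]
    beta_reduce
    rw [← MonoidHom.map_zpow, ← ofAdd_zsmul, zsmul_eq_mul, mul_comm]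
  have hgen : ∀ σ ∈ ℬ, ∀ j, j ∉ σ → Q j ≠ basisChar y Q σ (φ j) := by
    intro σ hσ j hj h
    rw [hchar] at h
    exact hc σ hσ j hj (sub_eq_zero.2 (Multiplicative.ofAdd.injective (hEi h)))
  set d := Fintype.card ι - r with hd
  set U : Finset ι → PowerSeries ℚ := fun σ => ∏ j ∈ Finset.univ \ σ, u (c j - L σ (φ j)) with hU
  have hterm : ∀ σ ∈ ℬ, ∀ a, em PowerSeries.X ^ d * vertexTerm φ y Q Finset.univ σ a =
      em (expCharacter (.ofAdd (L σ a)) * U σ) := by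
    intro σ hσ a
    have hX : PowerSeries.X ^ d = U σ *
        ∏ j ∈ Finset.univ \ σ, (1 - expCharacter (.ofAdd (c j - L σ (φ j)))) := by
      rw [hU, ← Finset.prod_mul_distrib, Finset.prod_congr rfl fun j hj =>
        hu _ (hc σ hσ j (Finset.mem_sdiff.1 hj).2), Finset.prod_const, ← Finset.compl_eq_univ_sdiff,
        Finset.card_compl, hcard σ hσ]
    have hprod : ∏ j ∈ Finset.univ \ σ, (1 - Q j / basisChar y Q σ (φ j)) =
        em (∏ j ∈ Finset.univ \ σ, (1 - expCharacter (.ofAdd (c j - L σ (φ j))))) := by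
      rw [map_prod]
      refine Finset.prod_congr rfl fun j _ => ?_
      have : E (.ofAdd (c j) / .ofAdd (L σ (φ j))) =
          E (.ofAdd (c j)) / E (.ofAdd (L σ (φ j))) := by
        rw [eq_div_iff (hE0 _), ← map_mul, div_mul_cancel]
      rw [hchar, map_sub, map_one, ofAdd_sub, ← this]
      rfl
    have hne : em (∏ j ∈ Finset.univ \ σ, (1 - expCharacter (.ofAdd (c j - L σ (φ j))))) ≠ 0 := by
      intro h
      have := congrArg em hX
      rw [map_mul, h, mul_zero, map_pow] at this
      exact pow_ne_zero _ ((map_ne_zero_iff em hemi).2 PowerSeries.X_ne_zero) this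
    rw [vertexTerm, hprod, ← map_pow, hX, map_mul, mul_assoc, mul_div_cancel₀ _ hne, hchar,
      map_mul, mul_comm]
    rfl
  have hcount : ∀ a, weightedCount φ Q Finset.univ a =
      em (∑ x ∈ (solutionSet_finite hpt Finset.univ a).toFinset,
        ∏ i, expCharacter (.ofAdd (c i)) ^ x i) := by
    intro a
    rw [weightedCount, finsum_mem_eq_finite_toFinset_sum _ (solutionSet_finite hpt _ a), map_sum]
    refine Finset.sum_congr rfl fun x _ => ?_
    rw [map_prod]
    refine Finset.prod_congr rfl fun i _ => ?_
    rw [map_pow]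
    rfl
  refine ⟨∑ σ ∈ J, ∑ p ∈ Finset.HasAntidiagonal.antidiagonal d,
    (∑ l, MvPolynomial.C (L σ (Pi.single l 1)) * MvPolynomial.X l) ^ p.1 *
      MvPolynomial.C (1 / p.1.factorial * PowerSeries.coeff p.2 (U σ)), ?_⟩
  intro a B t hB ht hJt
  have hbrion := S.weightedCount_eq_vertexSum hpt (fun i => hE0 _) hgen hB ht
    (Finset.subset_univ B) a
  have hsum : vertexSum φ ℬ y Q Finset.univ
      (sideWeight K y (shiftPoint φ t Finset.univ a) 0) a =
        ∑ σ ∈ J, vertexTerm φ y Q Finset.univ σ a := by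
    rw [vertexSum, Finset.filter_true_of_mem fun _ _ => Finset.subset_univ _,
      ← Finset.sum_subset hJ]
    · refine Finset.sum_congr rfl fun σ hσ => ?_
      rw [sideWeight, if_pos fun i hi => Or.inl ((hJt σ (hJ hσ)).1 hσ i hi), one_mul]
    · intro σ hσ hσJ
      rw [sideWeight, if_neg, zero_mul]
      intro h
      exact hσJ ((hJt σ hσ).2 fun i hi => by simpa using h i hi)
  rw [hsum, hcount] at hbrion
  have hseries : PowerSeries.X ^ d * ∑ x ∈ (solutionSet_finite hpt Finset.univ a).toFinset,
      ∏ i, expCharacter (.ofAdd (c i)) ^ x i = ∑ σ ∈ J, expCharacter (.ofAdd (L σ a)) * U σ := by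
    apply hemi
    rw [map_mul, hbrion, map_pow, Finset.mul_sum, map_sum]
    exact Finset.sum_congr rfl fun σ hσ => hterm σ (hJ hσ) a
  have hcoeff := congrArg (PowerSeries.coeff d) hseries
  have hone : ∀ x : ι → ℕ, PowerSeries.coeff 0 (∏ i, expCharacter (.ofAdd (c i)) ^ x i) = 1 := by
    intro x
    simp [map_prod, constantCoeff_expCharacter]
  have hlin : ∀ σ, ∑ l, L σ (Pi.single l 1) * (a l : ℚ) = L σ a := by
    intro σ
    simp only [hL, Finset.sum_mul]
    rw [Finset.sum_comm]
    refine Finset.sum_congr rfl fun i _ => ?_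
    have : y σ i a = ∑ l, y σ i (Pi.single l 1) * a l := by
      conv_lhs => rw [← Finset.univ_sum_single a, map_sum]
      refine Finset.sum_congr rfl fun l _ => ?_
      rw [mul_comm, ← smul_eq_mul, ← map_zsmul, ← Pi.single_smul, smul_eq_mul, mul_one]
    rw [this]
    push_cast
    rw [Finset.mul_sum]
    exact Finset.sum_congr rfl fun l _ => by ring
  have hz := PowerSeries.coeff_X_pow_mul (∑ x ∈ (solutionSet_finite hpt Finset.univ a).toFinset,
      ∏ i, expCharacter (.ofAdd (c i)) ^ x i) d 0
  rw [zero_add] at hz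
  rw [hz, map_sum, Finset.sum_congr rfl fun x _ => hone x, Finset.sum_const, nsmul_one,
    ← Set.ncard_eq_toFinset_card _ (solutionSet_finite hpt Finset.univ a), map_sum] at hcoeff
  rw [hcoeff, map_sum]
  refine Finset.sum_congr rfl fun σ _ => ?_
  rw [PowerSeries.coeff_mul, map_sum (MvPolynomial.eval _)]
  refine Finset.sum_congr rfl fun p _ => ?_
  rw [coeff_expCharacter, map_mul, map_pow, map_sum (MvPolynomial.eval _), MvPolynomial.eval_C]
  simp only [map_mul, MvPolynomial.eval_C, MvPolynomial.eval_X]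
  rw [hlin, mul_assoc]

end Polynomiality

section GenericShift

theorem eventually_add_mul_ne_zero {a b : ℝ} (hb : b ≠ 0) :
    ∀ᶠ e in nhdsWithin (0 : ℝ) (Set.Ioi 0), a + e * b ≠ 0 := by
  by_cases ha : a = 0
  · filter_upwards [self_mem_nhdsWithin] with e he
    rw [ha, zero_add]
    exact mul_ne_zero (ne_of_gt he) hb
  · refine nhdsWithin_le_nhds (ContinuousAt.eventually_ne ?_ ?_)
    · fun_prop
    · simpa using ha

/-- A point satisfying finitely many strict linear inequalities can be scaled and perturbed so
that finitely many nonzero linear functionals take nonintegral values. -/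
theorem exists_pos_forall_ne_intCast {ι κ κ' : Type*} [Finite ι] [Finite κ] [Finite κ']
    (f : κ → Module.Dual ℝ (ι → ℝ)) (hf : ∀ k, ∃ x, f k x ≠ 0)
    (g : κ' → Module.Dual ℝ (ι → ℝ)) {s : ι → ℝ} (hg : ∀ m, 0 < g m s) :
    ∃ t : ι → ℝ, (∀ k, ∀ n : ℤ, f k t ≠ n) ∧ (∀ m, 0 < g m t) ∧ ∀ i, t i < 1 := by
  obtain ⟨v, hv⟩ := Module.Dual.exists_forall_ne_zero_of_forall_exists f hf
  have h1 : ∀ᶠ e in nhdsWithin (0 : ℝ) (Set.Ioi 0), ∀ k, f k (s + e • v) ≠ 0 := by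
    refine Filter.eventually_all.2 fun k => ?_
    filter_upwards [eventually_add_mul_ne_zero (a := f k s) (hv k)] with e he
    simpa using he
  have h2 : ∀ᶠ e in nhdsWithin (0 : ℝ) (Set.Ioi 0), ∀ m, 0 < g m (s + e • v) := by
    refine Filter.eventually_all.2 fun m => nhdsWithin_le_nhds ?_
    have : ContinuousAt (fun e : ℝ => g m s + e * g m v) 0 := by fun_prop
    filter_upwards [this.eventually_const_lt (u := 0) (by simpa using hg m)] with e he
    simpa using he
  obtain ⟨e, he1, he2⟩ := (h1.and h2).exists
  set w := s + e • v
  have h3 : ∀ᶠ δ in nhdsWithin (0 : ℝ) (Set.Ioi 0), ∀ k, |δ * f k w| < 1 := by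
    refine Filter.eventually_all.2 fun k => nhdsWithin_le_nhds ?_
    have : ContinuousAt (fun δ : ℝ => |δ * f k w|) 0 := by fun_prop
    exact this.eventually_lt_const (by simp)
  have h4 : ∀ᶠ δ in nhdsWithin (0 : ℝ) (Set.Ioi 0), ∀ i, δ * w i < 1 := by
    refine Filter.eventually_all.2 fun i => nhdsWithin_le_nhds ?_
    have : ContinuousAt (fun δ : ℝ => δ * w i) 0 := by fun_prop
    exact this.eventually_lt_const (by simp)
  obtain ⟨δ, ⟨hδ3, hδ4⟩, hδ⟩ := ((h3.and h4).and self_mem_nhdsWithin).exists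
  have hδ : 0 < δ := hδ
  refine ⟨δ • w, fun k n h => ?_, fun m => ?_, fun i => ?_⟩
  · rw [map_smul, smul_eq_mul] at h
    have h5 := hδ3 k
    rw [h] at h5
    have h6 : |n| < 1 := by exact_mod_cast h5
    rw [Int.abs_lt_one_iff.1 h6, Int.cast_zero] at h
    exact mul_ne_zero hδ.ne' (he1 k) h
  · rw [map_smul, smul_eq_mul]
    exact mul_pos hδ (he2 m)
  · simpa using hδ4 i

variable {ι M : Type*} [DecidableEq ι] [AddCommGroup M]
  {φ : ι → M} {ℬ : Finset (Finset ι)} {y : Finset ι → ι → M →+ ℤ}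

omit [DecidableEq ι] in
theorem finite_wallFunctionals [Finite ι] : (wallFunctionals φ ℬ y).Finite := by
  refine ((Set.finite_range fun p : Finset ι × ι => y p.1 p.2).union
    (Set.finite_range fun p : Finset ι × ι × ι × ι =>
      y p.1 p.2.1 (φ p.2.2.2) • y p.1 p.2.2.1 - y p.1 p.2.2.1 (φ p.2.2.2) • y p.1 p.2.1)).subset ?_
  rintro l (⟨σ, -, i, -, rfl⟩ | ⟨σ, -, i, -, j, -, k, -, -, rfl⟩)
  · exact Or.inl ⟨(σ, i), rfl⟩
  · exact Or.inr ⟨(σ, i, j, k), rfl⟩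

theorem UnimodularBases.exists_ne_zero_of_mem_wallFunctionals (S : UnimodularBases φ ℬ y)
    {l : M →+ ℤ} (hl : l ∈ wallFunctionals φ ℬ y) : ∃ a, l a ≠ 0 := by
  rcases hl with ⟨σ, hσ, i, hi, rfl⟩ | ⟨σ, hσ, i, hi, j, hj, k, hij, hk, rfl⟩
  · exact ⟨φ i, by rw [S.coord_self hσ hi]; exact one_ne_zero⟩
  · refine ⟨φ j, ?_⟩
    simpa [S.coord_self hσ hj, S.coord_ne hσ hi hj hij] using hk

theorem UnimodularBases.exists_isGenericShift (S : UnimodularBases φ ℬ y) [Fintype ι]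
    {B : Finset ι} (hB : B ∈ ℬ) {J : Set (Finset ι)} {s : ι → ℝ} (hs : ∀ i, 0 < s i)
    (hJ : ∀ σ ∈ J, ∀ i ∈ σ, 0 < ∑ j, s j * (y σ i (φ j) : ℝ)) :
    ∃ t, IsGenericShift φ ℬ y B t ∧ ∀ σ ∈ J, ∀ i ∈ σ, 0 < ∑ j, t j * (y σ i (φ j) : ℝ) := by
  have hfin := finite_wallFunctionals (φ := φ) (ℬ := ℬ) (y := y)
  have := hfin.to_subtype
  have hsum : ∀ (X : Finset ι) (l : M →+ ℤ) (x : ι → ℝ),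
      (∑ i ∈ X, (l (φ i) : ℝ) • LinearMap.proj i : Module.Dual ℝ (ι → ℝ)) x =
        ∑ i ∈ X, x i * (l (φ i) : ℝ) := by
    intro X l x
    simp [LinearMap.sum_apply, mul_comm]
  obtain ⟨t, ht1, ht2, ht3⟩ := exists_pos_forall_ne_intCast
    (fun p : wallFunctionals φ ℬ y × {X : Finset ι // B ⊆ X} =>
      (∑ i ∈ p.2.1, (p.1.1 (φ i) : ℝ) • LinearMap.proj i : Module.Dual ℝ (ι → ℝ))) (by
        rintro ⟨⟨l, hl⟩, ⟨X, hX⟩⟩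
        obtain ⟨b, hb, hb0⟩ : ∃ b ∈ B, l (φ b) ≠ 0 := by
          by_contra! h
          obtain ⟨a, ha⟩ := S.exists_ne_zero_of_mem_wallFunctionals hl
          refine ha ?_
          rw [S.apply_eq_sum hB l a]
          exact Finset.sum_eq_zero fun i hi => by rw [h i hi, mul_zero]
        refine ⟨Pi.single b 1, ?_⟩
        rw [hsum, Finset.sum_eq_single_of_mem b (hX hb)]
        · simpa using hb0
        · intro i _ hib
          rw [Pi.single_eq_of_ne hib, zero_mul])
    (Sum.elim (fun i : ι => (LinearMap.proj i : Module.Dual ℝ (ι → ℝ)))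
      fun p : {p : Finset ι × ι // p.1 ∈ J ∧ p.2 ∈ p.1} =>
        ∑ i, (y p.1.1 p.1.2 (φ i) : ℝ) • LinearMap.proj i)
    (s := s) (by
      rintro (i | ⟨⟨σ, i⟩, hσ, hi⟩)
      · exact hs i
      · rw [Sum.elim_inr, hsum]
        exact hJ σ hσ i hi)
  refine ⟨t, ⟨fun i => ht2 (Sum.inl i), ht3, fun l hl X hX n => ?_⟩, fun σ hσ i hi => ?_⟩
  · have := ht1 (⟨l, hl⟩, ⟨X, hX⟩) n
    rwa [hsum] at this
  · have := ht2 (Sum.inr ⟨(σ, i), hσ, hi⟩)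
    rwa [Sum.elim_inr, hsum] at this

end GenericShift

section Lattice

variable {N r : ℕ}

/-- The real vectors underlying a family of integral vectors. -/
def realVec (φ : Fin N → Fin r → ℤ) (i : Fin N) (j : Fin r) : ℝ := (φ i j : ℝ)

/-- The real-linear extension of an integral functional. -/
def realExt (l : (Fin r → ℤ) →+ ℤ) : (Fin r → ℝ) →ₗ[ℝ] ℝ :=
  ∑ k, (l (Pi.single k 1) : ℝ) • LinearMap.proj k

theorem realExt_apply (l : (Fin r → ℤ) →+ ℤ) (v : Fin r → ℝ) :
    realExt l v = ∑ k, (l (Pi.single k 1) : ℝ) * v k := by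
  simp [realExt, LinearMap.sum_apply]

theorem realExt_intCast (l : (Fin r → ℤ) →+ ℤ) (a : Fin r → ℤ) :
    realExt l (fun j => (a j : ℝ)) = l a := by
  have : l a = ∑ k, l (Pi.single k 1) * a k := by
    conv_lhs => rw [← Finset.univ_sum_single a, map_sum]
    refine Finset.sum_congr rfl fun k _ => ?_
    rw [mul_comm, ← smul_eq_mul, ← map_zsmul, ← Pi.single_smul, smul_eq_mul, mul_one]
  rw [realExt_apply, this]
  push_cast
  rfl

theorem realExt_realVec (l : (Fin r → ℤ) →+ ℤ) (φ : Fin N → Fin r → ℤ) (i : Fin N) :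
    realExt l (realVec φ i) = l (φ i) :=
  realExt_intCast l (φ i)

theorem continuous_realExt (l : (Fin r → ℤ) →+ ℤ) : Continuous (realExt l) :=
  (realExt l).continuous_of_finiteDimensional

open Classical in
/-- The set of all basic subsets of a family of integral vectors. -/
def basicSubsets (φ : Fin N → Fin r → ℤ) : Finset (Finset (Fin N)) :=
  Finset.univ.filter fun σ => IsBasic (realVec φ) σ

theorem mem_basicSubsets {φ : Fin N → Fin r → ℤ} {σ : Finset (Fin N)} :
    σ ∈ basicSubsets φ ↔ IsBasic (realVec φ) σ := by
  simp [basicSubsets]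

theorem exists_coordinates {φ : Fin N → Fin r → ℤ} {σ : Finset (Fin N)} (hσ : σ.card = r)
    (hdet : ∀ e : Fin r ≃ {i // i ∈ σ},
      (Matrix.det (Matrix.of fun k l => φ (e k : Fin N) l)).natAbs = 1) :
    ∃ f : Fin N → (Fin r → ℤ) →+ ℤ,
      (∀ i ∈ σ, ∀ j ∈ σ, f i (φ j) = if i = j then 1 else 0) ∧ ∀ a, ∑ i ∈ σ, f i a • φ i = a := by
  set e : Fin r ≃ {i // i ∈ σ} := (σ.equivFinOfCardEq hσ).symm
  set A : Matrix (Fin r) (Fin r) ℤ := Matrix.of fun k l => φ (e k : Fin N) l with hA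
  have hunit : IsUnit A.det := Int.isUnit_iff_natAbs_eq.2 (hdet e)
  have hrow : ∀ k, A k = φ (e k) := fun k => rfl
  refine ⟨fun i => if h : i ∈ σ then
    (Pi.evalAddMonoidHom (fun _ => ℤ) (e.symm ⟨i, h⟩)).comp
      (Matrix.vecMulLinear A⁻¹).toAddMonoidHom else 0, ?_, ?_⟩
  · intro i hi j hj
    have hφ : φ j = Matrix.vecMul (Pi.single (e.symm ⟨j, hj⟩) 1) A := by
      rw [Matrix.single_one_vecMul]
      simp [Matrix.row, hrow]
    simp only [dif_pos hi]
    change Matrix.vecMul (φ j) A⁻¹ (e.symm ⟨i, hi⟩) = _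
    rw [hφ, Matrix.vecMul_vecMul, Matrix.mul_nonsing_inv _ hunit, Matrix.vecMul_one, Pi.single_apply]
    simp
  · intro a
    rw [← Finset.sum_coe_sort, ← e.sum_comp]
    have : ∀ k, (if h : (e k : Fin N) ∈ σ then
        (Pi.evalAddMonoidHom (fun _ => ℤ) (e.symm ⟨e k, h⟩)).comp
          (Matrix.vecMulLinear A⁻¹).toAddMonoidHom else 0) a • φ (e k) =
        Matrix.vecMul a A⁻¹ k • A k := by
      intro k
      rw [dif_pos (e k).2, hrow]
      simp
    rw [Finset.sum_congr rfl fun k _ => this k, ← Matrix.vecMul_eq_sum, Matrix.vecMul_vecMul,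
      Matrix.nonsing_inv_mul _ hunit, Matrix.vecMul_one]

theorem exists_unimodularBases (φ : Fin N → Fin r → ℤ)
    (hunimod : ∀ σ : Finset (Fin N), IsBasic (realVec φ) σ → ∀ e : Fin r ≃ {i // i ∈ σ},
      (Matrix.det (Matrix.of fun k l => φ (e k : Fin N) l)).natAbs = 1) :
    ∃ y, UnimodularBases φ (basicSubsets φ) y := by
  choose! y hy1 hy2 using fun σ (hσ : σ ∈ basicSubsets φ) =>
    exists_coordinates (mem_basicSubsets.1 hσ).1 (hunimod σ (mem_basicSubsets.1 hσ))
  refine ⟨y, ⟨hy1, hy2, fun σ hσ i hi j hj => ?_⟩⟩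
  have hn : j ∉ σ.erase i := by
    intro h
    obtain ⟨hji, hjσ⟩ := Finset.mem_erase.1 h
    rw [hy1 σ hσ i hi j hjσ, if_neg hji.symm] at hj
    exact hj rfl
  obtain ⟨hcard, hli⟩ := mem_basicSubsets.1 hσ
  have hli : LinearIndepOn ℝ (realVec φ) (σ : Set (Fin N)) := hli
  refine mem_basicSubsets.2 ⟨?_, ?_⟩
  · rw [Finset.card_insert_of_notMem hn, Finset.card_erase_add_one hi, hcard]
  · suffices h : LinearIndepOn ℝ (realVec φ) (insert j (σ.erase i) : Finset (Fin N)) from h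
    rw [Finset.coe_insert, linearIndepOn_insert (by exact_mod_cast hn)]
    refine ⟨hli.mono (by simp), fun h => ?_⟩
    have hle : Submodule.span ℝ (realVec φ '' (σ.erase i : Finset (Fin N))) ≤
        LinearMap.ker (realExt (y σ i)) := by
      rw [Submodule.span_le]
      rintro _ ⟨l, hl, rfl⟩
      obtain ⟨hli, hlσ⟩ := Finset.mem_erase.1 (Finset.mem_coe.1 hl)
      rw [SetLike.mem_coe, LinearMap.mem_ker, realExt_realVec, hy1 σ hσ i hi l hlσ,
        if_neg hli.symm, Int.cast_zero]
    have := hle h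
    rw [LinearMap.mem_ker, realExt_realVec] at this
    exact hj (by exact_mod_cast this)

theorem span_realVec {φ : Fin N → Fin r → ℤ} (h : Submodule.span ℤ (Set.range φ) = ⊤) :
    Submodule.span ℝ (Set.range (realVec φ)) = ⊤ := by
  have hcast : ∀ a : Fin r → ℤ,
      (fun j => (a j : ℝ)) ∈ Submodule.span ℝ (Set.range (realVec φ)) := by
    intro a
    have ha : a ∈ Submodule.span ℤ (Set.range φ) := h ▸ Submodule.mem_top
    induction ha using Submodule.span_induction with
    | mem x hx =>
      obtain ⟨i, rfl⟩ := hx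
      exact Submodule.subset_span ⟨i, rfl⟩
    | zero =>
      simp only [Pi.zero_apply, Int.cast_zero]
      exact Submodule.zero_mem _
    | add x z _ _ hx hz => simpa [Pi.add_def] using Submodule.add_mem _ hx hz
    | smul n x _ hx =>
      have := Submodule.smul_mem _ (n : ℝ) hx
      simpa [Pi.smul_def] using this
  rw [eq_top_iff]
  intro v _
  rw [pi_eq_sum_univ v]
  refine Submodule.sum_mem _ fun i _ => Submodule.smul_mem _ _ ?_
  convert hcast (fun j => if i = j then 1 else 0) using 2
  simp

theorem basicSubsets_nonempty {φ : Fin N → Fin r → ℤ}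
    (h : Submodule.span ℤ (Set.range φ) = ⊤) : (basicSubsets φ).Nonempty := by
  classical
  obtain ⟨κ, a, ha, hspan, hli⟩ := exists_linearIndependent' ℝ (realVec φ)
  have := Finite.of_injective a ha
  have := Fintype.ofFinite κ
  refine ⟨Finset.univ.image a, mem_basicSubsets.2 ⟨?_, ?_⟩⟩
  · rw [Finset.card_image_of_injective _ ha, Finset.card_univ, ← finrank_span_eq_card hli, hspan,
      span_realVec h, finrank_top, Module.finrank_fin_fun]
  · suffices h : LinearIndepOn ℝ (realVec φ) (Finset.univ.image a : Finset (Fin N)) from h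
    rwa [Finset.coe_image, Finset.coe_univ, Set.image_univ, linearIndepOn_range_iff ha]

section Cones

variable {φ : Fin N → Fin r → ℤ} {y : Finset (Fin N) → Fin N → (Fin r → ℤ) →+ ℤ}
  (S : UnimodularBases φ (basicSubsets φ) y) {σ : Finset (Fin N)} (hσ : σ ∈ basicSubsets φ)

include S hσ

theorem sum_realExt_smul (v : Fin r → ℝ) : ∑ i ∈ σ, realExt (y σ i) v • realVec φ i = v := by
  have h : ∀ k j, ∑ i ∈ σ, (y σ i (Pi.single k 1) : ℝ) * (φ i j : ℝ) =
      if j = k then 1 else 0 := by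
    intro k j
    have := congrFun (S.expand σ hσ (Pi.single k 1)) j
    rw [Finset.sum_apply, Pi.single_apply] at this
    simp only [Pi.smul_apply, smul_eq_mul] at this
    exact_mod_cast this
  ext j
  rw [Finset.sum_apply]
  simp only [Pi.smul_apply, smul_eq_mul, realExt_apply, Finset.sum_mul]
  rw [Finset.sum_comm]
  have : ∀ k, ∑ i ∈ σ, (y σ i (Pi.single k 1) : ℝ) * v k * realVec φ i j =
      if j = k then v k else 0 := by
    intro k
    have := congrArg (· * v k) (h k j)
    simp only [Finset.sum_mul, ite_mul, one_mul, zero_mul] at this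
    rw [← this]
    exact Finset.sum_congr rfl fun i _ => by rw [realVec]; ring
  simp [this]

theorem mem_coneOf_iff {v : Fin r → ℝ} :
    v ∈ coneOf (realVec φ) σ ↔ ∀ i ∈ σ, 0 ≤ realExt (y σ i) v := by
  constructor
  · rintro ⟨c, hc, hc0, rfl⟩ i hi
    rw [map_sum]
    refine Finset.sum_nonneg fun j _ => ?_
    rw [map_smul, realExt_realVec, smul_eq_mul]
    by_cases hj : j ∈ σ
    · rw [S.coord_apply σ hσ i hi j hj]
      exact mul_nonneg (hc j) (by split_ifs <;> simp)
    · rw [hc0 j hj, zero_mul]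
  · intro h
    refine ⟨fun i => if i ∈ σ then realExt (y σ i) v else 0, fun i => ?_, fun i hi => if_neg hi, ?_⟩
    · beta_reduce
      split_ifs with hi
      · exact h i hi
      · exact le_rfl
    · simp only [ite_smul, zero_smul, Finset.sum_ite_mem, Finset.univ_inter]
      exact (sum_realExt_smul S hσ v).symm

theorem realExt_pos_of_mem_interior {v : Fin r → ℝ} (hv : v ∈ interior (coneOf (realVec φ) σ))
    {i : Fin N} (hi : i ∈ σ) : 0 < realExt (y σ i) v := by
  have hcont : ContinuousAt (fun e : ℝ => v - e • realVec φ i) 0 := by fun_prop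
  have hev := hcont.eventually_mem (s := coneOf (realVec φ) σ)
    (by simpa using mem_interior_iff_mem_nhds.1 hv)
  obtain ⟨e, he, he0⟩ := ((hev.filter_mono nhdsWithin_le_nhds).and
    (self_mem_nhdsWithin : Set.Ioi (0 : ℝ) ∈ nhdsWithin 0 (Set.Ioi 0))).exists
  have he0 : 0 < e := he0
  have := (mem_coneOf_iff S hσ).1 he i hi
  rw [map_sub, map_smul, realExt_realVec, S.coord_self hσ hi] at this
  simp only [Int.cast_one, smul_eq_mul, mul_one] at this
  linarith

end Cones

end Lattice

section Chambers

variable {N r : ℕ} {φ : Fin N → Fin r → ℤ}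

theorem exists_pos_realVec_sum_mem_interior {I : Set (Finset (Fin N))}
    (hfeas : IsFeasible (realVec φ) I) :
    ∃ s : Fin N → ℝ, (∀ i, 0 < s i) ∧
      ∀ σ ∈ I, ∑ j, s j • realVec φ j ∈ interior (coneOf (realVec φ) σ) := by
  obtain ⟨p, hp⟩ := hfeas
  rcases I.eq_empty_or_nonempty with rfl | ⟨τ, hτ⟩
  · exact ⟨1, fun i => one_pos, by simp⟩
  have hcont : ContinuousAt (fun e : ℝ => p - e • ∑ j, realVec φ j) 0 := by fun_prop
  have hev := hcont.eventually_mem (s := Fcone (realVec φ) I)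
    (by simpa using mem_interior_iff_mem_nhds.1 hp)
  obtain ⟨e, he, he0⟩ := ((hev.filter_mono nhdsWithin_le_nhds).and
    (self_mem_nhdsWithin : Set.Ioi (0 : ℝ) ∈ nhdsWithin 0 (Set.Ioi 0))).exists
  obtain ⟨c, hc, -, hce⟩ : p - e • ∑ j, realVec φ j ∈ coneOf (realVec φ) τ :=
    Set.biInter_subset_of_mem hτ he
  refine ⟨fun j => c j + e, fun j => add_pos_of_nonneg_of_pos (hc j) he0, fun σ hσ => ?_⟩
  have hsum : ∑ j, (c j + e) • realVec φ j = p := by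
    simp only [add_smul, Finset.sum_add_distrib, ← Finset.smul_sum, ← hce, sub_add_cancel]
  rw [hsum]
  exact interior_mono (Set.biInter_subset_of_mem hσ) hp

variable {y : Finset (Fin N) → Fin N → (Fin r → ℤ) →+ ℤ}

theorem realExt_sum_smul_realVec (l : (Fin r → ℤ) →+ ℤ) (s : Fin N → ℝ) :
    realExt l (∑ j, s j • realVec φ j) = ∑ j, s j * (l (φ j) : ℝ) := by
  simp only [map_sum, map_smul, realExt_realVec, smul_eq_mul]

/-- The cones of the bases in which a given point has positive coordinates intersect in a set with
nonempty interior. -/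
theorem isFeasible_of_realExt_pos (S : UnimodularBases φ (basicSubsets φ) y) (p : Fin r → ℝ)
    {J : Set (Finset (Fin N))} (hJ : ∀ σ ∈ J, σ ∈ basicSubsets φ)
    (hpos : ∀ σ ∈ J, ∀ i ∈ σ, 0 < realExt (y σ i) p) : IsFeasible (realVec φ) J := by
  refine ⟨p, mem_interior_iff_mem_nhds.2 ?_⟩
  have hev : ∀ᶠ v in nhds p, ∀ σ, σ ∈ J → ∀ i, i ∈ σ → 0 < realExt (y σ i) v := by
    simp only [Filter.eventually_all]
    intro σ hσ i hi
    exact (continuous_realExt (y σ i)).continuousAt.eventually_const_lt (hpos σ hσ i hi)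
  filter_upwards [hev] with v hv
  exact Set.mem_iInter₂.2 fun σ hσ =>
    (mem_coneOf_iff S (hJ σ hσ)).2 fun i hi => (hv σ hσ i hi).le

theorem IsChamber.mem_iff_shiftPoint_pos {I : Set (Finset (Fin N))}
    (hI : IsChamber (realVec φ) I) (S : UnimodularBases φ (basicSubsets φ) y) {t : Fin N → ℝ}
    (ht : ∀ σ ∈ I, ∀ i ∈ σ, 0 < ∑ j, t j * (y σ i (φ j) : ℝ)) {a : Fin r → ℤ}
    (ha : (fun j => (a j : ℝ)) ∈ Fcone (realVec φ) I) {σ : Finset (Fin N)}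
    (hσ : σ ∈ basicSubsets φ) :
    σ ∈ I ↔ ∀ i ∈ σ, 0 < shiftPoint φ t Finset.univ a (y σ i) := by
  have hpos : ∀ τ ∈ I, ∀ i ∈ τ, 0 < shiftPoint φ t Finset.univ a (y τ i) := by
    intro τ hτ i hi
    have h := (mem_coneOf_iff S (mem_basicSubsets.2 (hI.1 τ hτ))).1
      (Set.biInter_subset_of_mem hτ ha) i hi
    rw [realExt_intCast] at h
    rw [shiftPoint_apply]
    exact add_pos_of_nonneg_of_pos h (ht τ hτ i hi)
  refine ⟨hpos σ, fun h => ?_⟩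
  set J : Set (Finset (Fin N)) :=
    {τ | τ ∈ basicSubsets φ ∧ ∀ i ∈ τ, 0 < shiftPoint φ t Finset.univ a (y τ i)}
  have hJ : J = I := by
    refine hI.2.2 J (fun τ hτ => ⟨mem_basicSubsets.2 (hI.1 τ hτ), hpos τ hτ⟩)
      (fun τ hτ => mem_basicSubsets.1 hτ.1)
      (isFeasible_of_realExt_pos S ((fun j => (a j : ℝ)) + ∑ j, t j • realVec φ j)
        (fun τ hτ => hτ.1) fun τ hτ i hi => ?_)
    rw [map_add, realExt_intCast, realExt_sum_smul_realVec, ← shiftPoint_apply]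
    exact hτ.2 i hi
  rw [← hJ]
  exact ⟨hσ, h⟩

end Chambers

/-- for a unimodular system, the number of lattice points of `P(Φ,a)` is
given by a single polynomial on (the closure of) each chamber. -/
theorem ehrhart_polynomial_on_chamber_of_unimodular
    {N r : ℕ} (φ : Fin N → (Fin r → ℤ)) (hφ : ∀ i, φ i ≠ 0)
    (hspanZ : Submodule.span ℤ (Set.range φ) = ⊤)
    (hunimod : ∀ σ : Finset (Fin N), IsBasic (fun i j => (φ i j : ℝ)) σ →
      ∀ e : Fin r ≃ {i // i ∈ σ},
        (Matrix.det (Matrix.of fun k l => φ (e k : Fin N) l)).natAbs = 1)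
    (hpointed : ∀ x : Fin N → ℝ, (∀ i, 0 ≤ x i) →
      (∑ i, x i • (fun j => (φ i j : ℝ))) = 0 → x = 0)
    (I : Set (Finset (Fin N))) (hI : IsChamber (fun i j => (φ i j : ℝ)) I) :
    ∃ P : MvPolynomial (Fin r) ℚ, ∀ a : Fin r → ℤ,
      (fun j => (a j : ℝ)) ∈ Fcone (fun i j => (φ i j : ℝ)) I →
      (Nat.card {x : Fin N → ℕ // (∑ i, (x i : ℤ) • φ i) = a} : ℚ) =
        MvPolynomial.eval (fun j => (a j : ℚ)) P := by
  obtain ⟨y, S⟩ := exists_unimodularBases φ hunimod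
  obtain ⟨B, hB⟩ := basicSubsets_nonempty hspanZ
  have hI : IsChamber (realVec φ) I := hI
  have hpt : ∀ x : Fin N → ℕ, ∑ i, x i • φ i = 0 → x = 0 := by
    intro x hx
    have h := hpointed (fun i => x i) (fun i => Nat.cast_nonneg _) (by
      ext j
      have := congrFun hx j
      simp only [Finset.sum_apply, Pi.zero_apply, nsmul_eq_mul] at this
      simp only [Finset.sum_apply, Pi.smul_apply, Pi.zero_apply, smul_eq_mul]
      exact_mod_cast this)
    ext i
    simpa using congrFun h i
  obtain ⟨s, hs, hsI⟩ := exists_pos_realVec_sum_mem_interior hI.2.1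
  obtain ⟨t, ht, htI⟩ := S.exists_isGenericShift hB (J := I) hs fun σ hσ i hi => by
    rw [← realExt_sum_smul_realVec]
    exact realExt_pos_of_mem_interior S (mem_basicSubsets.2 (hI.1 σ hσ)) (hsI σ hσ) hi
  classical
  obtain ⟨P, hP⟩ := S.exists_polynomial hpt (fun σ hσ => (mem_basicSubsets.1 hσ).1)
    (Finset.filter_subset (· ∈ I) (basicSubsets φ))
  refine ⟨P, fun a ha => ?_⟩
  rw [← hP a B t hB ht fun σ hσ => ?_]
  · have hset : solutionSet φ Finset.univ a = {x | ∑ i, (x i : ℤ) • φ i = a} := by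
      ext x
      simp [solutionSet]
    rw [hset, ← Nat.card_coe_set_eq]
    rfl
  · rw [Finset.mem_filter, and_iff_right hσ]
    exact hI.mem_iff_shiftPoint_pos S htI ha hσ

end
end

section
/- Let τ be a tope for Δ⁺. Then for ν ⊆ {1,…,N}: ν is a minimal transversal (a transversal such that no proper subset of ν is a transversal) if and only if ν is a basic subset (|ν| = r and {φ_i : i ∈ ν} linearly independent) and τ ⊆ C(ν). -/
noncomputable section

/-- A tope: a nonempty open convex subset of `C(Δ⁺)` disjoint from every wall. -/
def IsTope {N r : ℕ} (φ : Fin N → (Fin r → ℝ)) (τ : Set (Fin r → ℝ)) : Prop :=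
  τ.Nonempty ∧ IsOpen τ ∧ Convex ℝ τ ∧ τ ⊆ coneOf φ Finset.univ ∧
  ∀ W : Submodule ℝ (Fin r → ℝ), IsWall φ W → Disjoint τ (W : Set (Fin r → ℝ))

/-- `pos(W,τ)`: the indices `i` such that `φ i` lies strictly on the same open side of
the wall `W` as the tope `τ`. -/
def posW {N r : ℕ} (φ : Fin N → (Fin r → ℝ)) (W : Submodule ℝ (Fin r → ℝ))
    (τ : Set (Fin r → ℝ)) : Set (Fin N) :=
  {i | ∃ f : (Fin r → ℝ) →ₗ[ℝ] ℝ, LinearMap.ker f = W ∧ 0 < f (φ i) ∧ ∀ y ∈ τ, 0 < f y}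

/-- A transversal for the tope `τ`: a set of indices meeting `pos(W,τ)` for every wall. -/
def IsTransversal {N r : ℕ} (φ : Fin N → (Fin r → ℝ)) (τ : Set (Fin r → ℝ))
    (ν : Finset (Fin N)) : Prop :=
  ∀ W : Submodule ℝ (Fin r → ℝ), IsWall φ W → ∃ i ∈ ν, i ∈ posW φ W τ

open Module in
/-- The span of a subfamily is the span of a linearly independent subfamily of it. -/
lemma exists_linearIndependent_finset_span_eq {N r : ℕ} (φ : Fin N → (Fin r → ℝ))
    (ν : Finset (Fin N)) :
    ∃ s ⊆ ν, LinearIndependent ℝ (fun i : {i // i ∈ s} => φ i) ∧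
      Submodule.span ℝ (φ '' (s : Set (Fin N))) = Submodule.span ℝ (φ '' (ν : Set (Fin N))) ∧
      s.card = finrank ℝ (Submodule.span ℝ (φ '' (ν : Set (Fin N)))) := by
  obtain ⟨b, hbν, -, hb, hli⟩ := exists_linearIndepOn_extension
    (linearIndepOn_empty ℝ φ) (Set.empty_subset (ν : Set (Fin N)))
  lift b to Finset (Fin N) using Set.toFinite b
  have hspan : Submodule.span ℝ (φ '' (b : Set (Fin N))) =
      Submodule.span ℝ (φ '' (ν : Set (Fin N))) :=
    le_antisymm (Submodule.span_mono (Set.image_mono hbν)) (Submodule.span_le.2 hb)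
  have hli' : LinearIndependent ℝ (fun i : {i // i ∈ b} => φ i) := hli
  refine ⟨b, Finset.coe_subset.1 hbν, hli', hspan, ?_⟩
  rw [← hspan, Set.image_eq_range]
  have := finrank_span_eq_card hli'
  rw [Fintype.card_coe] at this
  exact this.symm

lemma finrank_ker_of_ne_zero {r : ℕ} {f : (Fin r → ℝ) →ₗ[ℝ] ℝ} (hf : f ≠ 0) :
    Module.finrank ℝ (LinearMap.ker f) = r - 1 := by
  have h := f.finrank_range_add_finrank_ker
  rw [LinearMap.range_eq_top.2 (LinearMap.surjective hf), finrank_top] at h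
  simp at h
  omega

lemma isWall_ker {N r : ℕ} (φ : Fin N → (Fin r → ℝ)) {f : (Fin r → ℝ) →ₗ[ℝ] ℝ} (hf : f ≠ 0)
    {T : Finset (Fin N)} (hT : Submodule.span ℝ (φ '' (T : Set (Fin N))) = LinearMap.ker f) :
    IsWall φ (LinearMap.ker f) := by
  obtain ⟨s, -, hli, hs, hcard⟩ := exists_linearIndependent_finset_span_eq φ T
  refine ⟨s, ?_, hli, by rw [hs, hT]⟩
  rw [hcard, hT, finrank_ker_of_ne_zero hf]

/-- A subfamily that does not span is contained in a wall. -/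
lemma exists_isWall_ge {N r : ℕ} (φ : Fin N → (Fin r → ℝ))
    (hspan : Submodule.span ℝ (Set.range φ) = ⊤) (ν : Finset (Fin N))
    (hν : Submodule.span ℝ (φ '' (ν : Set (Fin N))) ≠ ⊤) :
    ∃ W, IsWall φ W ∧ Submodule.span ℝ (φ '' (ν : Set (Fin N))) ≤ W := by
  classical
  obtain ⟨b, -, hbli, hb, -⟩ := exists_linearIndependent_finset_span_eq φ ν
  obtain ⟨B, -, hbB, hB, hBli⟩ := exists_linearIndepOn_extension
    (show LinearIndepOn ℝ φ (b : Set (Fin N)) from hbli) (Set.subset_univ _)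
  lift B to Finset (Fin N) using Set.toFinite B
  have hBtop : Submodule.span ℝ (φ '' (B : Set (Fin N))) = ⊤ := by
    rw [eq_top_iff, ← hspan, Submodule.span_le, ← Set.image_univ]
    exact hB
  have hcard : B.card = r := by
    have h := finrank_span_eq_card (R := ℝ) (b := fun i : {i // i ∈ B} => φ i) hBli
    rw [Fintype.card_coe] at h
    rw [← h]
    rw [Set.image_eq_range] at hBtop
    have h2 : Submodule.span ℝ (Set.range fun i : {i // i ∈ B} => φ i) = ⊤ := hBtop
    rw [h2]
    simp
  obtain ⟨a, haB, hab⟩ : ∃ a ∈ B, a ∉ b := by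
    by_contra! h
    have : (B : Set (Fin N)) = b := Set.Subset.antisymm h hbB
    rw [this] at hBtop
    exact hν (hb ▸ hBtop)
  refine ⟨_, ⟨B.erase a, by rw [Finset.card_erase_of_mem haB, hcard], ?_, rfl⟩, ?_⟩
  · exact LinearIndepOn.mono (v := φ) hBli (Finset.coe_subset.2 (Finset.erase_subset a B))
  · rw [← hb]
    refine Submodule.span_mono (Set.image_mono fun i hi => ?_)
    have hi' : i ∈ b := hi
    simp only [Finset.coe_erase, Set.mem_sdiff, Set.mem_singleton_iff]
    exact ⟨hbB hi, fun h => hab (h ▸ hi')⟩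

lemma IsTope.pos_dim {N r : ℕ} {φ : Fin N → (Fin r → ℝ)} {τ : Set (Fin r → ℝ)}
    (hτ : IsTope φ τ) : 0 < r := by
  obtain ⟨⟨y, hy⟩, -, -, -, hW⟩ := hτ
  rcases Nat.eq_zero_or_pos r with rfl | h
  · have hw : IsWall φ ⊥ := ⟨∅, rfl, linearIndependent_empty_type, by simp⟩
    exact absurd (Subsingleton.elim y 0) (by simpa using Set.disjoint_left.1 (hW _ hw) hy)
  · exact h

/-- The open half-space of a wall containing the tope. -/
lemma IsTope.exists_functional {N r : ℕ} {φ : Fin N → (Fin r → ℝ)} {τ : Set (Fin r → ℝ)}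
    (hτ : IsTope φ τ) {W : Submodule ℝ (Fin r → ℝ)} (hW : IsWall φ W) :
    ∃ f : (Fin r → ℝ) →ₗ[ℝ] ℝ, LinearMap.ker f = W ∧ ∀ y ∈ τ, 0 < f y := by
  have hr := hτ.pos_dim
  have hrank : Module.finrank ℝ W = r - 1 := by
    obtain ⟨s, hs, hli, rfl⟩ := hW
    have h := finrank_span_eq_card (R := ℝ) hli
    rw [Fintype.card_coe, hs] at h
    rw [Set.image_eq_range]
    exact h
  have hlt : W < ⊤ := by
    rw [lt_top_iff_ne_top]
    rintro rfl
    simp at hrank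
    omega
  obtain ⟨f, hf, hle⟩ := Submodule.exists_le_ker_of_lt_top W hlt
  have hker : LinearMap.ker f = W :=
    (Submodule.eq_of_le_of_finrank_eq hle (by rw [hrank, finrank_ker_of_ne_zero hf])).symm
  obtain ⟨⟨y, hy⟩, -, hconv, -, hdisj⟩ := hτ
  have hne : ∀ z ∈ τ, f z ≠ 0 := fun z hz h0 =>
    Set.disjoint_left.1 (hdisj W hW) hz (hker ▸ LinearMap.mem_ker.2 h0)
  have hpre : Set.OrdConnected (f '' τ) := (hconv.linear_image f).ordConnected
  have hzero : (0 : ℝ) ∉ f '' τ := fun ⟨z, hz, h0⟩ => hne z hz h0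
  rcases lt_or_gt_of_ne (hne y hy) with h | h
  · refine ⟨-f, by rw [← hker]; ext; simp, fun z hz => ?_⟩
    by_contra hneg
    refine hzero (hpre.out (Set.mem_image_of_mem f hy) (Set.mem_image_of_mem f hz) ⟨h.le, ?_⟩)
    simpa using hneg
  · refine ⟨f, hker, fun z hz => ?_⟩
    by_contra hneg
    exact hzero (hpre.out (Set.mem_image_of_mem f hz) (Set.mem_image_of_mem f hy)
      ⟨not_lt.1 hneg, h.le⟩)

lemma IsTope.isTransversal_of_mem_coneOf {N r : ℕ} {φ : Fin N → (Fin r → ℝ)}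
    {τ : Set (Fin r → ℝ)} (hτ : IsTope φ τ) {ν : Finset (Fin N)} {y : Fin r → ℝ} (hy : y ∈ τ)
    (hyν : y ∈ coneOf φ ν) : IsTransversal φ τ ν := by
  intro W hW
  obtain ⟨f, hker, hpos⟩ := hτ.exists_functional hW
  obtain ⟨c, hc, hc0, rfl⟩ := hyν
  have h := hpos _ hy
  rw [map_sum] at h
  obtain ⟨i, -, hi⟩ := Finset.exists_lt_of_sum_lt (s := Finset.univ) (f := fun _ : Fin N => (0 : ℝ))
    (by simpa using h)
  have hci : c i ≠ 0 := fun h0 => by simp [h0] at hi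
  refine ⟨i, by_contra fun hn => hci (hc0 i hn), f, hker, ?_, hpos⟩
  exact pos_of_mul_pos_right hi (hc i)

lemma IsTransversal.span_eq_top {N r : ℕ} {φ : Fin N → (Fin r → ℝ)}
    (hspan : Submodule.span ℝ (Set.range φ) = ⊤) {τ : Set (Fin r → ℝ)} {ν : Finset (Fin N)}
    (hν : IsTransversal φ τ ν) : Submodule.span ℝ (φ '' (ν : Set (Fin N))) = ⊤ := by
  by_contra hne
  obtain ⟨W, hW, hle⟩ := exists_isWall_ge φ hspan ν hne
  obtain ⟨i, hi, f, hker, hfi, -⟩ := hν W hW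
  have hmem : φ i ∈ LinearMap.ker f :=
    hker ▸ hle (Submodule.subset_span (Set.mem_image_of_mem φ hi))
  exact hfi.ne' hmem

/-- An open set not contained in a full-dimensional finitely generated cone has a point that a
linear functional strictly separates from the cone. -/
lemma exists_separating_functional {N r : ℕ} {φ : Fin N → (Fin r → ℝ)} {τ : Set (Fin r → ℝ)}
    (hopen : IsOpen τ) {ν : Finset (Fin N)}
    (hν : Submodule.span ℝ (φ '' (ν : Set (Fin N))) = ⊤) (hsub : ¬ τ ⊆ coneOf φ ν) :
    ∃ f : (Fin r → ℝ) →ₗ[ℝ] ℝ, ∃ z ∈ τ, 0 < f z ∧ ∀ i ∈ ν, f (φ i) ≤ 0 := by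
  classical
  obtain ⟨y, hy, hyC⟩ := Set.not_subset.1 hsub
  let L : (Fin N → ℝ) →ₗ[ℝ] (Fin r → ℝ) := ∑ i ∈ ν, (LinearMap.proj i).smulRight (φ i)
  have hL : ∀ c, L c = ∑ i ∈ ν, c i • φ i := fun c => by simp [L]
  have hsurj : Function.Surjective L := by
    intro x
    have hx : x ∈ Submodule.span ℝ (φ '' (ν : Set (Fin N))) := hν ▸ Submodule.mem_top
    obtain ⟨c, hc⟩ := Submodule.mem_span_image_finset_iff_exists_fun' ℝ |>.1 hx
    exact ⟨c, by rw [hL, hc]⟩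
  let P : Set (Fin N → ℝ) := {c | ∀ i, 0 < c i}
  have hPopen : IsOpen P := by
    have : P = Set.univ.pi fun _ => Set.Ioi 0 := by ext; simp [P]
    rw [this]
    exact isOpen_set_pi Set.finite_univ fun _ _ => isOpen_Ioi
  have hPconv : Convex ℝ P := by
    have : P = Set.univ.pi fun _ => Set.Ioi 0 := by ext; simp [P]
    rw [this]
    exact convex_pi fun _ _ => convex_Ioi 0
  have hDopen : IsOpen (L '' P) :=
    (LinearMap.toContinuousLinearMap L).isOpenMap hsurj P hPopen
  have hyD : y ∉ L '' P := by
    rintro ⟨c, hc, rfl⟩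
    refine hyC ⟨fun i => if i ∈ ν then c i else 0, fun i => ?_, fun i hi => if_neg hi, ?_⟩
    · dsimp only
      split_ifs
      exacts [(hc i).le, le_rfl]
    · simp [hL, ite_smul, Finset.sum_ite_mem]
  obtain ⟨f, hf⟩ := geometric_hahn_banach_open_point (hPconv.linear_image L) hDopen hyD
  have hf' : ∀ c ∈ P, f (L c) < f y := fun c hc => hf _ (Set.mem_image_of_mem L hc)
  have h1 : (fun _ => 1 : Fin N → ℝ) ∈ P := fun _ => one_pos
  have hfy : 0 ≤ f y := by
    by_contra! hneg
    have hS := hf' _ h1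
    have hS0 := hS.trans hneg
    have h := hf' ((f y / f (L fun _ => 1)) • (fun _ => 1)) fun i => by
      simpa using div_pos_of_neg_of_neg hneg hS0
    rw [map_smul, map_smul, smul_eq_mul, div_mul_cancel₀ _ hS0.ne] at h
    exact lt_irrefl _ h
  have hle : ∀ i ∈ ν, f (φ i) ≤ 0 := by
    intro i hi
    by_contra! hpos
    have hS := hf' _ h1
    have ht : 0 < (f y - f (L fun _ => 1)) / f (φ i) := div_pos (sub_pos.2 hS) hpos
    have h := hf' ((fun _ => 1) + Pi.single i ((f y - f (L fun _ => 1)) / f (φ i))) fun j => by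
      by_cases hj : j = i
      · subst hj
        simp
        linarith
      · simp [hj]
    have hsing : ∀ t : ℝ, L (Pi.single i t) = t • φ i := fun t => by
      rw [hL, Finset.sum_eq_single i]
      · simp
      · intro j _ hj
        simp [hj]
      · exact fun h => absurd hi h
    rw [map_add, map_add, hsing, map_smul, smul_eq_mul, div_mul_cancel₀ _ hpos.ne'] at h
    linarith
  obtain ⟨v, hv⟩ : ∃ v, 0 < f v := ⟨y - L fun _ => 1, by
    rw [map_sub]
    exact sub_pos.2 (hf' _ h1)⟩
  have hcont : Filter.Tendsto (fun t : ℝ => y + t • v) (nhdsWithin 0 (Set.Ioi 0)) (nhds y) := by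
    have : Continuous fun t : ℝ => y + t • v := by fun_prop
    have h := this.tendsto 0
    simp only [zero_smul, add_zero] at h
    exact h.mono_left nhdsWithin_le_nhds
  obtain ⟨t, ht, ht0⟩ := ((hcont.eventually (hopen.mem_nhds hy)).and
    (self_mem_nhdsWithin (a := (0 : ℝ)) (s := Set.Ioi 0))).exists
  refine ⟨f.toLinearMap, y + t • v, ht, ?_, hle⟩
  have := mul_pos (Set.mem_Ioi.1 ht0) hv
  simp
  linarith

/-- A functional separating a point from a full-dimensional finitely generated cone can be rotated
until its kernel is spanned by generators of the cone. -/
lemma exists_facet_functional {N r : ℕ} {φ : Fin N → (Fin r → ℝ)} {ν : Finset (Fin N)}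
    (hν : Submodule.span ℝ (φ '' (ν : Set (Fin N))) = ⊤) {f : (Fin r → ℝ) →ₗ[ℝ] ℝ}
    {z : Fin r → ℝ} (hz : 0 < f z) (hle : ∀ i ∈ ν, f (φ i) ≤ 0) :
    ∃ g : (Fin r → ℝ) →ₗ[ℝ] ℝ, 0 < g z ∧ (∀ i ∈ ν, g (φ i) ≤ 0) ∧
      ∃ T : Finset (Fin N), Submodule.span ℝ (φ '' (T : Set (Fin N))) = LinearMap.ker g := by
  classical
  induction hn : (ν.filter fun i => f (φ i) ≠ 0).card using Nat.strong_induction_on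
    generalizing f with
  | _ n ih =>
  subst hn
  set T := ν.filter fun i => f (φ i) = 0 with hT
  set U := Submodule.span ℝ (φ '' (T : Set (Fin N))) with hU
  have hUker : U ≤ LinearMap.ker f := by
    rw [hU, Submodule.span_le]
    rintro _ ⟨i, hi, rfl⟩
    exact (Finset.mem_filter.1 hi).2
  by_cases heq : U = LinearMap.ker f
  · exact ⟨f, hz, hle, T, heq⟩
  have hlt : U ⊔ Submodule.span ℝ {z} < ⊤ := by
    rw [lt_top_iff_ne_top]
    intro htop
    refine heq (le_antisymm hUker fun x hx => ?_)
    obtain ⟨u, hu, w, hw, rfl⟩ := Submodule.mem_sup.1 (htop ▸ Submodule.mem_top : x ∈ _)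
    obtain ⟨a, rfl⟩ := Submodule.mem_span_singleton.1 hw
    have hfu : f u = 0 := hUker hu
    have ha : a = 0 := by
      rw [LinearMap.mem_ker, map_add, hfu, map_smul, smul_eq_mul, zero_add] at hx
      exact (mul_eq_zero.1 hx).resolve_right hz.ne'
    simpa [ha] using hu
  obtain ⟨g, hg0, hgle⟩ := Submodule.exists_le_ker_of_lt_top _ hlt
  have hgz : g z = 0 := hgle (Submodule.mem_sup_right (Submodule.mem_span_singleton_self z))
  have hgT : ∀ i ∈ ν, f (φ i) = 0 → g (φ i) = 0 := fun i hi h0 =>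
    hgle (Submodule.mem_sup_left (Submodule.subset_span
      (Set.mem_image_of_mem φ (Finset.mem_coe.2 (Finset.mem_filter.2 ⟨hi, h0⟩)))))
  obtain ⟨g, hgz, hgT, j, hj, hgj⟩ : ∃ g : (Fin r → ℝ) →ₗ[ℝ] ℝ, g z = 0 ∧
      (∀ i ∈ ν, f (φ i) = 0 → g (φ i) = 0) ∧ ∃ j ∈ ν, 0 < g (φ j) := by
    obtain ⟨j, hj, hgj⟩ : ∃ j ∈ ν, g (φ j) ≠ 0 := by
      by_contra! h
      refine hg0 (LinearMap.ker_eq_top.1 (top_le_iff.1 ?_))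
      rw [← hν, Submodule.span_le]
      rintro _ ⟨i, hi, rfl⟩
      exact h i hi
    rcases lt_or_gt_of_ne hgj with h | h
    · exact ⟨-g, by simp [hgz], fun i hi h0 => by simp [hgT i hi h0], j, hj, by simpa using h⟩
    · exact ⟨g, hgz, hgT, j, hj, h⟩
  obtain ⟨k, hk, hmin⟩ := Finset.exists_min_image (ν.filter fun i => 0 < g (φ i))
    (fun i => -f (φ i) / g (φ i)) ⟨j, Finset.mem_filter.2 ⟨hj, hgj⟩⟩
  obtain ⟨hkν, hgk⟩ := Finset.mem_filter.1 hk
  set t := -f (φ k) / g (φ k) with ht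
  have ht0 : 0 ≤ t := div_nonneg (neg_nonneg.2 (hle k hkν)) hgk.le
  have hkzero : (f + t • g) (φ k) = 0 := by
    simp [ht, div_mul_cancel₀ _ hgk.ne']
  have hfk : f (φ k) ≠ 0 := fun h0 => hgk.ne' (hgT k hkν h0)
  refine ih _ (Finset.card_lt_card ?_) (f := f + t • g) (by simpa [hgz] using hz) ?_ rfl
  · rw [Finset.ssubset_iff_of_subset]
    · exact ⟨k, Finset.mem_filter.2 ⟨hkν, hfk⟩, fun h => (Finset.mem_filter.1 h).2 hkzero⟩
    · intro i hi
      obtain ⟨hiν, hi0⟩ := Finset.mem_filter.1 hi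
      refine Finset.mem_filter.2 ⟨hiν, fun h0 => hi0 ?_⟩
      simp [h0, hgT i hiν h0]
  · intro i hi
    simp only [LinearMap.add_apply, LinearMap.smul_apply, smul_eq_mul]
    rcases lt_or_ge 0 (g (φ i)) with h | h
    · have := hmin i (Finset.mem_filter.2 ⟨hi, h⟩)
      rw [le_div_iff₀ h] at this
      linarith
    · have := mul_nonpos_of_nonneg_of_nonpos ht0 h
      have := hle i hi
      linarith

lemma IsTransversal.subset_coneOf {N r : ℕ} {φ : Fin N → (Fin r → ℝ)}
    (hspan : Submodule.span ℝ (Set.range φ) = ⊤) {τ : Set (Fin r → ℝ)} (hτ : IsTope φ τ)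
    {ν : Finset (Fin N)} (hν : IsTransversal φ τ ν) : τ ⊆ coneOf φ ν := by
  by_contra hsub
  have htop := hν.span_eq_top hspan
  obtain ⟨f, z, hzτ, hfz, hle⟩ := exists_separating_functional hτ.2.1 htop hsub
  obtain ⟨g, hgz, hgle, T, hT⟩ := exists_facet_functional htop hfz hle
  have hg0 : g ≠ 0 := by
    rintro rfl
    simp at hgz
  obtain ⟨i, hi, h, hker, hhi, hpos⟩ := hν _ (isWall_ker φ hg0 hT)
  have hhz := hpos z hzτ
  have hx : g z • φ i - g (φ i) • z ∈ LinearMap.ker h := by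
    rw [hker]
    simp [mul_comm]
  simp only [LinearMap.mem_ker, map_sub, map_smul, smul_eq_mul] at hx
  have h1 := mul_pos hgz hhi
  have h2 := mul_nonpos_of_nonpos_of_nonneg (hgle i hi) hhz.le
  linarith

/-- A point of the cone of a linearly dependent family lies in the cone of a proper subfamily. -/
lemma exists_erase_mem_coneOf {N r : ℕ} {φ : Fin N → (Fin r → ℝ)} {ν : Finset (Fin N)}
    (hν : ¬ LinearIndependent ℝ (fun i : {i // i ∈ ν} => φ i)) {y : Fin r → ℝ}
    (hy : y ∈ coneOf φ ν) : ∃ k ∈ ν, y ∈ coneOf φ (ν.erase k) := by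
  classical
  obtain ⟨c, hc, hc0, hyc⟩ := hy
  obtain ⟨a, ha, j, hj, haj⟩ : ∃ a : Fin N → ℝ, ∑ i ∈ ν, a i • φ i = 0 ∧ ∃ j ∈ ν, 0 < a j := by
    have h : ¬ LinearIndepOn ℝ φ (ν : Set (Fin N)) := hν
    rw [linearIndepOn_finset_iff] at h
    push Not at h
    obtain ⟨a, ha, j, hj, haj⟩ := h
    rcases lt_or_gt_of_ne haj with h | h
    · exact ⟨-a, by simp [ha], j, hj, by simpa using h⟩
    · exact ⟨a, ha, j, hj, h⟩
  obtain ⟨k, hk, hmin⟩ := Finset.exists_min_image (ν.filter fun i => 0 < a i)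
    (fun i => c i / a i) ⟨j, Finset.mem_filter.2 ⟨hj, haj⟩⟩
  obtain ⟨hkν, hak⟩ := Finset.mem_filter.1 hk
  have ht0 : 0 ≤ c k / a k := div_nonneg (hc k) hak.le
  refine ⟨k, hkν, fun i => c i - c k / a k * (if i ∈ ν then a i else 0), fun i => ?_,
    fun i hi => ?_, ?_⟩
  · dsimp only
    split_ifs with hi
    · rcases lt_or_ge 0 (a i) with h | h
      · have := hmin i (Finset.mem_filter.2 ⟨hi, h⟩)
        rw [le_div_iff₀ h] at this
        linarith
      · have := mul_nonpos_of_nonneg_of_nonpos ht0 h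
        linarith [hc i]
    · simpa using hc i
  · by_cases hik : i = k
    · subst hik
      simp [hkν, div_mul_cancel₀ _ hak.ne']
    · have hiν : i ∉ ν := fun h => hi (Finset.mem_erase.2 ⟨hik, h⟩)
      simp [hiν, hc0 i hiν]
  · have hs : ∑ i, (if i ∈ ν then a i else 0) • φ i = 0 := by
      simpa [ite_smul, Finset.sum_ite_mem] using ha
    simp only [sub_smul, mul_smul, Finset.sum_sub_distrib, ← Finset.smul_sum, hs]
    simp [hyc]

/-- the minimal transversals of a tope `τ` are exactly the basic subsets
`ν` with `τ ⊆ C(ν)`. -/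
theorem minimal_transversal_iff_basic_and_contains_tope
    {N r : ℕ} (φ : Fin N → (Fin r → ℝ)) (hφ : ∀ i, φ i ≠ 0)
    (hspan : Submodule.span ℝ (Set.range φ) = ⊤)
    (τ : Set (Fin r → ℝ)) (hτ : IsTope φ τ) (ν : Finset (Fin N)) :
    (IsTransversal φ τ ν ∧ ∀ ν' : Finset (Fin N), ν' ⊂ ν → ¬ IsTransversal φ τ ν') ↔
    (IsBasic φ ν ∧ τ ⊆ coneOf φ ν) := by
  constructor
  · rintro ⟨hν, hmin⟩
    have hsub := hν.subset_coneOf hspan hτ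
    have hli : LinearIndependent ℝ (fun i : {i // i ∈ ν} => φ i) := by
      by_contra hdep
      obtain ⟨y, hy⟩ := hτ.1
      obtain ⟨k, hk, hyk⟩ := exists_erase_mem_coneOf hdep (hsub hy)
      exact hmin _ (Finset.erase_ssubset hk) (hτ.isTransversal_of_mem_coneOf hy hyk)
    refine ⟨⟨?_, hli⟩, hsub⟩
    have h := finrank_span_eq_card hli
    have htop := hν.span_eq_top hspan
    rw [Set.image_eq_range] at htop
    have htop' : Submodule.span ℝ (Set.range fun i : {i // i ∈ ν} => φ i) = ⊤ := htop
    rw [htop', finrank_top, Module.finrank_fin_fun, Fintype.card_coe] at h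
    exact h.symm
  · rintro ⟨⟨hcard, -⟩, hsub⟩
    obtain ⟨y, hy⟩ := hτ.1
    refine ⟨hτ.isTransversal_of_mem_coneOf hy (hsub hy), fun ν' hlt hν' => ?_⟩
    obtain ⟨s, hs, -, -, hscard⟩ := exists_linearIndependent_finset_span_eq φ ν'
    rw [hν'.span_eq_top hspan, finrank_top, Module.finrank_fin_fun] at hscard
    have h1 := Finset.card_le_card hs
    have h2 := Finset.card_lt_card hlt
    omega

end
end

section
/- Let τ be a tope for Δ⁺. If ν ⊆ {1,…,N} satisfies ν ∩ pos(W,τ) ≠ ∅ for every wall W (i.e. ν is a transversal), then the vectors {φ_i : i ∈ ν} span ℝ^r. -/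
noncomputable section

/-- any transversal of a tope spans `ℝ^r`. -/
theorem transversal_spans
    {N r : ℕ} (φ : Fin N → (Fin r → ℝ)) (hφ : ∀ i, φ i ≠ 0)
    (hspan : Submodule.span ℝ (Set.range φ) = ⊤)
    (τ : Set (Fin r → ℝ)) (hτ : IsTope φ τ)
    (ν : Finset (Fin N)) (hν : IsTransversal φ τ ν) :
    Submodule.span ℝ (φ '' (ν : Set (Fin N))) = ⊤ := by
  classical
  by_contra hne
  obtain ⟨b, hbν, -, hνb, hb⟩ :=
    exists_linearIndepOn_extension (linearIndepOn_empty ℝ φ) (Set.empty_subset (ν : Set (Fin N)))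
  obtain ⟨B, -, hbB, hBspan, hB⟩ := exists_linearIndepOn_extension hb (Set.subset_univ b)
  have hBtop : Submodule.span ℝ (φ '' B) = ⊤ := by
    rw [eq_top_iff, ← hspan, Submodule.span_le, ← Set.image_univ]
    exact hBspan
  obtain ⟨j, hjB, hjb⟩ : ∃ j ∈ B, j ∉ b := by
    by_contra! hBb
    refine hne (eq_top_iff.2 ?_)
    rw [← hBtop]
    exact Submodule.span_mono (Set.image_mono (Set.Subset.trans hBb hbν))
  have hcard : B.toFinset.card = r := by
    have h := finrank_span_eq_card (R := ℝ) (b := fun i : B => φ i) hB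
    have hrange : Set.range (fun i : B => φ i) = φ '' B := (Set.image_eq_range φ B).symm
    rw [hrange, hBtop, finrank_top, Module.finrank_fin_fun] at h
    rw [Set.toFinset_card, h]
  have hwall : IsWall φ (Submodule.span ℝ (φ '' (B.toFinset.erase j : Set (Fin N)))) := by
    refine ⟨B.toFinset.erase j, ?_, ?_, rfl⟩
    · rw [Finset.card_erase_of_mem (Set.mem_toFinset.2 hjB), hcard]
    · exact hB.mono fun i hi => Set.mem_toFinset.1 (Finset.mem_of_mem_erase hi)
  obtain ⟨i, hiν, f, hker, hpos, -⟩ := hν _ hwall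
  have hbs : b ⊆ (B.toFinset.erase j : Set (Fin N)) := fun k hk =>
    Finset.mem_coe.2 (Finset.mem_erase.2
      ⟨fun h => hjb (h ▸ hk), Set.mem_toFinset.2 (hbB hk)⟩)
  have hmem : φ i ∈ LinearMap.ker f := by
    rw [hker]
    exact Submodule.span_mono (Set.image_mono hbs) (hνb (Set.mem_image_of_mem φ hiν))
  exact hpos.ne' (LinearMap.mem_ker.1 hmem)

end
end

section
/- Fix r ≥ 1. Let Φ be a finite family of elements of A_r^+ spanning E_r, in which e_i − e_j occurs with multiplicity m_{ij} ≥ 0; let m ≥ 1 be the maximum of the m_{ij}, ε = 1/(2mr²), and for a ∈ E_r set def(a) = a + ε·Σ_{α∈Φ} α + ε²·(Σ_{i=1}^r e_i − r·e_{r+1}). Then for every a ∈ E_r with integer coordinates: (i) def(a) is regular, i.e. lies on no wall of A_r^+; (ii) if τ is a tope and a ∈ τ, then def(a) ∈ τ; (iii) a ∈ C(A_r^+) if and only if def(a) ∈ C(A_r^+); (iv) a ∈ C(Φ) if and only if def(a) ∈ C(Φ). -/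
noncomputable section

/-- The standard basis vector `e_i` in `ℝ^{r+1}`. -/
def eVec (r : ℕ) (i : Fin (r + 1)) : Fin (r + 1) → ℝ := Pi.single i 1

/-- `E_r = {x ∈ ℝ^{r+1} : Σ x_i = 0}`. -/
def ErSet (r : ℕ) : Set (Fin (r + 1) → ℝ) := {x | ∑ i, x i = 0}

/-- The positive roots `A_r^+ = {e_i - e_j : i < j}`. -/
def posRoots (r : ℕ) : Set (Fin (r + 1) → ℝ) :=
  {v | ∃ i j : Fin (r + 1), i < j ∧ v = eVec r i - eVec r j}

/-- The cone `C(A_r^+)` of nonnegative combinations of the positive roots. -/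
def coneArp (r : ℕ) : Set (Fin (r + 1) → ℝ) :=
  {x | ∃ c : Fin (r + 1) → Fin (r + 1) → ℝ, (∀ i j, 0 ≤ c i j) ∧
    x = ∑ i, ∑ j, if i < j then c i j • (eVec r i - eVec r j) else 0}

/-- The cone `C(Φ)` of nonnegative combinations of the roots present in `Φ`
(those with multiplicity `m i j > 0`). -/
def conePhi (r : ℕ) (m : Fin (r + 1) → Fin (r + 1) → ℕ) : Set (Fin (r + 1) → ℝ) :=
  {x | ∃ c : Fin (r + 1) → Fin (r + 1) → ℝ, (∀ i j, 0 ≤ c i j) ∧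
    (∀ i j, m i j = 0 → c i j = 0) ∧
    x = ∑ i, ∑ j, if i < j then c i j • (eVec r i - eVec r j) else 0}

/-- A wall of `A_r^+`: an `(r-1)`-dimensional subspace of `E_r` spanned by positive
roots. -/
def IsWallArp (r : ℕ) (W : Submodule ℝ (Fin (r + 1) → ℝ)) : Prop :=
  (∃ S : Set (Fin (r + 1) → ℝ), S ⊆ posRoots r ∧ W = Submodule.span ℝ S) ∧
  Module.finrank ℝ W = r - 1

/-- A point is regular if it lies on no wall of `A_r^+`. -/
def IsRegularArp (r : ℕ) (a : Fin (r + 1) → ℝ) : Prop :=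
  ∀ W : Submodule ℝ (Fin (r + 1) → ℝ), IsWallArp r W → a ∉ (W : Set (Fin (r + 1) → ℝ))

/-- The union of all walls of `A_r^+`. -/
def wallUnion (r : ℕ) : Set (Fin (r + 1) → ℝ) :=
  ⋃ W ∈ {W : Submodule ℝ (Fin (r + 1) → ℝ) | IsWallArp r W}, (W : Set (Fin (r + 1) → ℝ))

/-- A tope: a connected component of `C(A_r^+)` minus the union of all walls. -/
def IsTopeArp (r : ℕ) (τ : Set (Fin (r + 1) → ℝ)) : Prop :=
  ∃ x ∈ coneArp r \ wallUnion r, τ = connectedComponentIn (coneArp r \ wallUnion r) x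

/-- The deformation `def(a) = a + ε Σ_{α ∈ Φ} α + ε² (Σ_{i=1}^r e_i - r e_{r+1})` with
`ε = 1/(2 M r²)`, `M` the maximal multiplicity. -/
def defVec (r : ℕ) (m : Fin (r + 1) → Fin (r + 1) → ℕ) (M : ℕ) (a : Fin (r + 1) → ℝ) :
    Fin (r + 1) → ℝ :=
  a + (1 / (2 * (M : ℝ) * (r : ℝ) ^ 2)) •
        (∑ i, ∑ j, if i < j then (m i j : ℝ) • (eVec r i - eVec r j) else 0)
    + ((1 / (2 * (M : ℝ) * (r : ℝ) ^ 2)) ^ 2) •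
        ((∑ i ∈ Finset.univ.erase (Fin.last r), eVec r i) - (r : ℝ) • eVec r (Fin.last r))

/-- The combination `∑_{i < j} c i j (e_i - e_j)` of positive roots. -/
def rootComb (r : ℕ) (c : Fin (r + 1) → Fin (r + 1) → ℝ) : Fin (r + 1) → ℝ :=
  ∑ i, ∑ j, if i < j then c i j • (eVec r i - eVec r j) else 0

theorem sum_mul_eVec (r : ℕ) (y : Fin (r + 1) → ℝ) (i : Fin (r + 1)) :
    ∑ k, y k * eVec r i k = y i := by
  simp [eVec, Pi.single_apply]

theorem sum_mul_rootComb (r : ℕ) (c : Fin (r + 1) → Fin (r + 1) → ℝ) (y : Fin (r + 1) → ℝ) :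
    ∑ k, y k * rootComb r c k = ∑ i, ∑ j, if i < j then c i j * (y i - y j) else 0 := by
  simp only [rootComb, Finset.sum_apply, Finset.mul_sum]
  rw [Finset.sum_comm]
  refine Finset.sum_congr rfl fun i _ => ?_
  rw [Finset.sum_comm]
  refine Finset.sum_congr rfl fun j _ => ?_
  split_ifs with h
  · simp only [Pi.smul_apply, Pi.sub_apply, smul_eq_mul]
    rw [← sum_mul_eVec r y i, ← sum_mul_eVec r y j, ← Finset.sum_sub_distrib, Finset.mul_sum]
    refine Finset.sum_congr rfl fun k _ => ?_
    ring
  · simp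

theorem sum_mem_eq_sum_mul (r : ℕ) (x : Fin (r + 1) → ℝ) (I : Finset (Fin (r + 1))) :
    ∑ k ∈ I, x k = ∑ k, (if k ∈ I then (1 : ℝ) else 0) * x k := by
  simp

theorem continuous_rootComb (r : ℕ) : Continuous (rootComb r) := by
  unfold rootComb
  refine continuous_finsetSum _ fun i _ => continuous_finsetSum _ fun j _ => ?_
  split_ifs <;> fun_prop

theorem mem_conePhi_iff_rootComb {r : ℕ} {m : Fin (r + 1) → Fin (r + 1) → ℕ}
    {x : Fin (r + 1) → ℝ} :
    x ∈ conePhi r m ↔ ∃ c : Fin (r + 1) → Fin (r + 1) → ℝ, (∀ i j, 0 ≤ c i j) ∧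
      (∀ i j, m i j = 0 → c i j = 0) ∧ x = rootComb r c := Iff.rfl

theorem rootComb_add (r : ℕ) (c d : Fin (r + 1) → Fin (r + 1) → ℝ) :
    rootComb r (c + d) = rootComb r c + rootComb r d := by
  simp only [rootComb, ← Finset.sum_add_distrib]
  refine Finset.sum_congr rfl fun i _ => Finset.sum_congr rfl fun j _ => ?_
  split_ifs <;> simp [add_smul]

theorem rootComb_smul (r : ℕ) (t : ℝ) (c : Fin (r + 1) → Fin (r + 1) → ℝ) :
    rootComb r (t • c) = t • rootComb r c := by
  simp only [rootComb, Finset.smul_sum]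
  refine Finset.sum_congr rfl fun i _ => Finset.sum_congr rfl fun j _ => ?_
  split_ifs <;> simp [mul_smul]

/-- The weights `-k` give every positive root `e_i - e_j` the value `j - i ≥ 1`, so the
coefficients of a nonnegative combination are bounded by its weight. -/
theorem coeff_le_weight (r : ℕ) {c : Fin (r + 1) → Fin (r + 1) → ℝ} (hc : ∀ i j, 0 ≤ c i j)
    {i j : Fin (r + 1)} (hij : i < j) :
    c i j ≤ ∑ k : Fin (r + 1), -(k : ℝ) * rootComb r c k := by
  rw [sum_mul_rootComb r c fun k => -(k : ℝ)]
  have hterm : ∀ p q : Fin (r + 1),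
      0 ≤ if p < q then c p q * (-(p : ℝ) - -(q : ℝ)) else 0 := by
    intro p q
    split_ifs with h
    · have : (p : ℝ) ≤ q := by exact_mod_cast h.le
      exact mul_nonneg (hc p q) (by linarith)
    · exact le_rfl
  calc c i j ≤ if i < j then c i j * (-(i : ℝ) - -(j : ℝ)) else 0 := by
        rw [if_pos hij]
        have : (i : ℝ) + 1 ≤ j := by exact_mod_cast hij
        nlinarith [hc i j]
    _ ≤ ∑ q, if i < q then c i q * (-(i : ℝ) - -(q : ℝ)) else 0 :=
        Finset.single_le_sum (f := fun q => if i < q then c i q * (-(i : ℝ) - -(q : ℝ)) else 0)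
          (fun q _ => hterm i q) (Finset.mem_univ j)
    _ ≤ _ := Finset.single_le_sum
          (f := fun p => ∑ q, if p < q then c p q * (-(p : ℝ) - -(q : ℝ)) else 0)
          (fun p _ => Finset.sum_nonneg fun q _ => hterm p q) (Finset.mem_univ i)

theorem isClosed_conePhi (r : ℕ) (m : Fin (r + 1) → Fin (r + 1) → ℕ) :
    IsClosed (conePhi r m) := by
  refine isClosed_of_closure_subset fun x hx => ?_
  set w : (Fin (r + 1) → ℝ) → ℝ := fun y => ∑ k : Fin (r + 1), -(k : ℝ) * y k
  have hwc : Continuous w := by fun_prop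
  set B : ℝ := w x + 1
  set K : Set (Fin (r + 1) → Fin (r + 1) → ℝ) :=
    Set.Icc 0 (fun _ _ => B) ∩ ⋂ i, ⋂ j, {c | m i j = 0 → c i j = 0}
  have hKc : IsCompact K := by
    refine isCompact_Icc.inter_right (isClosed_iInter fun i => isClosed_iInter fun j => ?_)
    by_cases h : m i j = 0
    · simpa [h] using isClosed_eq (by fun_prop) continuous_const
    · simp [h]
  have hKcl : IsClosed (rootComb r '' K) := (hKc.image (continuous_rootComb r)).isClosed
  have hsub : rootComb r '' K ⊆ conePhi r m := by
    rintro _ ⟨c, ⟨hc, hc0⟩, rfl⟩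
    simp only [Set.mem_iInter] at hc0
    exact ⟨c, fun i j => hc.1 i j, hc0, rfl⟩
  refine hsub (hKcl.closure_subset ?_)
  rw [mem_closure_iff] at hx ⊢
  intro U hU hxU
  obtain ⟨y, ⟨hyU, hyB⟩, c, hc, hc0, hyc⟩ :=
    hx (U ∩ {y | w y < B}) (hU.inter (isOpen_lt hwc continuous_const))
      ⟨hxU, by simp [B]⟩
  change y = rootComb r c at hyc
  refine ⟨y, hyU, fun i j => if i < j then c i j else 0, ⟨⟨?_, ?_⟩, ?_⟩, ?_⟩
  · intro i j
    dsimp only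
    split_ifs
    · exact hc i j
    · exact le_rfl
  · have hyB' : w y < B := hyB
    intro i j
    dsimp only
    have hw0 : 0 ≤ w y := by
      rw [hyc]
      change 0 ≤ ∑ k : Fin (r + 1), -(k : ℝ) * rootComb r c k
      rw [sum_mul_rootComb r c fun k => -(k : ℝ)]
      refine Finset.sum_nonneg fun p _ => Finset.sum_nonneg fun q _ => ?_
      split_ifs with h
      · have : (p : ℝ) ≤ q := by exact_mod_cast h.le
        exact mul_nonneg (hc p q) (by linarith)
      · exact le_rfl
    split_ifs with h
    · have := coeff_le_weight r hc h
      rw [← hyc] at this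
      exact this.trans hyB'.le
    · exact hw0.trans hyB'.le
  · simp only [Set.mem_iInter]
    intro i j h
    simp [hc0 i j h]
  · rw [hyc]
    refine Finset.sum_congr rfl fun i _ => Finset.sum_congr rfl fun j _ => ?_
    split_ifs with h <;> simp [h]

theorem sum_sub_mul_nonneg_of_levels {ι : Type*} (x y : ι → ℝ) (s : Finset ι) (b : ℝ)
    (hb : ∀ k ∈ s, b ≤ y k) (h : ∀ t, b < t → 0 ≤ ∑ k ∈ s with t ≤ y k, x k) :
    0 ≤ ∑ k ∈ s, (y k - b) * x k := by
  induction s using Finset.strongInduction generalizing b with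
  | H s ih =>
    rcases s.eq_empty_or_nonempty with rfl | hs
    · simp
    obtain ⟨k₀, hk₀, hmin⟩ := s.exists_min_image y hs
    have h₁ : 0 ≤ (y k₀ - b) * ∑ k ∈ s, x k := by
      rcases (hb k₀ hk₀).eq_or_lt with h' | h'
      · simp [h']
      · have := h _ h'
        rw [Finset.filter_true_of_mem hmin] at this
        exact mul_nonneg (by linarith) this
    have h₂ : 0 ≤ ∑ k ∈ s with y k₀ < y k, (y k - y k₀) * x k := by
      refine ih _ ?_ _ (fun k hk => (Finset.mem_filter.1 hk).2.le) fun t ht => ?_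
      · exact Finset.filter_ssubset.2 ⟨k₀, hk₀, lt_irrefl _⟩
      · rw [Finset.filter_filter]
        have := h t (lt_of_le_of_lt (hb k₀ hk₀) ht)
        convert this using 3 with k
        exact ⟨fun h => h.2, fun h => ⟨ht.trans_le h, h⟩⟩
    have h₃ : ∑ k ∈ s with y k₀ < y k, (y k - y k₀) * x k = ∑ k ∈ s, (y k - y k₀) * x k := by
      refine Finset.sum_filter_of_ne fun k hk hne => ?_
      refine lt_of_le_of_ne (hmin k hk) fun h => hne ?_
      rw [h]; ring
    have h₄ : ∑ k ∈ s, (y k - b) * x k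
        = (y k₀ - b) * ∑ k ∈ s, x k + ∑ k ∈ s, (y k - y k₀) * x k := by
      rw [Finset.mul_sum, ← Finset.sum_add_distrib]
      exact Finset.sum_congr rfl fun k _ => by ring
    linarith

/-- The sets of vertices that no arc of the support of `m` enters. -/
def IsArcClosed {r : ℕ} (m : Fin (r + 1) → Fin (r + 1) → ℕ) (I : Finset (Fin (r + 1))) : Prop :=
  ∀ i j, i < j → m i j ≠ 0 → j ∈ I → i ∈ I

/-- Gale's feasibility criterion: membership in `C(Φ)` is decided by the sums of coordinates over
the sets of vertices that no arc enters. -/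
theorem mem_conePhi_iff {r : ℕ} {m : Fin (r + 1) → Fin (r + 1) → ℕ} {x : Fin (r + 1) → ℝ} :
    x ∈ conePhi r m ↔ ∑ i, x i = 0 ∧ ∀ I, IsArcClosed m I → 0 ≤ ∑ i ∈ I, x i := by
  constructor
  · rw [mem_conePhi_iff_rootComb]
    rintro ⟨c, hc, hc0, rfl⟩
    constructor
    · simpa using sum_mul_rootComb r c fun _ => 1
    · intro I hI
      rw [sum_mem_eq_sum_mul, sum_mul_rootComb r c fun k => if k ∈ I then (1 : ℝ) else 0]
      refine Finset.sum_nonneg fun i _ => Finset.sum_nonneg fun j _ => ?_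
      split_ifs with h hi hj hj
      · simp
      · simpa using hc i j
      · by_cases hm : m i j = 0
        · simp [hc0 i j hm]
        · exact absurd (hI i j h hm hj) hi
      · simp
      · exact le_rfl
  · rintro ⟨hx, hI⟩
    by_contra hxc
    let C : ProperCone ℝ (Fin (r + 1) → ℝ) :=
      { carrier := conePhi r m
        add_mem' := by
          rintro _ _ ⟨c, hc, hc0, rfl⟩ ⟨d, hd, hd0, rfl⟩
          refine ⟨c + d, fun i j => add_nonneg (hc i j) (hd i j), fun i j h => ?_,
            (rootComb_add r c d).symm⟩
          simp [hc0 i j h, hd0 i j h]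
        zero_mem' := ⟨0, by simp, by simp, by simp⟩
        smul_mem' := by
          rintro ⟨t, ht⟩ _ ⟨c, hc, hc0, rfl⟩
          refine ⟨t • c, fun i j => mul_nonneg ht (hc i j), fun i j h => ?_,
            (rootComb_smul r t c).symm⟩
          simp [hc0 i j h]
        isClosed' := isClosed_conePhi r m }
    obtain ⟨f, hf, hfx⟩ := C.hyperplane_separation_point (x₀ := x) hxc
    have hfy : ∀ z : Fin (r + 1) → ℝ, f z = ∑ k, z k * f (eVec r k) := by
      intro z
      conv_lhs => rw [pi_eq_sum_univ' z]
      simp [map_sum, eVec]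
    have hy : ∀ i j, i < j → m i j ≠ 0 → f (eVec r j) ≤ f (eVec r i) := by
      intro i j hij hm
      have : eVec r i - eVec r j ∈ conePhi r m := by
        refine ⟨fun p q => if p = i ∧ q = j then 1 else 0, fun p q => ?_, fun p q h => ?_, ?_⟩
        · dsimp only; split_ifs <;> norm_num
        · refine if_neg ?_
          rintro ⟨rfl, rfl⟩
          exact hm h
        · rw [Finset.sum_eq_single i, Finset.sum_eq_single j]
          · simp [hij]
          · intro q _ hq; simp [hq]
          · simp
          · intro p _ hp; simp [hp]
          · simp
      have := hf _ this
      rw [map_sub] at this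
      linarith
    obtain ⟨b, hb⟩ := (Set.finite_range fun k => f (eVec r k)).bddBelow
    have := sum_sub_mul_nonneg_of_levels x (fun k => f (eVec r k)) Finset.univ b
      (fun k _ => hb ⟨k, rfl⟩) fun t _ => hI _ fun i j hij hm hj => by
        simp only [Finset.mem_filter, Finset.mem_univ, true_and] at hj ⊢
        exact hj.trans (hy i j hij hm)
    simp only [sub_mul, Finset.sum_sub_distrib, ← Finset.mul_sum, hx, mul_zero, sub_zero] at this
    rw [hfy] at hfx
    simp only [mul_comm] at hfx this
    linarith

theorem coneArp_eq_conePhi (r : ℕ) : coneArp r = conePhi r fun _ _ => 1 := by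
  ext x
  simp [coneArp, conePhi]

/-- The coordinate sum over `I` as a linear functional. -/
def coordSum (r : ℕ) (I : Finset (Fin (r + 1))) : (Fin (r + 1) → ℝ) →ₗ[ℝ] ℝ :=
  ∑ i ∈ I, LinearMap.proj i

theorem coordSum_apply (r : ℕ) (I : Finset (Fin (r + 1))) (x : Fin (r + 1) → ℝ) :
    coordSum r I x = ∑ i ∈ I, x i := by
  simp [coordSum]

theorem coordSum_eVec (r : ℕ) (I : Finset (Fin (r + 1))) (i : Fin (r + 1)) :
    coordSum r I (eVec r i) = if i ∈ I then 1 else 0 := by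
  simp [coordSum, eVec, Pi.single_apply]

/-- Every wall is cut out of `E_r` by the vanishing of a proper partial sum of coordinates. -/
theorem IsWallArp.exists_coordSum {r : ℕ} (hr : 1 ≤ r) {W : Submodule ℝ (Fin (r + 1) → ℝ)}
    (hW : IsWallArp r W) :
    ∃ I : Finset (Fin (r + 1)), I.Nonempty ∧ Fin.last r ∉ I ∧
      ∀ x : Fin (r + 1) → ℝ, ∑ i, x i = 0 → (x ∈ W ↔ ∑ i ∈ I, x i = 0) := by
  classical
  obtain ⟨⟨S, hS, hWS⟩, hdim⟩ := hW
  set E := LinearMap.ker (coordSum r Finset.univ) with hE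
  have hmemE : ∀ x, x ∈ E ↔ ∑ i, x i = 0 := fun x => by
    rw [hE, LinearMap.mem_ker, coordSum_apply]
  have hEdim : Module.finrank ℝ E = r := by
    have h0 : coordSum r Finset.univ ≠ 0 := fun h => by
      have := coordSum_eVec r Finset.univ 0
      simp [h] at this
    have : Module.finrank ℝ E + 1 = Module.finrank ℝ (Fin (r + 1) → ℝ) :=
      Module.Dual.finrank_ker_add_one_of_ne_zero h0
    simp only [Module.finrank_fintype_fun_eq_card, Fintype.card_fin] at this
    omega
  set I : Finset (Fin (r + 1)) := {i | eVec r i - eVec r (Fin.last r) ∉ W} with hI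
  have hmemI : ∀ i, i ∈ I ↔ eVec r i - eVec r (Fin.last r) ∉ W := by simp [hI]
  have hne : I.Nonempty := by
    by_contra hemp
    rw [Finset.not_nonempty_iff_eq_empty] at hemp
    have hall : ∀ i, eVec r i - eVec r (Fin.last r) ∈ W := fun i => by
      by_contra h
      have := (hmemI i).2 h
      simp [hemp] at this
    have hEW : E ≤ W := by
      intro x hx
      rw [hmemE] at hx
      have : x = ∑ i, x i • (eVec r i - eVec r (Fin.last r)) := by
        simp only [smul_sub, Finset.sum_sub_distrib, ← Finset.sum_smul, hx, zero_smul, sub_zero]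
        ext k
        simp [eVec, Pi.single_apply]
      rw [this]
      exact W.sum_mem fun i _ => W.smul_mem _ (hall i)
    have := Submodule.finrank_mono hEW
    omega
  have hlast : Fin.last r ∉ I := by simp [hmemI]
  have hWI : W ≤ E ⊓ LinearMap.ker (coordSum r I) := by
    conv_lhs => rw [hWS]
    rw [Submodule.span_le]
    intro s hs
    have hsW : s ∈ W := by rw [hWS]; exact Submodule.subset_span hs
    obtain ⟨i, j, hij, rfl⟩ := hS hs
    have hiff : i ∈ I ↔ j ∈ I := by
      rw [hmemI, hmemI, not_iff_not]
      constructor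
      · intro h
        have := W.sub_mem h hsW
        simpa using this
      · intro h
        have := W.add_mem hsW h
        simpa using this
    refine ⟨?_, ?_⟩
    · simp [hE, coordSum_eVec]
    · simp [coordSum_eVec, hiff]
  have hlt : E ⊓ LinearMap.ker (coordSum r I) < E := by
    refine lt_of_le_of_ne inf_le_left fun h => ?_
    obtain ⟨i, hi⟩ := hne
    have hmem : eVec r i - eVec r (Fin.last r) ∈ E := by simp [hE, coordSum_eVec]
    rw [← h] at hmem
    simpa [coordSum_eVec, hi, hlast] using hmem.2
  have hltdim := Submodule.finrank_lt_finrank_of_lt hlt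
  have hWeq : W = E ⊓ LinearMap.ker (coordSum r I) :=
    Submodule.eq_of_le_of_finrank_le hWI (by omega)
  refine ⟨I, hne, hlast, fun x hx => ?_⟩
  rw [hWeq, Submodule.mem_inf, hmemE, LinearMap.mem_ker, coordSum_apply]
  exact and_iff_right hx

/-- The coordinate sum over `I` of `∑_{α ∈ Φ} α`. -/
def arcBalance {r : ℕ} (m : Fin (r + 1) → Fin (r + 1) → ℕ) (I : Finset (Fin (r + 1))) : ℤ :=
  ∑ i, ∑ j, if i < j then
    (m i j : ℤ) * ((if i ∈ I then 1 else 0) - (if j ∈ I then 1 else 0)) else 0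

/-- The coordinate sum over `I` of `∑_{i ≤ r} e_i - r e_{r+1}`. -/
def tiltSum {r : ℕ} (I : Finset (Fin (r + 1))) : ℤ :=
  ((I.erase (Fin.last r)).card : ℤ) - if Fin.last r ∈ I then (r : ℤ) else 0

theorem sum_defVec (r : ℕ) (m : Fin (r + 1) → Fin (r + 1) → ℕ) (M : ℕ) (a : Fin (r + 1) → ℝ)
    (I : Finset (Fin (r + 1))) :
    ∑ i ∈ I, defVec r m M a i = ∑ i ∈ I, a i
      + 1 / (2 * (M : ℝ) * (r : ℝ) ^ 2) * arcBalance m I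
      + (1 / (2 * (M : ℝ) * (r : ℝ) ^ 2)) ^ 2 * tiltSum I := by
  have h₁ : coordSum r I (rootComb r fun i j => (m i j : ℝ)) = arcBalance m I := by
    rw [coordSum_apply, sum_mem_eq_sum_mul,
      sum_mul_rootComb r _ fun k => if k ∈ I then (1 : ℝ) else 0]
    simp only [arcBalance, Int.cast_sum]
    refine Finset.sum_congr rfl fun i _ => Finset.sum_congr rfl fun j _ => ?_
    split_ifs <;> simp
  have h₂ : coordSum r I ((∑ i ∈ Finset.univ.erase (Fin.last r), eVec r i)
      - (r : ℝ) • eVec r (Fin.last r)) = tiltSum I := by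
    rw [map_sub, map_sum, map_smul]
    simp only [coordSum_eVec, tiltSum]
    rw [Finset.sum_boole]
    have : (Finset.univ.erase (Fin.last r)).filter (· ∈ I) = I.erase (Fin.last r) := by
      ext k; simp
    rw [this]
    split_ifs <;> simp
  rw [← coordSum_apply, ← coordSum_apply, defVec, map_add, map_add, map_smul, map_smul, h₂]
  change _ + _ • coordSum r I (rootComb r fun i j => (m i j : ℝ)) + _ = _
  rw [h₁, smul_eq_mul, smul_eq_mul]

theorem abs_tiltSum_le {r : ℕ} (I : Finset (Fin (r + 1))) : |(tiltSum I : ℤ)| ≤ r := by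
  have h : (I.erase (Fin.last r)).card ≤ r := by
    calc (I.erase (Fin.last r)).card ≤ (Finset.univ.erase (Fin.last r)).card :=
          Finset.card_le_card (Finset.erase_subset_erase _ (Finset.subset_univ I))
      _ = r := by simp
  unfold tiltSum
  rw [abs_le]
  split_ifs <;> constructor <;> omega

theorem abs_arcBalance_le {r : ℕ} {m : Fin (r + 1) → Fin (r + 1) → ℕ} {M : ℕ}
    (hM : ∀ i j, m i j ≤ M) (I : Finset (Fin (r + 1))) :
    |arcBalance m I| ≤ M * r ^ 2 := by
  have hterm : ∀ i j : Fin (r + 1), |if i < j then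
      (m i j : ℤ) * ((if i ∈ I then 1 else 0) - (if j ∈ I then 1 else 0)) else 0|
      ≤ if i < j then (M : ℤ) else 0 := by
    intro i j
    have : (m i j : ℤ) ≤ M := by exact_mod_cast hM i j
    split_ifs <;> simp [this]
  calc |arcBalance m I| ≤ ∑ i : Fin (r + 1), ∑ j : Fin (r + 1), if i < j then (M : ℤ) else 0 :=
        (Finset.abs_sum_le_sum_abs _ _).trans <| Finset.sum_le_sum fun i _ =>
          (Finset.abs_sum_le_sum_abs _ _).trans <| Finset.sum_le_sum fun j _ => hterm i j
    _ ≤ ∑ _i : Fin r, ∑ _j : Fin r, (M : ℤ) := by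
        rw [Fin.sum_univ_castSucc]
        have hl : ∑ j : Fin (r + 1), (if Fin.last r < j then (M : ℤ) else 0) = 0 :=
          Finset.sum_eq_zero fun j _ => if_neg (Fin.le_last j).not_gt
        rw [hl, add_zero]
        refine Finset.sum_le_sum fun i _ => ?_
        rw [Fin.sum_univ_succ, if_neg (Fin.zero_le _).not_gt, zero_add]
        refine Finset.sum_le_sum fun j _ => ?_
        split_ifs <;> simp
    _ = M * r ^ 2 := by simp; ring

/-- The sign rules for `A + ε N + ε² V` with `A`, `N`, `V` integers and `ε = 1 / (2 M r²)`. -/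
theorem sign_perturbed {r M : ℕ} (hr : 1 ≤ r) (hM : 1 ≤ M) {A N V : ℤ}
    (hN : |N| ≤ M * r ^ 2) (hV : |V| ≤ r) {D : ℝ}
    (hD : D = A + 1 / (2 * (M : ℝ) * (r : ℝ) ^ 2) * N
      + (1 / (2 * (M : ℝ) * (r : ℝ) ^ 2)) ^ 2 * V) :
    (0 < A → 0 < D) ∧ (A < 0 → D < 0) ∧ (0 < V → D ≠ 0) ∧ (0 ≤ A → 1 ≤ N → 0 < D) := by
  have hr' : (1 : ℝ) ≤ r := by exact_mod_cast hr
  have hM' : (1 : ℝ) ≤ M := by exact_mod_cast hM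
  have hN' : |(N : ℝ)| ≤ M * r ^ 2 := by exact_mod_cast hN
  have hV' : |(V : ℝ)| ≤ r := by exact_mod_cast hV
  set ε : ℝ := 1 / (2 * (M : ℝ) * (r : ℝ) ^ 2) with hε
  have hε0 : 0 < ε := by positivity
  have hεMr : ε * (M * r ^ 2) = 1 / 2 := by rw [hε]; field_simp
  have hεr : ε * r ≤ 1 / 2 := by
    rw [← hεMr]
    have : (r : ℝ) ≤ M * r ^ 2 := by nlinarith [mul_nonneg (sub_nonneg.2 hM') (sq_nonneg (r : ℝ))]
    gcongr
  have hε1 : ε ≤ 1 / 2 := by nlinarith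
  have hεN := abs_le.1 (show |ε * N| ≤ 1 / 2 by
    rw [abs_mul, abs_of_pos hε0, ← hεMr]; gcongr)
  have hεV := abs_le.1 (show |ε * V| ≤ 1 / 2 by
    rw [abs_mul, abs_of_pos hε0]; exact le_trans (by gcongr) hεr)
  have h2V : ε ^ 2 * V = ε * (ε * V) := by ring
  have hup : ε * (ε * V) ≤ 1 / 4 := by nlinarith
  have hlo : -(1 / 4) ≤ ε * (ε * V) := by nlinarith
  rw [h2V] at hD
  have hpos : 0 < A → 0 < D := fun hA => by
    have : (1 : ℝ) ≤ A := by exact_mod_cast hA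
    linarith
  have hneg : A < 0 → D < 0 := fun hA => by
    have : (A : ℝ) ≤ -1 := by exact_mod_cast Int.le_sub_one_of_lt hA
    linarith
  refine ⟨hpos, hneg, fun hV0 => ?_, fun hA hN1 => ?_⟩
  · rcases lt_trichotomy A 0 with hA | hA | hA
    · exact (hneg hA).ne
    · rw [hA, Int.cast_zero, zero_add] at hD
      have hVpos : (0 : ℝ) < V := by exact_mod_cast hV0
      have h2 : 0 < ε * (ε * V) := by positivity
      rcases le_or_gt 0 N with h | h
      · have : (0 : ℝ) ≤ N := by exact_mod_cast h
        have : 0 ≤ ε * N := by positivity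
        linarith
      · have : (N : ℝ) ≤ -1 := by exact_mod_cast Int.le_sub_one_of_lt h
        have : D < 0 := by nlinarith
        exact this.ne
    · exact (hpos hA).ne'
  · have hA' : (0 : ℝ) ≤ A := by exact_mod_cast hA
    have hN1' : (1 : ℝ) ≤ N := by exact_mod_cast hN1
    nlinarith

theorem arcBalance_pos_or_coordSum_eq_zero {r : ℕ} {m : Fin (r + 1) → Fin (r + 1) → ℕ}
    (hspan : ∀ x ∈ ErSet r, x ∈ Submodule.span ℝ
      {v | ∃ i j : Fin (r + 1), i < j ∧ 0 < m i j ∧ v = eVec r i - eVec r j})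
    {I : Finset (Fin (r + 1))} (hI : IsArcClosed m I) :
    1 ≤ arcBalance m I ∨ ∀ x ∈ ErSet r, ∑ i ∈ I, x i = 0 := by
  have hterm : ∀ i j : Fin (r + 1), 0 ≤ if i < j then
      (m i j : ℤ) * ((if i ∈ I then 1 else 0) - (if j ∈ I then 1 else 0)) else 0 := by
    intro i j
    by_cases hm : m i j = 0
    · simp [hm]
    · have := hI i j
      split_ifs <;> simp_all
  have h0 : 0 ≤ arcBalance m I :=
    Finset.sum_nonneg fun i _ => Finset.sum_nonneg fun j _ => hterm i j
  rcases h0.eq_or_lt with h | h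
  · right
    intro x hx
    have hle : Submodule.span ℝ
        {v | ∃ i j : Fin (r + 1), i < j ∧ 0 < m i j ∧ v = eVec r i - eVec r j}
        ≤ LinearMap.ker (coordSum r I) := by
      rw [Submodule.span_le]
      rintro _ ⟨i, j, hij, hm, rfl⟩
      have h₁ := (Finset.sum_eq_zero_iff_of_nonneg
        fun i _ => Finset.sum_nonneg fun j _ => hterm i j).1 h.symm i (Finset.mem_univ i)
      have h₂ := (Finset.sum_eq_zero_iff_of_nonneg fun j _ => hterm i j).1 h₁ j (Finset.mem_univ j)
      rw [if_pos hij, mul_eq_zero] at h₂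
      have h₃ := h₂.resolve_left (by exact_mod_cast hm.ne')
      rw [SetLike.mem_coe, LinearMap.mem_ker, map_sub, coordSum_eVec, coordSum_eVec]
      exact_mod_cast h₃
    have := hle (hspan x hx)
    rwa [LinearMap.mem_ker, coordSum_apply] at this
  · exact Or.inl h

/-- properties of the deformation `def(a)` for integral `a ∈ E_r`:
it is regular, stays in the tope of `a`, and stays in (or out of) the cones
`C(A_r^+)` and `C(Φ)` together with `a`. -/
theorem deformation_properties (r : ℕ) (hr : 1 ≤ r)
    (m : Fin (r + 1) → Fin (r + 1) → ℕ)
    (hm : ∀ i j : Fin (r + 1), ¬ i < j → m i j = 0)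
    (hspan : ∀ x ∈ ErSet r, x ∈ Submodule.span ℝ
      {v | ∃ i j : Fin (r + 1), i < j ∧ 0 < m i j ∧ v = eVec r i - eVec r j})
    (M : ℕ) (hM1 : 1 ≤ M) (hMub : ∀ i j, m i j ≤ M)
    (hMmax : ∃ i j : Fin (r + 1), i < j ∧ m i j = M)
    (a : Fin (r + 1) → ℝ) (haZ : ∀ i, ∃ k : ℤ, a i = (k : ℝ)) (haE : a ∈ ErSet r) :
    IsRegularArp r (defVec r m M a) ∧
    (∀ τ : Set (Fin (r + 1) → ℝ), IsTopeArp r τ → a ∈ τ → defVec r m M a ∈ τ) ∧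
    (a ∈ coneArp r ↔ defVec r m M a ∈ coneArp r) ∧
    (a ∈ conePhi r m ↔ defVec r m M a ∈ conePhi r m) := by
  choose k hk using haZ
  have haI : ∀ I : Finset (Fin (r + 1)), ∑ i ∈ I, a i = ((∑ i ∈ I, k i : ℤ) : ℝ) := fun I => by
    rw [Int.cast_sum]
    exact Finset.sum_congr rfl fun i _ => hk i
  have hsign : ∀ I : Finset (Fin (r + 1)), _ := fun I =>
    sign_perturbed hr hM1 (abs_arcBalance_le hMub I) (abs_tiltSum_le I)
      ((sum_defVec r m M a I).trans (by rw [haI I]))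
  have hdefE : ∑ i, defVec r m M a i = 0 := by
    have ha0 : ∑ i, a i = 0 := haE
    have hN : arcBalance m Finset.univ = 0 := by simp [arcBalance]
    have hV : tiltSum (Finset.univ : Finset (Fin (r + 1))) = 0 := by simp [tiltSum]
    rw [sum_defVec, ha0, hN, hV]
    simp
  have htilt : ∀ I : Finset (Fin (r + 1)), I.Nonempty → Fin.last r ∉ I → 0 < tiltSum I := by
    intro I hI hl
    simp only [tiltSum, hl, if_false, sub_zero, Finset.erase_eq_of_notMem hl]
    exact_mod_cast hI.card_pos
  have hclosed : ∀ I, IsArcClosed m I →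
      (0 ≤ ∑ i ∈ I, a i ↔ 0 ≤ ∑ i ∈ I, defVec r m M a i) := by
    intro I hI
    obtain ⟨-, hneg, -, hpos⟩ := hsign I
    rcases arcBalance_pos_or_coordSum_eq_zero hspan hI with h | h
    · rw [haI I, Int.cast_nonneg_iff]
      refine ⟨fun hA => (hpos hA h).le, fun hD => ?_⟩
      by_contra! hA
      exact absurd (hneg hA) hD.not_gt
    · rw [h a haE, h _ hdefE]
  have hArp : a ∈ coneArp r ↔ defVec r m M a ∈ coneArp r := by
    rw [coneArp_eq_conePhi, mem_conePhi_iff, mem_conePhi_iff]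
    refine and_congr (iff_of_true haE hdefE) (forall₂_congr fun I hI => hclosed I ?_)
    exact fun i j hij _ => hI i j hij one_ne_zero
  refine ⟨?_, ?_, hArp, ?_⟩
  · intro W hW hmem
    obtain ⟨I, hI, hl, hiff⟩ := hW.exists_coordSum hr
    exact (hsign I).2.2.1 (htilt I hI hl) ((hiff _ hdefE).1 hmem)
  · rintro τ ⟨x, -, rfl⟩ ha
    have haF := connectedComponentIn_subset _ _ ha
    have hadj := hArp.1 haF.1
    rw [connectedComponentIn_eq ha]
    refine (convex_segment a (defVec r m M a)).isPreconnected.subset_connectedComponentIn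
      (left_mem_segment ℝ _ _) ?_ (right_mem_segment ℝ _ _)
    rintro _ ⟨s, t, hs, ht, hst, rfl⟩
    have hcomb : ∀ I : Finset (Fin (r + 1)), ∑ i ∈ I, (s • a + t • defVec r m M a) i
        = s * ∑ i ∈ I, a i + t * ∑ i ∈ I, defVec r m M a i := fun I => by
      simp [Finset.sum_add_distrib, Finset.mul_sum]
    have hsum : ∑ i, (s • a + t • defVec r m M a) i = 0 := by
      rw [hcomb, hdefE, show ∑ i, a i = 0 from haE]
      simp
    constructor
    · have haC := haF.1
      rw [coneArp_eq_conePhi, mem_conePhi_iff] at haC hadj ⊢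
      refine ⟨hsum, fun I hI => ?_⟩
      rw [hcomb]
      exact add_nonneg (mul_nonneg hs (haC.2 I hI)) (mul_nonneg ht (hadj.2 I hI))
    · intro hwall
      simp only [wallUnion, Set.mem_iUnion, Set.mem_ofPred_eq, exists_prop] at hwall
      obtain ⟨W, hW, hmem⟩ := hwall
      obtain ⟨I, -, -, hiff⟩ := hW.exists_coordSum hr
      have haW : a ∉ W := fun h => haF.2 (Set.mem_biUnion (show W ∈ {W | IsWallArp r W} from hW) h)
      have hzero := (hiff _ hsum).1 hmem
      rw [hcomb] at hzero
      have hA : ∑ i ∈ I, a i ≠ 0 := fun h => haW ((hiff a haE).2 h)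
      obtain ⟨hpos, hneg, -, -⟩ := hsign I
      rw [haI I] at hA hzero
      rcases lt_or_gt_of_ne (Int.cast_ne_zero.1 hA) with h | h
      · have h₁ := hneg h
        have h₂ : ((∑ i ∈ I, k i : ℤ) : ℝ) < 0 := by exact_mod_cast h
        rcases hs.eq_or_lt with rfl | hs'
        · nlinarith
        · nlinarith [mul_neg_of_pos_of_neg hs' h₂, mul_nonpos_of_nonneg_of_nonpos ht h₁.le]
      · have h₁ := hpos h
        have h₂ : (0 : ℝ) < ((∑ i ∈ I, k i : ℤ) : ℝ) := by exact_mod_cast h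
        rcases hs.eq_or_lt with rfl | hs'
        · nlinarith
        · nlinarith [mul_pos hs' h₂, mul_nonneg ht h₁.le]
  · rw [mem_conePhi_iff, mem_conePhi_iff]
    exact and_congr (iff_of_true haE hdefE) (forall₂_congr hclosed)

end
end

section
/- Fix r ≥ 1. An (r−1)-dimensional linear subspace W of E_r is a wall of A_r^+ (i.e. W is spanned by r−1 linearly independent elements of A_r^+) if and only if there exists a nonempty proper subset J ⊊ {1,…,r+1} such that W = {x ∈ E_r : Σ_{i∈J} x_i = 0}. -/
noncomputable section

/-- The linear functional `x ↦ Σ_{i ∈ J} x_i` on `ℝ^{r+1}`. -/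
def sumFunctional (r : ℕ) (J : Finset (Fin (r + 1))) : (Fin (r + 1) → ℝ) →ₗ[ℝ] ℝ :=
  ∑ i ∈ J, LinearMap.proj i

/-- `E_r` as a submodule: the kernel of `x ↦ Σ_i x_i`. -/
def ErSub (r : ℕ) : Submodule ℝ (Fin (r + 1) → ℝ) :=
  LinearMap.ker (sumFunctional r Finset.univ)

theorem sumFunctional_apply (r : ℕ) (J : Finset (Fin (r + 1))) (x : Fin (r + 1) → ℝ) :
    sumFunctional r J x = ∑ i ∈ J, x i := by
  simp [sumFunctional]

theorem sumFunctional_eVec (r : ℕ) (J : Finset (Fin (r + 1))) (k : Fin (r + 1)) :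
    sumFunctional r J (eVec r k) = if k ∈ J then 1 else 0 := by
  simp [sumFunctional_apply, eVec, Pi.single_apply]

theorem eVec_sub_mem_ErSub (r : ℕ) (i j : Fin (r + 1)) : eVec r i - eVec r j ∈ ErSub r := by
  simp [ErSub, sumFunctional_eVec]

theorem sum_smul_eVec (r : ℕ) (x : Fin (r + 1) → ℝ) : ∑ i, x i • eVec r i = x := by
  ext j
  simp [eVec, Pi.single_apply]

theorem finrank_ErSub (r : ℕ) : Module.finrank ℝ (ErSub r) = r := by
  have hne : sumFunctional r Finset.univ ≠ 0 := fun h => by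
    have := sumFunctional_eVec r Finset.univ 0
    simp [h] at this
  have := Module.Dual.finrank_ker_add_one_of_ne_zero (f := sumFunctional r Finset.univ) hne
  rw [Module.finrank_fin_fun] at this
  exact Nat.succ_injective this

/-- A combination of the `e_i`, `i ∈ J`, with coefficients summing to zero lies in every
submodule containing the differences `e_i - e_a`. -/
theorem sum_smul_eVec_mem (r : ℕ) (J : Finset (Fin (r + 1))) (a : Fin (r + 1))
    (V : Submodule ℝ (Fin (r + 1) → ℝ)) (hV : ∀ i ∈ J, eVec r i - eVec r a ∈ V)
    (x : Fin (r + 1) → ℝ) (hx : ∑ i ∈ J, x i = 0) : ∑ i ∈ J, x i • eVec r i ∈ V := by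
  have h : ∑ i ∈ J, x i • eVec r i = ∑ i ∈ J, x i • (eVec r i - eVec r a) := by
    simp only [smul_sub, Finset.sum_sub_distrib, ← Finset.sum_smul, hx, zero_smul, sub_zero]
  rw [h]
  exact V.sum_mem fun i hi => V.smul_mem _ (hV i hi)

theorem ErSub_le_of_eVec_sub_mem (r : ℕ) (V : Submodule ℝ (Fin (r + 1) → ℝ))
    (hV : ∀ i j, eVec r i - eVec r j ∈ V) : ErSub r ≤ V := fun x hx => by
  rw [← sum_smul_eVec r x]
  refine sum_smul_eVec_mem r _ 0 V (fun i _ => hV i 0) x ?_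
  simpa [ErSub, sumFunctional_apply] using hx

/-- The positive roots lying in `W` have in their span every difference `e_i - e_j ∈ W`. -/
theorem eVec_sub_mem_span_posRoots_inter (r : ℕ) (W : Submodule ℝ (Fin (r + 1) → ℝ))
    (i j : Fin (r + 1)) (h : eVec r i - eVec r j ∈ W) :
    eVec r i - eVec r j ∈ Submodule.span ℝ (posRoots r ∩ W) := by
  rcases lt_trichotomy i j with hij | rfl | hij
  · exact Submodule.subset_span ⟨⟨i, j, hij, rfl⟩, h⟩
  · simp
  · rw [← neg_sub] at h ⊢
    exact neg_mem (Submodule.subset_span ⟨⟨j, i, hij, rfl⟩, neg_mem_iff.mp h⟩)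

theorem span_posRoots_inter_eq (r : ℕ) (J : Finset (Fin (r + 1))) (hJ : J.Nonempty)
    (hJu : J ≠ Finset.univ) :
    Submodule.span ℝ (posRoots r ∩
      (ErSub r ⊓ LinearMap.ker (sumFunctional r J) : Submodule ℝ (Fin (r + 1) → ℝ))) =
      ErSub r ⊓ LinearMap.ker (sumFunctional r J) := by
  refine le_antisymm (Submodule.span_le.mpr Set.inter_subset_right) fun x hx => ?_
  obtain ⟨a, ha⟩ := hJ
  obtain ⟨b, hb⟩ : ∃ b, b ∉ J := by
    by_contra! h
    exact hJu (Finset.eq_univ_iff_forall.mpr h)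
  obtain ⟨hxE, hxJ⟩ := hx
  have hxE' : ∑ i, x i = 0 := by simpa [ErSub, sumFunctional_apply] using hxE
  have hxJ' : ∑ i ∈ J, x i = 0 := by simpa [sumFunctional_apply] using hxJ
  have hxJc : ∑ i ∈ Jᶜ, x i = 0 := by
    have := Finset.sum_add_sum_compl J x
    linarith
  rw [← sum_smul_eVec r x, ← Finset.sum_add_sum_compl J]
  refine add_mem (sum_smul_eVec_mem r J a _ (fun i hi => ?_) x hxJ')
    (sum_smul_eVec_mem r Jᶜ b _ (fun i hi => ?_) x hxJc)
  · refine eVec_sub_mem_span_posRoots_inter r _ i a ⟨eVec_sub_mem_ErSub r i a, ?_⟩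
    simp [sumFunctional_eVec, hi, ha]
  · refine eVec_sub_mem_span_posRoots_inter r _ i b ⟨eVec_sub_mem_ErSub r i b, ?_⟩
    simp [sumFunctional_eVec, Finset.mem_compl.mp hi, hb]

/-- an `(r-1)`-dimensional subspace `W` of `E_r` is a wall of `A_r^+`
iff it is cut out of `E_r` by `Σ_{i ∈ J} x_i = 0` for some nonempty proper subset `J`
of `{1, …, r+1}`. -/
theorem wall_iff_subset_sum_functional (r : ℕ) (hr : 1 ≤ r)
    (W : Submodule ℝ (Fin (r + 1) → ℝ)) (hWE : W ≤ ErSub r)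
    (hdim : Module.finrank ℝ W = r - 1) :
    (∃ s : Finset (Fin (r + 1) → ℝ), (s : Set (Fin (r + 1) → ℝ)) ⊆ posRoots r ∧
        s.card = r - 1 ∧
        LinearIndependent ℝ (Subtype.val : {x // x ∈ s} → (Fin (r + 1) → ℝ)) ∧
        W = Submodule.span ℝ (s : Set (Fin (r + 1) → ℝ))) ↔
    (∃ J : Finset (Fin (r + 1)), J.Nonempty ∧ J ≠ Finset.univ ∧
        W = ErSub r ⊓ LinearMap.ker (sumFunctional r J)) := by
  constructor
  · classical
    rintro ⟨s, hs, -, -, hW⟩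
    obtain ⟨i, j, hij⟩ : ∃ i j, eVec r i - eVec r j ∉ W := by
      by_contra! h
      have hle := Submodule.finrank_mono (ErSub_le_of_eVec_sub_mem r W h)
      rw [finrank_ErSub] at hle
      omega
    set J : Finset (Fin (r + 1)) := Finset.univ.filter fun k => eVec r i - eVec r k ∈ W with hJ
    have hmem : ∀ k, k ∈ J ↔ eVec r i - eVec r k ∈ W := by simp [hJ]
    have hi : i ∈ J := by simp [hmem]
    have hj : j ∉ J := by simpa [hmem] using hij
    have hker : W ≤ LinearMap.ker (sumFunctional r J) := by
      conv_lhs => rw [hW]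
      refine Submodule.span_le.mpr fun v hv => ?_
      have hvW : v ∈ W := hW ▸ Submodule.subset_span hv
      obtain ⟨k, l, -, rfl⟩ := hs hv
      have hkl : k ∈ J ↔ l ∈ J := by
        rw [hmem, hmem, ← sub_add_sub_cancel (eVec r i) (eVec r k) (eVec r l)]
        exact (Submodule.add_mem_iff_left W hvW).symm
      simp [sumFunctional_eVec, hkl]
    refine ⟨J, ⟨i, hi⟩, fun h => hj (h ▸ Finset.mem_univ j), ?_⟩
    refine Submodule.eq_of_le_of_finrank_le (le_inf hWE hker) ?_
    have hlt : ErSub r ⊓ LinearMap.ker (sumFunctional r J) < ErSub r := by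
      refine lt_of_le_of_ne inf_le_left fun h => ?_
      have := (inf_eq_left.mp h) (eVec_sub_mem_ErSub r i j)
      simp [sumFunctional_eVec, hi, hj] at this
    have := Submodule.finrank_lt_finrank_of_lt hlt
    rw [finrank_ErSub] at this
    omega
  · rintro ⟨J, hJ, hJu, hW⟩
    have hspan := span_posRoots_inter_eq r J hJ hJu
    rw [← hW] at hspan
    obtain ⟨b, hb, hbspan, hbli⟩ := exists_linearIndependent ℝ (posRoots r ∩ (W : Set _))
    have hfin : b.Finite := hbli.setFinite
    lift b to Finset (Fin (r + 1) → ℝ) using hfin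
    refine ⟨b, hb.trans Set.inter_subset_left, ?_, hbli, (hbspan.trans hspan).symm⟩
    rw [← hdim, ← hspan, ← hbspan]
    exact (finrank_span_finset_eq_card hbli).symm

end
end

section
/- Let I be a combinatorial chamber and let W be an essential wall of F(I). Then: (1) I = I(W|facet) ∪ I(W|cut); (2) I(W|facet) ≠ ∅; (3) for every ν ⊆ {1,…,N} consisting of r−1 indices with {φ_i : i ∈ ν} linearly independent and spanning W, one has δ⁻(ν) ∩ I = ∅, and if δ⁺(ν) ∩ I ≠ ∅ then δ⁺(ν) ⊆ I; (4) if I(W|cut) ≠ ∅, then the set (⋂_{σ∈I(W|cut)} interior(C(σ))) ∩ W is nonempty (equivalently, it intersects W in a set of affine dimension r−1). -/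
noncomputable section

/-- `σ ∈ I(W|facet)` relative to a defining functional `f` for the wall `W`:
`|σ ∩ zeros(W)| = r - 1`. -/
def FacetOf {N r : ℕ} (φ : Fin N → (Fin r → ℝ)) (f : (Fin r → ℝ) →ₗ[ℝ] ℝ)
    (σ : Finset (Fin N)) : Prop :=
  ((σ : Set (Fin N)) ∩ {i | f (φ i) = 0}).ncard = r - 1

/-- `σ ∈ I(W|cut)` relative to a defining functional `f` for the wall `W`:
`σ` meets both open sides of `W`. -/
def CutOf {N r : ℕ} (φ : Fin N → (Fin r → ℝ)) (f : (Fin r → ℝ) →ₗ[ℝ] ℝ)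
    (σ : Finset (Fin N)) : Prop :=
  (∃ i ∈ σ, 0 < f (φ i)) ∧ (∃ i ∈ σ, f (φ i) < 0)

/-- A basic subset has a dual family of coordinate functionals. -/
lemma IsBasic.exists_dual {N r : ℕ} {φ : Fin N → (Fin r → ℝ)} {σ : Finset (Fin N)}
    (hσ : IsBasic φ σ) :
    ∃ ξ : Fin N → ((Fin r → ℝ) →ₗ[ℝ] ℝ), (∀ y, y = ∑ i, ξ i y • φ i) ∧
      (∀ i, i ∉ σ → ξ i = 0) ∧ (∀ i ∈ σ, ξ i (φ i) = 1) ∧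
      (∀ i j, j ∈ σ → i ≠ j → ξ i (φ j) = 0) := by
  classical
  obtain ⟨hcard, hli⟩ := hσ
  have hfin : Fintype.card {i // i ∈ σ} = Module.finrank ℝ (Fin r → ℝ) := by simp [hcard]
  let b : Module.Basis {i // i ∈ σ} ℝ (Fin r → ℝ) :=
    Module.Basis.mk hli (hli.span_eq_top_of_card_eq_finrank' hfin).ge
  have hb : ∀ i, b i = φ i := fun i => by simp [b]
  refine ⟨fun i => if h : i ∈ σ then b.coord ⟨i, h⟩ else 0, fun y => ?_, fun i hi => by simp [hi],
    fun i hi => ?_, fun i j hj hij => ?_⟩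
  · have h := b.sum_repr y
    have h' : ∑ i ∈ σ, (if h : i ∈ σ then b.coord ⟨i, h⟩ else 0) y • φ i = y := by
      rw [← Finset.sum_coe_sort]
      conv_rhs => rw [← h]
      exact Finset.sum_congr rfl fun i _ => by simp [hb]
    rw [← Finset.sum_subset (Finset.subset_univ σ), h']
    intro i _ hi
    simp [hi]
  · simp [hi, ← hb ⟨i, hi⟩]
  · by_cases hi : i ∈ σ
    · have : (⟨j, hj⟩ : {i // i ∈ σ}) ≠ ⟨i, hi⟩ := fun h => hij (congrArg Subtype.val h).symm
      simp [hi, ← hb ⟨j, hj⟩, Finsupp.single_eq_of_ne this.symm]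
    · simp [hi]

lemma nonneg_of_mem_coneOf {N r : ℕ} {φ : Fin N → (Fin r → ℝ)} {σ : Finset (Fin N)}
    (g : (Fin r → ℝ) →ₗ[ℝ] ℝ) (hg : ∀ i ∈ σ, 0 ≤ g (φ i)) {y : Fin r → ℝ}
    (hy : y ∈ coneOf φ σ) : 0 ≤ g y := by
  obtain ⟨c, hc, hcσ, rfl⟩ := hy
  rw [map_sum]
  refine Finset.sum_nonneg fun i _ => ?_
  by_cases hi : i ∈ σ
  · simpa using mul_nonneg (hc i) (hg i hi)
  · simp [hcσ i hi]

lemma coneOf_mono {N r : ℕ} (φ : Fin N → (Fin r → ℝ)) {σ τ : Finset (Fin N)} (h : σ ⊆ τ) :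
    coneOf φ σ ⊆ coneOf φ τ := by
  rintro y ⟨c, hc, hcσ, rfl⟩
  exact ⟨c, hc, fun i hi => hcσ i fun h' => hi (h h'), rfl⟩

lemma convex_coneOf {N r : ℕ} (φ : Fin N → (Fin r → ℝ)) (σ : Finset (Fin N)) :
    Convex ℝ (coneOf φ σ) := by
  rintro x ⟨c, hc, hcσ, rfl⟩ y ⟨d, hd, hdσ, rfl⟩ a b ha hb _
  refine ⟨fun i => a * c i + b * d i,
    fun i => add_nonneg (mul_nonneg ha (hc i)) (mul_nonneg hb (hd i)),
    fun i hi => by simp [hcσ i hi, hdσ i hi], ?_⟩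
  simp only [Finset.smul_sum, smul_smul, add_smul, Finset.sum_add_distrib]

lemma zero_mem_coneOf {N r : ℕ} (φ : Fin N → (Fin r → ℝ)) (σ : Finset (Fin N)) :
    0 ∈ coneOf φ σ :=
  ⟨0, fun _ => le_rfl, fun _ _ => rfl, by simp⟩

lemma add_mem_coneOf {N r : ℕ} {φ : Fin N → (Fin r → ℝ)} {σ : Finset (Fin N)}
    {x y : Fin r → ℝ} (hx : x ∈ coneOf φ σ) (hy : y ∈ coneOf φ σ) : x + y ∈ coneOf φ σ := by
  obtain ⟨c, hc, hcσ, rfl⟩ := hx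
  obtain ⟨d, hd, hdσ, rfl⟩ := hy
  exact ⟨c + d, fun i => add_nonneg (hc i) (hd i), fun i hi => by simp [hcσ i hi, hdσ i hi],
    by simp [add_smul, Finset.sum_add_distrib]⟩

lemma convex_Fcone {N r : ℕ} (φ : Fin N → (Fin r → ℝ)) (I : Set (Finset (Fin N))) :
    Convex ℝ (Fcone φ I) :=
  convex_iInter₂ fun σ _ => convex_coneOf φ σ

lemma Fcone_subset {N r : ℕ} (φ : Fin N → (Fin r → ℝ)) {I : Set (Finset (Fin N))}
    {σ : Finset (Fin N)} (hσ : σ ∈ I) : Fcone φ I ⊆ coneOf φ σ :=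
  Set.biInter_subset_of_mem hσ

/-- A point all of whose coordinates are positive is interior to the simplicial cone. -/
lemma mem_interior_coneOf {N r : ℕ} {φ : Fin N → (Fin r → ℝ)} {σ : Finset (Fin N)}
    {ξ : Fin N → ((Fin r → ℝ) →ₗ[ℝ] ℝ)} (hξ : ∀ y, y = ∑ i, ξ i y • φ i)
    (hξσ : ∀ i, i ∉ σ → ξ i = 0) {y : Fin r → ℝ} (hy : ∀ i ∈ σ, 0 < ξ i y) :
    y ∈ interior (coneOf φ σ) := by
  have hopen : IsOpen (⋂ i ∈ σ, {z | 0 < ξ i z}) :=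
    isOpen_biInter_finset fun i _ =>
      isOpen_lt continuous_const (ξ i).continuous_of_finiteDimensional
  refine interior_maximal (fun z hz => ?_) hopen (by simpa using hy)
  simp only [Set.mem_iInter, Set.mem_ofPred_eq] at hz
  refine ⟨fun i => ξ i z, fun i => ?_, fun i hi => by simp [hξσ i hi], hξ z⟩
  by_cases hi : i ∈ σ
  · exact (hz i hi).le
  · simp [hξσ i hi]

/-- A nonzero functional that is nonnegative on a set is positive on the interior of the set. -/
lemma pos_of_mem_interior {r : ℕ} {f : (Fin r → ℝ) →ₗ[ℝ] ℝ} (hf : f ≠ 0)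
    {s : Set (Fin r → ℝ)} (hs : ∀ x ∈ s, 0 ≤ f x) {x : Fin r → ℝ} (hx : x ∈ interior s) :
    0 < f x := by
  have hopen : IsOpenMap f := f.isOpenMap_of_finiteDimensional (LinearMap.surjective hf)
  have h : f x ∈ interior (Set.Ici (0 : ℝ)) :=
    interior_maximal (by rintro _ ⟨z, hz, rfl⟩; exact hs z (interior_subset hz))
      (hopen _ isOpen_interior) ⟨x, hx, rfl⟩
  simpa using h

/-- If `f` does not vanish at `φ j`, then a coordinate functional along `φ i` which is zero
at `φ j` does not vanish identically on the kernel of `f`. -/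
lemma exists_coord_ne_zero {N r : ℕ} {φ : Fin N → (Fin r → ℝ)}
    {g f : (Fin r → ℝ) →ₗ[ℝ] ℝ} {i j : Fin N}
    (hi : g (φ i) = 1) (hj : g (φ j) = 0) (hfj : f (φ j) ≠ 0) :
    ∃ x ∈ LinearMap.ker f, g x ≠ 0 := by
  refine ⟨f (φ j) • φ i - f (φ i) • φ j, ?_, ?_⟩
  · simp [mul_comm]
  · simpa [hi, hj] using hfj

/-- A point in the relative interior of `F(I) ∩ W`, as detected by linear functionals. -/
lemma exists_generic_point {N r : ℕ} (φ : Fin N → (Fin r → ℝ)) (I : Set (Finset (Fin N)))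
    (W : Submodule ℝ (Fin r → ℝ)) (hW : W ≤ Submodule.span ℝ (Fcone φ I ∩ W)) :
    ∃ x ∈ Fcone φ I ∩ W, ∀ g : (Fin r → ℝ) →ₗ[ℝ] ℝ, (∀ z ∈ Fcone φ I ∩ W, 0 ≤ g z) →
      (∃ z ∈ W, g z ≠ 0) → 0 < g x := by
  obtain ⟨b, hb, hbspan, hbli⟩ := exists_linearIndependent ℝ (Fcone φ I ∩ (W : Set (Fin r → ℝ)))
  have hbfin : b.Finite := hbli.setFinite
  have hmem : ∀ t : Finset (Fin r → ℝ), (∀ z ∈ t, z ∈ Fcone φ I ∩ W) →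
      ∑ z ∈ t, z ∈ Fcone φ I ∩ W := by
    intro t ht
    refine ⟨?_, W.sum_mem fun z hz => (ht z hz).2⟩
    simp only [Fcone, Set.mem_iInter]
    intro σ hσ
    refine Finset.sum_induction (fun z => z) (· ∈ coneOf φ σ) (fun _ _ => add_mem_coneOf)
      (zero_mem_coneOf φ σ) fun z hz => Fcone_subset φ hσ (ht z hz).1
  refine ⟨∑ z ∈ hbfin.toFinset, z, hmem _ fun z hz => hb (by simpa using hz), fun g hg hgW => ?_⟩
  have hnn : ∀ z ∈ hbfin.toFinset, 0 ≤ g z := fun z hz => hg z (hb (by simpa using hz))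
  rw [map_sum]
  refine (Finset.sum_nonneg hnn).lt_of_ne' fun h0 => ?_
  rw [Finset.sum_eq_zero_iff_of_nonneg hnn] at h0
  obtain ⟨z, hzW, hz⟩ := hgW
  have hle : Submodule.span ℝ b ≤ LinearMap.ker g :=
    Submodule.span_le.2 fun y hy => h0 y (by simpa using hy)
  exact hz (hle (hbspan ▸ hW hzW))

lemma le_span_of_finrank_vectorSpan {r n : ℕ} {s : Set (Fin r → ℝ)}
    {W : Submodule ℝ (Fin r → ℝ)} (hn : Module.finrank ℝ W = n)
    (h : Module.finrank ℝ (vectorSpan ℝ (s ∩ W)) = n) : W ≤ Submodule.span ℝ (s ∩ W) := by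
  have hle : vectorSpan ℝ (s ∩ (W : Set (Fin r → ℝ))) ≤ Submodule.span ℝ (s ∩ W) := by
    refine Submodule.span_le.2 ?_
    rintro _ ⟨x, hx, y, hy, rfl⟩
    exact Submodule.sub_mem _ (Submodule.subset_span hx) (Submodule.subset_span hy)
  have hle' : Submodule.span ℝ (s ∩ W) ≤ W := Submodule.span_le.2 Set.inter_subset_right
  exact (Submodule.eq_of_le_of_finrank_eq (hle.trans hle') (h.trans hn.symm)).ge.trans hle

lemma finrank_of_isWall {N r : ℕ} {φ : Fin N → (Fin r → ℝ)} {W : Submodule ℝ (Fin r → ℝ)}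
    (hW : IsWall φ W) : Module.finrank ℝ W = r - 1 := by
  obtain ⟨s, hs, hli, rfl⟩ := hW
  have h := finrank_span_eq_card hli
  have hr : Set.range (fun i : {i // i ∈ s} => φ i) = φ '' (s : Set (Fin N)) := by
    ext y; simp
  rw [hr] at h
  simpa [hs] using h

lemma isBasic_insert {N r : ℕ} {φ : Fin N → (Fin r → ℝ)} (hr : r ≠ 0) {ν : Finset (Fin N)}
    (hν : ν.card = r - 1) (hli : LinearIndependent ℝ (fun i : {i // i ∈ ν} => φ i)) {j : Fin N}
    (hj : φ j ∉ Submodule.span ℝ (φ '' (ν : Set (Fin N)))) : IsBasic φ (insert j ν) := by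
  have hjν : j ∉ ν := fun h => hj (Submodule.subset_span ⟨j, h, rfl⟩)
  refine ⟨by rw [Finset.card_insert_of_notMem hjν]; omega, ?_⟩
  have h : LinearIndepOn ℝ φ (insert j (ν : Set (Fin N))) := LinearIndepOn.insert hli hj
  rw [← Finset.coe_insert] at h
  exact h

/-- A chamber contains every basic subset that remains feasible with it. -/
lemma IsChamber.mem_of_interior {N r : ℕ} {φ : Fin N → (Fin r → ℝ)} {I : Set (Finset (Fin N))}
    (hI : IsChamber φ I) {τ : Finset (Fin N)} (hτ : IsBasic φ τ) {y : Fin r → ℝ}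
    (hy : y ∈ interior (Fcone φ I)) (hyτ : y ∈ interior (coneOf φ τ)) : τ ∈ I := by
  obtain ⟨hbas, -, hmax⟩ := hI
  rw [← hmax (insert τ I) (Set.subset_insert _ _) (by simpa [hτ] using hbas)
    ⟨y, by
      rw [Fcone, Set.biInter_insert, interior_inter]
      exact ⟨hyτ, hy⟩⟩]
  exact Set.mem_insert _ _

/-- A basic subset with a single vector off the wall is of facet type. -/
lemma facetOf_of_forall_ne {N r : ℕ} {φ : Fin N → (Fin r → ℝ)} {f : (Fin r → ℝ) →ₗ[ℝ] ℝ}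
    {σ : Finset (Fin N)} (hσ : σ.card = r) {i : Fin N} (hi : i ∈ σ) (hfi : f (φ i) ≠ 0)
    (h : ∀ j ∈ σ, j ≠ i → f (φ j) = 0) : FacetOf φ f σ := by
  have hset : (σ : Set (Fin N)) ∩ {i | f (φ i) = 0} = (σ.erase i : Finset (Fin N)) := by
    ext j
    simp only [Set.mem_inter_iff, Finset.mem_coe, Set.mem_ofPred_eq, Finset.mem_erase]
    exact ⟨fun ⟨hj, hfj⟩ => ⟨fun hji => hfi (hji ▸ hfj), hj⟩, fun ⟨hji, hj⟩ => ⟨hj, h j hj hji⟩⟩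
  rw [FacetOf, hset, Set.ncard_coe_finset, Finset.card_erase_of_mem hi, hσ]

/-- necessary conditions satisfied by an essential wall `W` of `F(I)`.
The wall is presented by a linear functional `f` with `ker f = W`, nonnegative on
`F(I)`; essentiality is the condition that `F(I) ∩ W` has affine dimension `r - 1`. -/
theorem essential_wall_necessary_conditions
    {N r : ℕ} (φ : Fin N → (Fin r → ℝ)) (hφ : ∀ i, φ i ≠ 0)
    (hspan : Submodule.span ℝ (Set.range φ) = ⊤)
    (I : Set (Finset (Fin N))) (hI : IsChamber φ I)
    (W : Submodule ℝ (Fin r → ℝ)) (hW : IsWall φ W)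
    (f : (Fin r → ℝ) →ₗ[ℝ] ℝ) (hker : LinearMap.ker f = W)
    (hside : ∀ x ∈ Fcone φ I, 0 ≤ f x)
    (hdim : Module.finrank ℝ
      (vectorSpan ℝ (Fcone φ I ∩ (W : Set (Fin r → ℝ)))) = r - 1) :
    (I = {σ | σ ∈ I ∧ FacetOf φ f σ} ∪ {σ | σ ∈ I ∧ CutOf φ f σ}) ∧
    ({σ | σ ∈ I ∧ FacetOf φ f σ}.Nonempty) ∧
    (∀ ν : Finset (Fin N), ν.card = r - 1 →
      LinearIndependent ℝ (fun i : {i // i ∈ ν} => φ i) →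
      Submodule.span ℝ (φ '' (ν : Set (Fin N))) = W →
      (∀ i, f (φ i) < 0 → insert i ν ∉ I) ∧
      ((∃ i, 0 < f (φ i) ∧ insert i ν ∈ I) → ∀ i, 0 < f (φ i) → insert i ν ∈ I)) ∧
    ({σ | σ ∈ I ∧ CutOf φ f σ}.Nonempty →
      ((⋂ σ ∈ {σ | σ ∈ I ∧ CutOf φ f σ}, interior (coneOf φ σ)) ∩
          (W : Set (Fin r → ℝ))).Nonempty) := by
  rcases eq_or_ne r 0 with rfl | hr
  · have hN : IsEmpty (Fin N) := ⟨fun i => hφ i (Subsingleton.elim _ _)⟩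
    have hfacet : ∀ σ : Finset (Fin N), FacetOf φ f σ := fun σ => by
      simp [FacetOf, Set.eq_empty_of_isEmpty]
    obtain ⟨y, hy⟩ := hI.2.1
    have hempty : (∅ : Finset (Fin N)) ∈ I := by
      refine hI.mem_of_interior ⟨by simp, linearIndependent_empty_type⟩ hy ?_
      have : coneOf φ ∅ = Set.univ :=
        Set.eq_univ_of_forall fun z => Subsingleton.elim 0 z ▸ zero_mem_coneOf φ ∅
      simp [this]
    refine ⟨?_, ⟨∅, hempty, hfacet _⟩, fun ν _ _ _ => ⟨isEmptyElim, fun ⟨i, _⟩ => isEmptyElim i⟩,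
      fun ⟨σ, _, ⟨i, _⟩, _⟩ => isEmptyElim i⟩
    ext σ
    simpa [hfacet σ] using fun h _ => h
  have hWr := finrank_of_isWall hW
  have hf : f ≠ 0 := by
    rintro rfl
    rw [← hker, LinearMap.ker_zero, finrank_top, Module.finrank_fin_fun] at hWr
    omega
  obtain ⟨x, hx, hgen⟩ := exists_generic_point φ I W (le_span_of_finrank_vectorSpan hWr hdim)
  have hfW : ∀ z ∈ W, f z = 0 := fun z hz => by rwa [← hker] at hz
  obtain ⟨y, hy⟩ := hI.2.1
  have hfy : 0 < f y := pos_of_mem_interior hf hside hy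
  have hpos : ∀ σ ∈ I, ∃ i ∈ σ, 0 < f (φ i) := by
    intro σ hσ
    by_contra! hneg
    have := nonneg_of_mem_coneOf (-f) (fun i hi => by simpa using hneg i hi)
      (Fcone_subset φ hσ (interior_subset hy))
    simp only [LinearMap.neg_apply] at this
    linarith
  have hcut : ∀ σ ∈ I, CutOf φ f σ → x ∈ interior (coneOf φ σ) := by
    rintro σ hσ ⟨⟨a, ha, hfa⟩, b, hb, hfb⟩
    obtain ⟨ξ, hξ, hξσ, hξ1, hξ0⟩ := (hI.1 σ hσ).exists_dual
    refine mem_interior_coneOf hξ hξσ fun i hi => hgen _ (fun z hz => ?_) ?_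
    · refine nonneg_of_mem_coneOf (ξ i) (fun j hj => ?_) (Fcone_subset φ hσ hz.1)
      rcases eq_or_ne i j with rfl | hij
      · simp [hξ1 i hi]
      · exact (hξ0 i j hj hij).ge
    · rw [← hker]
      rcases eq_or_ne i a with rfl | hia
      · have hib : i ≠ b := by rintro rfl; linarith
        exact exists_coord_ne_zero (hξ1 i hi) (hξ0 i b hb hib) hfb.ne
      · exact exists_coord_ne_zero (hξ1 i hi) (hξ0 i a ha hia) hfa.ne'
  have hfc : ∀ σ ∈ I, FacetOf φ f σ ∨ CutOf φ f σ := by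
    intro σ hσ
    by_cases hneg : ∃ i ∈ σ, f (φ i) < 0
    · exact Or.inr ⟨hpos σ hσ, hneg⟩
    push Not at hneg
    obtain ⟨i, hi, hfi⟩ := hpos σ hσ
    refine Or.inl (facetOf_of_forall_ne (hI.1 σ hσ).1 hi hfi.ne' fun j hj hji => ?_)
    by_contra hfj
    obtain ⟨ξ, hξ, hξσ, hξ1, hξ0⟩ := (hI.1 σ hσ).exists_dual
    have hle : ∀ z ∈ coneOf φ σ, 0 ≤ (f - f (φ i) • ξ i) z := by
      refine fun z hz => nonneg_of_mem_coneOf _ (fun k hk => ?_) hz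
      rcases eq_or_ne i k with rfl | hik
      · simp [hξ1 i hi]
      · simpa [hξ0 i k hk hik] using hneg k hk
    have hge : ∀ z ∈ coneOf φ σ, 0 ≤ ξ i z := by
      refine fun z hz => nonneg_of_mem_coneOf _ (fun k hk => ?_) hz
      rcases eq_or_ne i k with rfl | hik
      · simp [hξ1 i hi]
      · simp [hξ0 i k hk hik]
    have hxi : 0 < ξ i x := by
      refine hgen _ (fun z hz => hge z (Fcone_subset φ hσ hz.1)) ?_
      rw [← hker]
      exact exists_coord_ne_zero (hξ1 i hi) (hξ0 i j hj hji.symm) hfj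
    have := hle x (Fcone_subset φ hσ hx.1)
    simp only [LinearMap.sub_apply, LinearMap.smul_apply, smul_eq_mul, hfW x hx.2] at this
    nlinarith [mul_pos hfi hxi]
  refine ⟨?_, ?_, fun ν hν hli hνW => ⟨fun i hfi hmem => ?_, ?_⟩, fun _ => ⟨x, ?_, hx.2⟩⟩
  · ext σ
    simp only [Set.mem_union, Set.mem_ofPred_eq, ← and_or_left]
    exact ⟨fun h => ⟨h, hfc σ h⟩, And.left⟩
  · by_contra hempty
    have hint : x ∈ interior (Fcone φ I) := by
      rw [Fcone, (Set.toFinite I).interior_biInter]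
      refine Set.mem_iInter₂.2 fun σ hσ => hcut σ hσ ?_
      exact (hfc σ hσ).resolve_left fun h => hempty ⟨σ, hσ, h⟩
    exact (pos_of_mem_interior hf hside hint).ne' (hfW x hx.2)
  · obtain ⟨k, hk, hfk⟩ := hpos _ hmem
    rcases Finset.mem_insert.1 hk with rfl | hk
    · linarith
    · exact hfk.ne' (hfW _ (hνW ▸ Submodule.subset_span ⟨k, hk, rfl⟩))
  · rintro ⟨i, hfi, hmem⟩ j hfj
    have hfν : ∀ k ∈ ν, φ k ∈ W := fun k hk => hνW ▸ Submodule.subset_span ⟨k, hk, rfl⟩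
    have hiν : i ∉ ν := fun h => hfi.ne' (hfW _ (hfν i h))
    have hjν : j ∉ ν := fun h => hfj.ne' (hfW _ (hfν j h))
    have hτ : IsBasic φ (insert j ν) :=
      isBasic_insert hr hν hli fun h => hfj.ne' (hfW _ (hνW ▸ h))
    obtain ⟨ζ, hζ, hζτ, hζ1, hζ0⟩ := hτ.exists_dual
    have hζj : ∀ z, f z = ζ j z * f (φ j) := by
      intro z
      conv_lhs => rw [hζ z, map_sum]
      rw [Finset.sum_eq_single j]
      · simp
      · intro k _ hkj
        by_cases hk : k ∈ ν
        · simp [hfW _ (hfν k hk)]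
        · simp [hζτ k (by simp [hkj, hk])]
      · simp
    have hζx : ∀ k ∈ ν, 0 < ζ k x := by
      intro k hk
      have hkτ : k ∈ insert j ν := Finset.mem_insert_of_mem hk
      refine hgen _ (fun z hz => ?_) ⟨φ k, hfν k hk, by simp [hζ1 k hkτ]⟩
      have hzν : z ∈ coneOf φ ν := by
        obtain ⟨c, hc, hcσ, rfl⟩ := Fcone_subset φ hmem hz.1
        refine ⟨c, hc, fun l hl => ?_, rfl⟩
        rcases eq_or_ne l i with rfl | hli'
        · have h0 := hfW _ hz.2
          rw [map_sum, Finset.sum_eq_single l] at h0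
          · simpa [hfi.ne'] using h0
          · intro m _ hml
            by_cases hm : m ∈ ν
            · simp [hfW _ (hfν m hm)]
            · simp [hcσ m (by simp [hml, hm])]
          · simp
        · exact hcσ l (by simp [hli', hl])
      refine nonneg_of_mem_coneOf (ζ k) (fun l hl => ?_) hzν
      rcases eq_or_ne k l with rfl | hkl
      · simp [hζ1 k hkτ]
      · exact (hζ0 k l (Finset.mem_insert_of_mem hl) hkl).ge
    have hev : ∀ᶠ t : ℝ in nhdsWithin 0 (Set.Ioi 0),
        ∀ k ∈ ν, 0 < ζ k (t • y + (1 - t) • x) := by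
      refine (Filter.eventually_all_finset ν).2 fun k hk => nhdsWithin_le_nhds ?_
      have hcont : Continuous fun t : ℝ => ζ k (t • y + (1 - t) • x) :=
        (ζ k).continuous_of_finiteDimensional.comp (by fun_prop)
      exact hcont.continuousAt.eventually (lt_mem_nhds (by simpa using hζx k hk))
    have hlt : ∀ᶠ t : ℝ in nhdsWithin 0 (Set.Ioi 0), t ∈ Set.Ioo (0 : ℝ) 1 :=
      Ioo_mem_nhdsGT one_pos
    obtain ⟨t, ht, ht0, ht1⟩ := (hev.and hlt).exists
    refine hI.mem_of_interior hτ (y := t • y + (1 - t) • x)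
      ((convex_Fcone φ I).combo_interior_self_mem_interior hy hx.1 ht0 (by linarith) (by ring))
      (mem_interior_coneOf hζ hζτ fun k hk => ?_)
    rcases Finset.mem_insert.1 hk with rfl | hk
    · have h := hζj (t • y + (1 - t) • x)
      simp only [map_add, map_smul, hfW x hx.2, smul_eq_mul, mul_zero, add_zero] at h ⊢
      exact pos_of_mul_pos_left (h ▸ mul_pos ht0 hfy) hfj.le
    · exact ht k hk
  · exact Set.mem_iInter₂.2 fun σ hσ => hcut σ hσ.1 hσ.2


end
end
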